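/- arXiv:1712.01791 — 4 statements merged into one kernel-verified Lean document; each statement's English description precedes it below -/
import Mathlib

section
/- There is a universal constant c > 0 such that for every isotropic logconcave probability density p on ℝⁿ and every 0 < ε ≤ c, P_{x∼p}( ‖x‖₂² ≤ ε·n ) ≤ ε^{c·√n}. -/
open MeasureTheory Real Filter
open scoped RealInnerProductSpace Topology

noncomputable section

/-- Euclidean space `ℝⁿ`. -/
abbrev En (n : ℕ) := EuclideanSpace ℝ (Fin n)

/-- A nonnegative function which is logconcave. -/
def IsLogConcave {n : ℕ} (p : En n → ℝ) : Prop :=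
  (∀ x, 0 ≤ p x) ∧
  ∀ x y : En n, ∀ t : ℝ, 0 ≤ t → t ≤ 1 →
    p x ^ t * p y ^ (1 - t) ≤ p (t • x + (1 - t) • y)

/-- A probability density on `ℝⁿ` (w.r.t. Lebesgue measure). -/
def IsDensity {n : ℕ} (p : En n → ℝ) : Prop :=
  Integrable p ∧ (∫ x, p x) = 1

/-- The measure of a set under the density `p`. -/
def pmeas {n : ℕ} (p : En n → ℝ) (S : Set (En n)) : ℝ := ∫ x in S, p x

/-- Mean of the density `p`. -/
def pmean {n : ℕ} (p : En n → ℝ) : En n := ∫ x, p x • x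

/-- Covariance matrix of the density `p`. -/
def pcov {n : ℕ} (p : En n → ℝ) : Matrix (Fin n) (Fin n) ℝ :=
  fun i j => ∫ x, p x * ((x i - pmean p i) * (x j - pmean p j))

/-- Isotropic: mean zero and identity covariance. -/
def IsIsotropic {n : ℕ} (p : En n → ℝ) : Prop :=
  pmean p = 0 ∧ pcov p = 1

/-- Boundary measure `p(∂S)`, via the lower Minkowski content. -/
def bm {n : ℕ} (p : En n → ℝ) (S : Set (En n)) : ℝ :=
  liminf (fun ε : ℝ => (pmeas p (Metric.thickening ε S) - pmeas p S) / ε) (𝓝[>] 0)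

end

open scoped ENNReal NNReal Pointwise

/-- One-dimensional Brunn–Minkowski inequality. -/
theorem volume_add_le_of_add_mem {A B C : Set ℝ} (hA : MeasurableSet A) (hB : MeasurableSet B)
    (hA' : A.Nonempty) (hB' : B.Nonempty) (h : ∀ x ∈ A, ∀ y ∈ B, x + y ∈ C) :
    volume A + volume B ≤ volume C := by
  have key : ∀ K L : Set ℝ, K ⊆ A → L ⊆ B → IsCompact K → IsCompact L → K.Nonempty → L.Nonempty →
      volume K + volume L ≤ volume C := by
    intro K L hKA hLB hK hL hKn hLn
    obtain ⟨k, hkK, hk⟩ := hK.exists_isGreatest hKn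
    obtain ⟨l, hlL, hl⟩ := hL.exists_isLeast hLn
    have h1 : volume ((fun x => x + l) '' K) = volume K := by
      simp
    have h2 : volume ((fun x => k + x) '' L) = volume L := by
      simp
    have hm : MeasurableSet ((fun x => k + x) '' L) := (hL.image (by fun_prop)).measurableSet
    have hd : AEDisjoint volume ((fun x => x + l) '' K) ((fun x => k + x) '' L) := by
      refine measure_mono_null (t := {k + l}) ?_ (by simp)
      rintro z ⟨⟨x, hx, rfl⟩, ⟨y, hy, hxy⟩⟩
      have h3 := hk hx
      have h4 := hl hy
      simp only [Set.mem_singleton_iff] at *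
      linarith
    rw [← h1, ← h2, ← measure_union₀ hm.nullMeasurableSet hd]
    apply measure_mono
    rintro z (⟨x, hx, rfl⟩ | ⟨y, hy, rfl⟩)
    · exact h _ (hKA hx) _ (hLB hlL)
    · exact h _ (hKA hkK) _ (hLB hy)
  obtain ⟨a, ha⟩ := hA'
  obtain ⟨b, hb⟩ := hB'
  rw [hA.measure_eq_iSup_isCompact, hB.measure_eq_iSup_isCompact]
  simp only [iSup_and']
  refine ENNReal.biSup_add_biSup_le' ⟨∅, by simp⟩ ⟨∅, by simp⟩ fun K hK L hL => ?_
  exact (add_le_add (measure_mono (Set.subset_insert a K))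
    (measure_mono (Set.subset_insert b L))).trans
    (key (insert a K) (insert b L) (Set.insert_subset ha hK.1) (Set.insert_subset hb hL.1)
      (hK.2.insert a) (hL.2.insert b) (Set.insert_nonempty _ _) (Set.insert_nonempty _ _))

theorem ENNReal.geom_mean_le_arith_mean_two {a b : ℝ} (ha : 0 < a) (hb : 0 < b) (hab : a + b = 1)
    (x y : ℝ≥0∞) : x ^ a * y ^ b ≤ ENNReal.ofReal a * x + ENNReal.ofReal b * y := by
  rcases eq_or_ne x ∞ with rfl | hx
  · simp [ENNReal.mul_top, ha]
  rcases eq_or_ne y ∞ with rfl | hy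
  · simp [ENNReal.mul_top, hb]
  lift x to ℝ≥0 using hx
  lift y to ℝ≥0 using hy
  have := NNReal.geom_mean_le_arith_mean2_weighted a.toNNReal b.toNNReal x y
    (by rw [← Real.toNNReal_add ha.le hb.le, hab]; simp)
  rw [Real.coe_toNNReal _ ha.le, Real.coe_toNNReal _ hb.le] at this
  rw [← ENNReal.coe_rpow_of_nonneg _ ha.le, ← ENNReal.coe_rpow_of_nonneg _ hb.le]
  unfold ENNReal.ofReal
  exact_mod_cast this

/-- The Prékopa–Leindler inequality holds for the measure `μ`. -/
def PrekopaLeindler {E : Type*} [AddCommGroup E] [Module ℝ E] [MeasurableSpace E]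
    (μ : Measure E) : Prop :=
  ∀ a b : ℝ, 0 < a → 0 < b → a + b = 1 → ∀ f g h : E → ℝ≥0∞,
    Measurable f → Measurable g → Measurable h →
    (∀ x y, f x ^ a * g y ^ b ≤ h (a • x + b • y)) →
    (∫⁻ x, f x ∂μ) ^ a * (∫⁻ x, g x ∂μ) ^ b ≤ ∫⁻ x, h x ∂μ

theorem PrekopaLeindler.prod {E F : Type*} [AddCommGroup E] [Module ℝ E] [MeasurableSpace E]
    [AddCommGroup F] [Module ℝ F] [MeasurableSpace F] {μ : Measure E} {ν : Measure F}
    [SFinite μ] [SFinite ν]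
    (hμ : PrekopaLeindler μ) (hν : PrekopaLeindler ν) : PrekopaLeindler (μ.prod ν) := by
  intro a b ha hb hab f g h hf hg hh hfgh
  rw [lintegral_prod _ hf.aemeasurable, lintegral_prod _ hg.aemeasurable,
    lintegral_prod _ hh.aemeasurable]
  refine hμ a b ha hb hab _ _ _ hf.lintegral_prod_right' hg.lintegral_prod_right'
    hh.lintegral_prod_right' fun x y => ?_
  exact hν a b ha hb hab _ _ _ (by fun_prop) (by fun_prop) (by fun_prop)
    fun u v => hfgh (x, u) (y, v)

theorem PrekopaLeindler.of_measurePreserving {E F : Type*} [AddCommGroup E] [Module ℝ E]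
    [MeasurableSpace E] [AddCommGroup F] [Module ℝ F] [MeasurableSpace F] {μ : Measure E}
    {ν : Measure F} (hμ : PrekopaLeindler μ) (T : E → F) (hT : MeasurePreserving T μ ν)
    (hlin : ∀ a b : ℝ, ∀ x y, T (a • x + b • y) = a • T x + b • T y) : PrekopaLeindler ν := by
  intro a b ha hb hab f g h hf hg hh hfgh
  rw [← hT.lintegral_comp hf, ← hT.lintegral_comp hg, ← hT.lintegral_comp hh]
  refine hμ a b ha hb hab _ _ _ (hf.comp hT.measurable) (hg.comp hT.measurable)
    (hh.comp hT.measurable) fun x y => ?_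
  simpa [hlin] using hfgh (T x) (T y)

theorem volume_smul_add_le {A B C : Set ℝ} (hA : MeasurableSet A) (hB : MeasurableSet B)
    (hA' : A.Nonempty) (hB' : B.Nonempty) {a b : ℝ} (ha : 0 < a) (hb : 0 < b)
    (h : ∀ x ∈ A, ∀ y ∈ B, a * x + b * y ∈ C) :
    ENNReal.ofReal a * volume A + ENNReal.ofReal b * volume B ≤ volume C := by
  have := volume_add_le_of_add_mem (A := a • A) (B := b • B) (C := C) (hA.const_smul₀ a)
    (hB.const_smul₀ b) hA'.smul_set hB'.smul_set (by
      rintro _ ⟨x, hx, rfl⟩ _ ⟨y, hy, rfl⟩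
      exact h x hx y hy)
  simpa [Measure.addHaar_smul, abs_of_pos ha, abs_of_pos hb] using this

theorem lintegral_eq_lintegral_meas_lt_of_le_one {f : ℝ → ℝ≥0∞} (hf : Measurable f)
    (h1 : ∀ x, f x ≤ 1) :
    ∫⁻ x, f x = ∫⁻ t in Set.Ioi (0 : ℝ), volume {x | ENNReal.ofReal t < f x} := by
  have h2 := lintegral_eq_lintegral_meas_lt (volume : Measure ℝ) (f := fun x => (f x).toReal)
    (Eventually.of_forall fun x => ENNReal.toReal_nonneg) hf.ennreal_toReal.aemeasurable
  have hfin : ∀ x, f x ≠ ∞ := fun x => ((h1 x).trans_lt ENNReal.one_lt_top).ne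
  simp only [ENNReal.ofReal_toReal (hfin _)] at h2
  rw [h2]
  refine setLIntegral_congr_fun measurableSet_Ioi fun t ht => ?_
  simp only [ENNReal.ofReal_lt_iff_lt_toReal (le_of_lt ht) (hfin _)]

theorem arith_mean_lintegral_le {a b : ℝ} (ha : 0 < a) (hb : 0 < b) (hab : a + b = 1)
    {f g h : ℝ → ℝ≥0∞} (hf : Measurable f) (hg : Measurable g) (hh : Measurable h)
    (hf1 : ⨆ x, f x = 1) (hg1 : ⨆ x, g x = 1)
    (hfgh : ∀ x y, f x ^ a * g y ^ b ≤ h (a * x + b * y)) :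
    ENNReal.ofReal a * (∫⁻ x, f x) + ENNReal.ofReal b * (∫⁻ x, g x) ≤ ∫⁻ x, h x := by
  have hfle : ∀ x, f x ≤ 1 := fun x => hf1 ▸ le_iSup f x
  have hgle : ∀ x, g x ≤ 1 := fun x => hg1 ▸ le_iSup g x
  refine le_trans ?_ (lintegral_mono (f := fun x => min (h x) 1) fun x => min_le_left _ _)
  rw [lintegral_eq_lintegral_meas_lt_of_le_one hf hfle,
    lintegral_eq_lintegral_meas_lt_of_le_one hg hgle,
    lintegral_eq_lintegral_meas_lt_of_le_one (hh.min measurable_const) fun x => min_le_right _ _]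
  have hmeas : ∀ u : ℝ → ℝ≥0∞, Measurable fun t : ℝ => volume {x | ENNReal.ofReal t < u x} := by
    intro u
    refine Antitone.measurable fun s t hst => measure_mono fun x hx => ?_
    exact (ENNReal.ofReal_le_ofReal hst).trans_lt hx
  rw [← lintegral_const_mul _ (hmeas f), ← lintegral_const_mul _ (hmeas g),
    ← lintegral_add_left ((hmeas f).const_mul _)]
  refine setLIntegral_mono ((hmeas _)) fun t ht => ?_
  rcases lt_or_ge t 1 with ht1 | ht1
  · have ht1' : ENNReal.ofReal t < 1 := by simpa using ht1
    refine volume_smul_add_le (A := {x | ENNReal.ofReal t < f x})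
      (B := {x | ENNReal.ofReal t < g x}) (hf measurableSet_Ioi) (hg measurableSet_Ioi)
      (lt_iSup_iff.1 ((ht1'.trans_eq hf1.symm))) (lt_iSup_iff.1 ((ht1'.trans_eq hg1.symm))) ha hb fun x hx y hy => ?_
    refine lt_min (lt_of_lt_of_le ?_ (hfgh x y)) ht1'
    have : ENNReal.ofReal t = ENNReal.ofReal t ^ a * ENNReal.ofReal t ^ b := by
      rw [← ENNReal.rpow_add_of_nonneg _ _ ha.le hb.le, hab, ENNReal.rpow_one]
    rw [this]
    exact ENNReal.mul_lt_mul (ENNReal.rpow_lt_rpow hx ha) (ENNReal.rpow_lt_rpow hy hb)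
  · have h0 : ∀ u : ℝ → ℝ≥0∞, (∀ x, u x ≤ 1) → {x | ENNReal.ofReal t < u x} = ∅ := by
      intro u hu
      ext x
      simpa using (hu x).trans (by simpa using ht1)
    simp [h0 f hfle, h0 g hgle]

theorem prekopaLeindler_real_of_bounded {a b : ℝ} (ha : 0 < a) (hb : 0 < b) (hab : a + b = 1)
    {f g h : ℝ → ℝ≥0∞} (hf : Measurable f) (hg : Measurable g) (hh : Measurable h)
    (hf1 : ⨆ x, f x ≠ ∞) (hg1 : ⨆ x, g x ≠ ∞)
    (hfgh : ∀ x y, f x ^ a * g y ^ b ≤ h (a * x + b * y)) :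
    (∫⁻ x, f x) ^ a * (∫⁻ x, g x) ^ b ≤ ∫⁻ x, h x := by
  set α := ⨆ x, f x with hα
  set β := ⨆ x, g x with hβ
  rcases eq_or_ne α 0 with h0 | h0
  · have : ∀ x, f x = 0 := fun x => le_antisymm (h0 ▸ le_iSup f x) zero_le
    simp [this, ha]
  rcases eq_or_ne β 0 with h0' | h0'
  · have : ∀ x, g x = 0 := fun x => le_antisymm (h0' ▸ le_iSup g x) zero_le
    simp [this, hb]
  set γ := α ^ a * β ^ b with hγ
  have hγ0 : γ ≠ 0 := mul_ne_zero (by simp [h0, hf1]) (by simp [h0', hg1])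
  have hγt : γ ≠ ∞ := ENNReal.mul_ne_top (ENNReal.rpow_ne_top_of_nonneg ha.le hf1)
    (ENNReal.rpow_ne_top_of_nonneg hb.le hg1)
  have key := arith_mean_lintegral_le ha hb hab (f := fun x => α⁻¹ * f x) (g := fun x => β⁻¹ * g x)
    (h := fun x => γ⁻¹ * h x) (hf.const_mul _) (hg.const_mul _) (hh.const_mul _)
    (by rw [← ENNReal.mul_iSup, ← hα, ENNReal.inv_mul_cancel h0 hf1])
    (by rw [← ENNReal.mul_iSup, ← hβ, ENNReal.inv_mul_cancel h0' hg1])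
    (by
      intro x y
      rw [ENNReal.mul_rpow_of_nonneg _ _ ha.le, ENNReal.mul_rpow_of_nonneg _ _ hb.le,
        mul_mul_mul_comm, ENNReal.inv_rpow, ENNReal.inv_rpow, ← ENNReal.mul_inv]
      · exact mul_le_mul_right (hfgh x y) _
      · simp [h0, hf1]
      · simp [h0, hf1])
  have h3 := (ENNReal.geom_mean_le_arith_mean_two ha hb hab _ _).trans key
  rw [lintegral_const_mul _ hf, lintegral_const_mul _ hg, lintegral_const_mul _ hh,
    ENNReal.mul_rpow_of_nonneg _ _ ha.le, ENNReal.mul_rpow_of_nonneg _ _ hb.le,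
        mul_mul_mul_comm, ENNReal.inv_rpow, ENNReal.inv_rpow, ← ENNReal.mul_inv
        (by simp [h0, hf1]) (by simp [h0, hf1]), ← hγ] at h3
  exact (ENNReal.mul_le_mul_iff_right (by simpa using hγt) (by simpa using hγ0)).1 h3

theorem iSup_lintegral_min_natCast {f : ℝ → ℝ≥0∞} (hf : Measurable f) :
    ⨆ m : ℕ, ∫⁻ x, min (f x) m = ∫⁻ x, f x := by
  rw [← lintegral_iSup (fun m => hf.min measurable_const)]
  · congr with x
    rw [← inf_iSup_eq, ENNReal.iSup_natCast, inf_top_eq]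
  · intro m k hmk x
    exact min_le_min_left _ (by exact_mod_cast hmk)

theorem ENNReal.iSup_rpow {ι : Type*} {a : ℝ} (ha : 0 < a) (u : ι → ℝ≥0∞) :
    (⨆ i, u i) ^ a = ⨆ i, u i ^ a :=
  (ENNReal.orderIsoRpow a ha).map_iSup u

theorem prekopaLeindler_real : PrekopaLeindler (volume : Measure ℝ) := by
  intro a b ha hb hab f g h hf hg hh hfgh
  rw [← iSup_lintegral_min_natCast hf, ← iSup_lintegral_min_natCast hg, ENNReal.iSup_rpow ha,
    ENNReal.iSup_rpow hb, ENNReal.iSup_mul]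
  refine iSup_le fun m => ?_
  rw [ENNReal.mul_iSup]
  refine iSup_le fun k => ?_
  refine prekopaLeindler_real_of_bounded ha hb hab (hf.min measurable_const)
    (hg.min measurable_const) hh ?_ ?_ fun x y => ?_
  · exact ne_top_of_le_ne_top (ENNReal.natCast_ne_top m) (iSup_le fun x => min_le_right _ _)
  · exact ne_top_of_le_ne_top (ENNReal.natCast_ne_top k) (iSup_le fun x => min_le_right _ _)
  · refine le_trans ?_ (hfgh x y)
    gcongr <;> exact min_le_left _ _

theorem prekopaLeindler_pi (n : ℕ) : PrekopaLeindler (volume : Measure (Fin n → ℝ)) := by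
  induction n with
  | zero =>
    intro a b ha hb hab f g h hf hg hh hfgh
    rw [volume_pi, Measure.pi_of_empty _ 0]
    simpa [lintegral_dirac] using hfgh 0 0
  | succ n ih =>
    refine (prekopaLeindler_real.prod ih).of_measurePreserving
      (MeasurableEquiv.piFinSuccAbove (fun _ => ℝ) 0).symm
      ((volume_preserving_piFinSuccAbove (fun _ => ℝ) 0).symm _) fun a b x y => ?_
    ext i
    refine Fin.cases ?_ (fun j => ?_) i <;> simp [MeasurableEquiv.piFinSuccAbove]

theorem prekopaLeindler_euclideanSpace (n : ℕ) : PrekopaLeindler (volume : Measure (En n)) :=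
  (prekopaLeindler_pi n).of_measurePreserving _
    (EuclideanSpace.volume_preserving_symm_measurableEquiv_toLp (Fin n)).symm fun a b x y => by
      ext i
      simp

/-- Log-concavity of a measure. -/
def MeasLogConcave {E : Type*} [AddCommGroup E] [Module ℝ E] [MeasurableSpace E]
    (μ : Measure E) : Prop :=
  ∀ a b : ℝ, 0 < a → 0 < b → a + b = 1 → ∀ A B C : Set E,
    MeasurableSet A → MeasurableSet B → MeasurableSet C →
    (∀ x ∈ A, ∀ y ∈ B, a • x + b • y ∈ C) → μ A ^ a * μ B ^ b ≤ μ C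

theorem MeasLogConcave.map {E F : Type*} [AddCommGroup E] [Module ℝ E] [MeasurableSpace E]
    [AddCommGroup F] [Module ℝ F] [MeasurableSpace F] {μ : Measure E} (hμ : MeasLogConcave μ)
    (T : E →ₗ[ℝ] F) (hT : Measurable T) : MeasLogConcave (μ.map T) := by
  intro a b ha hb hab A B C hA hB hC h
  rw [Measure.map_apply hT hA, Measure.map_apply hT hB, Measure.map_apply hT hC]
  refine hμ a b ha hb hab _ _ _ (hT hA) (hT hB) (hT hC) fun x hx y hy => ?_
  simpa using h _ hx _ hy

theorem PrekopaLeindler.measLogConcave_withDensity {E : Type*} [AddCommGroup E] [Module ℝ E]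
    [MeasurableSpace E] {μ : Measure E} (hμ : PrekopaLeindler μ) {q r : E → ℝ≥0∞}
    (hq : Measurable q) (hr : Measurable r) (hqr : q =ᵐ[μ] r)
    (h : ∀ a b : ℝ, 0 < a → 0 < b → a + b = 1 → ∀ x y, q x ^ a * q y ^ b ≤ r (a • x + b • y)) :
    MeasLogConcave (μ.withDensity q) := by
  intro a b ha hb hab A B C hA hB hC hABC
  have : μ.withDensity q C = μ.withDensity r C := by rw [withDensity_congr_ae hqr]
  rw [this, withDensity_apply _ hA, withDensity_apply _ hB, withDensity_apply _ hC,
    ← lintegral_indicator hA, ← lintegral_indicator hB, ← lintegral_indicator hC]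
  refine hμ a b ha hb hab _ _ _ (hq.indicator hA) (hq.indicator hB) (hr.indicator hC)
    fun x y => ?_
  by_cases hx : x ∈ A
  · by_cases hy : y ∈ B
    · simpa [hx, hy, hABC x hx y hy] using h a b ha hb hab x y
    · simp [hy, hb]
  · simp [hx, ha]

theorem AEMeasurable.exists_measurable_between {α : Type*} [MeasurableSpace α] {μ : Measure α}
    {f : α → ℝ≥0∞} (hf : AEMeasurable f μ) :
    ∃ q r : α → ℝ≥0∞, Measurable q ∧ Measurable r ∧ q =ᵐ[μ] f ∧ r =ᵐ[μ] f ∧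
      (∀ x, q x ≤ f x) ∧ ∀ x, f x ≤ r x := by
  set N := toMeasurable μ {x | ¬ f x = hf.mk f x} with hN
  have hNm : MeasurableSet N := measurableSet_toMeasurable _ _
  have hN0 : μ N = 0 := by rw [hN, measure_toMeasurable]; exact hf.ae_eq_mk
  have hNae : ∀ᵐ x ∂μ, x ∉ N := measure_eq_zero_iff_ae_notMem.1 hN0
  have hout : ∀ x ∉ N, f x = hf.mk f x := by
    intro x hx
    by_contra hne
    exact hx (subset_toMeasurable _ _ hne)
  classical
  refine ⟨N.piecewise (fun _ => 0) (hf.mk f), N.piecewise (fun _ => ∞) (hf.mk f),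
    measurable_const.piecewise hNm hf.measurable_mk, measurable_const.piecewise hNm
    hf.measurable_mk, ?_, ?_, fun x => ?_, fun x => ?_⟩
  · filter_upwards [hNae] with x hx
    simp [hx, hout x hx]
  · filter_upwards [hNae] with x hx
    simp [hx, hout x hx]
  all_goals
    by_cases hx : x ∈ N
    · simp [hx]
    · simp [hx, hout x hx]

theorem measLogConcave_prod_of_isLogConcave {n : ℕ} {p : En n → ℝ} (hp : IsLogConcave p)
    (hm : AEMeasurable p) :
    MeasLogConcave (((volume : Measure (En n)).withDensity fun x => ENNReal.ofReal (p x)).prod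
      ((volume : Measure (En n)).withDensity fun x => ENNReal.ofReal (p x))) := by
  obtain ⟨q, r, hq, hr, hqf, hrf, hqle, hler⟩ := hm.ennreal_ofReal.exists_measurable_between
  rw [← withDensity_congr_ae hqf, prod_withDensity hq hq]
  have hPL := prekopaLeindler_euclideanSpace n
  refine (hPL.prod hPL).measLogConcave_withDensity (r := fun z => r z.1 * r z.2) (by fun_prop)
    (by fun_prop) ?_ ?_
  · have h1 := Measure.quasiMeasurePreserving_fst (μ := (volume : Measure (En n)))
      (ν := (volume : Measure (En n))) |>.ae_eq_comp (hqf.trans hrf.symm)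
    have h2 := Measure.quasiMeasurePreserving_snd (μ := (volume : Measure (En n)))
      (ν := (volume : Measure (En n))) |>.ae_eq_comp (hqf.trans hrf.symm)
    filter_upwards [h1, h2] with z hz1 hz2
    simp only [Function.comp_apply] at hz1 hz2
    rw [hz1, hz2]
  · intro a b ha hb hab x y
    have key : ∀ u v : En n, q u ^ a * q v ^ b ≤ r (a • u + b • v) := by
      intro u v
      refine le_trans (mul_le_mul' (ENNReal.rpow_le_rpow (hqle u) ha.le)
        (ENNReal.rpow_le_rpow (hqle v) hb.le)) (le_trans ?_ (hler _))
      rw [ENNReal.ofReal_rpow_of_nonneg (hp.1 _) ha.le, ENNReal.ofReal_rpow_of_nonneg (hp.1 _) hb.le,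
        ← ENNReal.ofReal_mul (rpow_nonneg (hp.1 _) _)]
      have := hp.2 u v a ha.le (by linarith)
      rw [← hab, add_sub_cancel_left] at this
      exact ENNReal.ofReal_le_ofReal this
    rw [ENNReal.mul_rpow_of_nonneg _ _ ha.le, ENNReal.mul_rpow_of_nonneg _ _ hb.le,
      mul_mul_mul_comm]
    exact mul_le_mul' (key x.1 y.1) (key x.2 y.2)

/-- Even log-concave probability measures on Euclidean space with covariance `2 I`. -/
structure IsEvenLogConcaveTwo {n : ℕ} (ν : Measure (En n)) : Prop where
  prob : IsProbabilityMeasure ν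
  logConcave : MeasLogConcave ν
  even : ν.map (fun x => -x) = ν
  moment : ∀ θ : En n, ∫⁻ x, ENNReal.ofReal (⟪x, θ⟫ ^ 2) ∂ν = ENNReal.ofReal (2 * ‖θ‖ ^ 2)

theorem integrable_coord_mul_coord {n : ℕ} {p : En n → ℝ} (hp : IsLogConcave p) (hd : IsDensity p)
    (hi : IsIsotropic p) (i j : Fin n) : Integrable fun x : En n => p x * (x i * x j) := by
  have hsq : ∀ i, Integrable fun x : En n => p x * (x i * x i) := by
    intro i
    by_contra h
    have h1 := congrFun (congrFun hi.2 i) i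
    simp only [pcov, hi.1, PiLp.zero_apply, sub_zero, Matrix.one_apply_eq] at h1
    rw [integral_undef h] at h1
    exact zero_ne_one h1
  refine ((hsq i).add (hsq j)).mono' ?_ (Eventually.of_forall fun x => ?_)
  · exact hd.1.aestronglyMeasurable.mul (by fun_prop)
  · rw [norm_mul, Real.norm_eq_abs, abs_of_nonneg (hp.1 x), Pi.add_apply, ← mul_add]
    refine mul_le_mul_of_nonneg_left ?_ (hp.1 x)
    rw [Real.norm_eq_abs, abs_le]
    constructor <;> nlinarith [sq_nonneg (x i + x j), sq_nonneg (x i - x j)]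

theorem integrable_coord {n : ℕ} {p : En n → ℝ} (hp : IsLogConcave p) (hd : IsDensity p)
    (hi : IsIsotropic p) (i : Fin n) : Integrable fun x : En n => p x * x i := by
  refine (hd.1.add (integrable_coord_mul_coord hp hd hi i i)).mono' ?_
    (Eventually.of_forall fun x => ?_)
  · exact hd.1.aestronglyMeasurable.mul (by fun_prop)
  · rw [norm_mul, Real.norm_eq_abs, abs_of_nonneg (hp.1 x), Pi.add_apply, ← mul_one_add]
    refine mul_le_mul_of_nonneg_left ?_ (hp.1 x)
    rw [Real.norm_eq_abs, abs_le]
    constructor <;> nlinarith [sq_nonneg (x i + 1), sq_nonneg (x i - 1)]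

theorem integral_coord_eq_zero {n : ℕ} {p : En n → ℝ} (hp : IsLogConcave p) (hd : IsDensity p)
    (hi : IsIsotropic p) (i : Fin n) : ∫ x : En n, p x * x i = 0 := by
  have := congrArg (fun v : En n => v i) hi.1
  simp only [pmean, PiLp.zero_apply] at this
  rw [eval_integral_piLp fun i => by simpa using integrable_coord hp hd hi i] at this
  simpa using this

/-- The measure with density `p`. -/
noncomputable def densityMeasure {n : ℕ} (p : En n → ℝ) : Measure (En n) :=
  (volume : Measure (En n)).withDensity fun x => ENNReal.ofReal (p x)

section densityMeasure

variable {n : ℕ} {p : En n → ℝ}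

theorem integrable_densityMeasure_iff (hp : IsLogConcave p) (hd : IsDensity p) {f : En n → ℝ} :
    Integrable f (densityMeasure p) ↔ Integrable fun x => p x * f x := by
  rw [densityMeasure, integrable_withDensity_iff_integrable_smul₀' hd.1.aemeasurable.ennreal_ofReal
    (by simp)]
  simp [ENNReal.toReal_ofReal (hp.1 _)]

theorem integral_densityMeasure (hp : IsLogConcave p) (hd : IsDensity p) (f : En n → ℝ) :
    ∫ x, f x ∂(densityMeasure p) = ∫ x, p x * f x := by
  rw [densityMeasure, integral_withDensity_eq_integral_toReal_smul₀
    hd.1.aemeasurable.ennreal_ofReal (by simp)]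
  simp [ENNReal.toReal_ofReal (hp.1 _)]

theorem isProbabilityMeasure_densityMeasure (hp : IsLogConcave p) (hd : IsDensity p) :
    IsProbabilityMeasure (densityMeasure p) := by
  constructor
  rw [densityMeasure, withDensity_apply _ MeasurableSet.univ, Measure.restrict_univ,
    ← ofReal_integral_eq_lintegral_ofReal hd.1 (Eventually.of_forall hp.1), hd.2, ENNReal.ofReal_one]

theorem pmeas_eq (hp : IsLogConcave p) (hd : IsDensity p) {S : Set (En n)} (hS : MeasurableSet S) :
    pmeas p S = (densityMeasure p S).toReal := by
  rw [densityMeasure, withDensity_apply _ hS, pmeas,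
    ← ofReal_integral_eq_lintegral_ofReal hd.1.integrableOn (Eventually.of_forall hp.1),
    ENNReal.toReal_ofReal (integral_nonneg hp.1)]

theorem integrable_inner_densityMeasure (hp : IsLogConcave p) (hd : IsDensity p)
    (hi : IsIsotropic p) (θ : En n) : Integrable (fun x => ⟪x, θ⟫) (densityMeasure p) := by
  simp only [PiLp.inner_apply]
  refine integrable_finsetSum _ fun i _ => ?_
  simp only [RCLike.inner_apply, conj_trivial]
  exact ((integrable_densityMeasure_iff hp hd).2 (integrable_coord hp hd hi i)).const_mul _

theorem integral_inner_densityMeasure (hp : IsLogConcave p) (hd : IsDensity p)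
    (hi : IsIsotropic p) (θ : En n) : ∫ x, ⟪x, θ⟫ ∂(densityMeasure p) = 0 := by
  simp only [PiLp.inner_apply, RCLike.inner_apply, conj_trivial]
  rw [integral_finsetSum _ fun i _ =>
    ((integrable_densityMeasure_iff hp hd).2 (integrable_coord hp hd hi i)).const_mul _]
  simp_rw [integral_const_mul, integral_densityMeasure hp hd, integral_coord_eq_zero hp hd hi]
  simp

theorem inner_sq_eq_sum (x θ : En n) :
    ⟪x, θ⟫ ^ 2 = ∑ i, ∑ j, (θ i * θ j) * (x i * x j) := by
  simp only [PiLp.inner_apply, RCLike.inner_apply, conj_trivial]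
  rw [sq, Finset.sum_mul_sum]
  exact Finset.sum_congr rfl fun i _ => Finset.sum_congr rfl fun j _ => by ring

theorem integrable_inner_sq_densityMeasure (hp : IsLogConcave p) (hd : IsDensity p)
    (hi : IsIsotropic p) (θ : En n) : Integrable (fun x => ⟪x, θ⟫ ^ 2) (densityMeasure p) := by
  simp only [inner_sq_eq_sum]
  exact integrable_finsetSum _ fun i _ => integrable_finsetSum _ fun j _ =>
    ((integrable_densityMeasure_iff hp hd).2 (integrable_coord_mul_coord hp hd hi i j)).const_mul _

theorem integral_inner_sq_densityMeasure (hp : IsLogConcave p) (hd : IsDensity p)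
    (hi : IsIsotropic p) (θ : En n) : ∫ x, ⟪x, θ⟫ ^ 2 ∂(densityMeasure p) = ‖θ‖ ^ 2 := by
  have hij := fun i j =>
    (integrable_densityMeasure_iff hp hd).2 (integrable_coord_mul_coord hp hd hi i j)
  simp only [inner_sq_eq_sum]
  rw [integral_finsetSum _ fun i _ => integrable_finsetSum _ fun j _ => (hij i j).const_mul _]
  have h1 : ∀ i j, ∫ x : En n, x i * x j ∂(densityMeasure p) = if i = j then 1 else 0 := by
    intro i j
    have := congrFun (congrFun hi.2 i) j
    simp only [pcov, hi.1, PiLp.zero_apply, sub_zero, Matrix.one_apply] at this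
    rw [integral_densityMeasure hp hd, this]
  simp_rw [integral_finsetSum _ fun j _ => (hij _ j).const_mul _, integral_const_mul, h1]
  rw [EuclideanSpace.norm_sq_eq]
  simp [sq]

theorem exists_symmetrization (hp : IsLogConcave p) (hd : IsDensity p) (hi : IsIsotropic p) :
    ∃ ν : Measure (En n), IsEvenLogConcaveTwo ν ∧
      ∀ ρ : ℝ, densityMeasure p (Metric.closedBall 0 ρ) ^ 2 ≤ ν (Metric.closedBall 0 (2 * ρ)) := by
  have := isProbabilityMeasure_densityMeasure hp hd
  set μ := densityMeasure p with hμ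
  have hsub : Measurable fun z : En n × En n => z.1 - z.2 := by fun_prop
  refine ⟨(μ.prod μ).map fun z => z.1 - z.2, ⟨?_, ?_, ?_, ?_⟩, ?_⟩
  · exact Measure.isProbabilityMeasure_map hsub.aemeasurable
  · exact (measLogConcave_prod_of_isLogConcave hp hd.1.aemeasurable).map
      (LinearMap.fst ℝ _ _ - LinearMap.snd ℝ _ _) hsub
  · rw [Measure.map_map measurable_neg hsub]
    conv_rhs => rw [← Measure.prod_swap, Measure.map_map hsub measurable_swap]
    congr 1
    ext z : 1
    simp
  · intro θ
    rw [lintegral_map (by fun_prop) hsub]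
    have hI := integrable_inner_densityMeasure hp hd hi θ
    have hI2 := integrable_inner_sq_densityMeasure hp hd hi θ
    have e : ∀ z : En n × En n, ⟪z.1 - z.2, θ⟫ ^ 2 =
        (⟪z.1, θ⟫ ^ 2 + ⟪z.2, θ⟫ ^ 2) - 2 * (⟪z.1, θ⟫ * ⟪z.2, θ⟫) := by
      intro z
      rw [inner_sub_left]
      ring
    have i1 : Integrable (fun z : En n × En n => ⟪z.1, θ⟫ ^ 2) (μ.prod μ) := hI2.comp_fst μ
    have i2 : Integrable (fun z : En n × En n => ⟪z.2, θ⟫ ^ 2) (μ.prod μ) := hI2.comp_snd μ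
    have i3 : Integrable (fun z : En n × En n => ⟪z.1, θ⟫ * ⟪z.2, θ⟫) (μ.prod μ) := hI.mul_prod hI
    have i4 : Integrable (fun z : En n × En n => ⟪z.1 - z.2, θ⟫ ^ 2) (μ.prod μ) := by
      simp only [e]
      exact (i1.add i2).sub (i3.const_mul 2)
    rw [← ofReal_integral_eq_lintegral_ofReal i4 (Eventually.of_forall fun z => sq_nonneg _)]
    simp only [e]
    rw [integral_sub (f := fun z : En n × En n => ⟪z.1, θ⟫ ^ 2 + ⟪z.2, θ⟫ ^ 2) (i1.add i2)
      (i3.const_mul 2), integral_add i1 i2, integral_const_mul,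
      integral_prod_mul (fun x => ⟪x, θ⟫) (fun x => ⟪x, θ⟫),
      integral_fun_fst (fun x => ⟪x, θ⟫ ^ 2), integral_fun_snd (fun x => ⟪x, θ⟫ ^ 2),
      integral_inner_densityMeasure hp hd hi, integral_inner_sq_densityMeasure hp hd hi]
    simp [two_mul]
  · intro ρ
    rw [Measure.map_apply hsub Metric.isClosed_closedBall.measurableSet, sq, ← Measure.prod_prod]
    refine measure_mono fun z hz => ?_
    simp only [Set.mem_prod, Metric.mem_closedBall, dist_zero_right, Set.mem_preimage] at *
    linarith [norm_sub_le z.1 z.2]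

end densityMeasure

namespace IsEvenLogConcaveTwo

variable {n : ℕ} {ν : Measure (En n)}

theorem measure_neg_preimage (hν : IsEvenLogConcaveTwo ν) {S : Set (En n)} (hS : MeasurableSet S) :
    ν ((fun x => -x) ⁻¹' S) = ν S := by
  conv_rhs => rw [← hν.even, Measure.map_apply measurable_neg hS]

theorem half_le_measure_inner_nonneg (hν : IsEvenLogConcaveTwo ν) (θ : En n) :
    (1 / 2 : ℝ) ≤ ν.real {x | 0 ≤ ⟪x, θ⟫} := by
  have := hν.prob
  have hm : MeasurableSet {x : En n | 0 ≤ ⟪x, θ⟫} := measurableSet_le (by fun_prop) (by fun_prop)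
  have h1 : ν.real {x | ⟪x, θ⟫ ≤ 0} = ν.real {x | 0 ≤ ⟪x, θ⟫} := by
    rw [measureReal_def, measureReal_def, ← hν.measure_neg_preimage hm]
    simp
  have h2 : ν.real Set.univ ≤ ν.real {x | ⟪x, θ⟫ ≤ 0} + ν.real {x | 0 ≤ ⟪x, θ⟫} := by
    refine le_trans (measureReal_mono ?_) (measureReal_union_le _ _)
    intro x _
    rcases le_total ⟪x, θ⟫ 0 with h | h
    · exact Or.inl h
    · exact Or.inr h
  rw [probReal_univ] at h2
  linarith

theorem measure_four_mul_le (hν : IsEvenLogConcaveTwo ν) {θ : En n} (hθ : θ ≠ 0) :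
    ν.real {x | 4 * ‖θ‖ ≤ |⟪x, θ⟫|} ≤ 1 / 8 := by
  have := hν.prob
  have hθ' : 0 < ‖θ‖ := norm_pos_iff.2 hθ
  have h1 := mul_meas_ge_le_lintegral₀ (μ := ν) (f := fun x => ENNReal.ofReal (⟪x, θ⟫ ^ 2))
    (by fun_prop) (ENNReal.ofReal (16 * ‖θ‖ ^ 2))
  rw [hν.moment] at h1
  have h2 : {x : En n | 4 * ‖θ‖ ≤ |⟪x, θ⟫|} ⊆
      {x | ENNReal.ofReal (16 * ‖θ‖ ^ 2) ≤ ENNReal.ofReal (⟪x, θ⟫ ^ 2)} := by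
    intro x hx
    simp only [Set.mem_ofPred_eq] at *
    refine ENNReal.ofReal_le_ofReal ?_
    rw [← sq_abs ⟪x, θ⟫]
    nlinarith
  have h3 := (mul_le_mul_right (measure_mono (μ := ν) h2) _).trans h1
  have h4 := ENNReal.toReal_mono ENNReal.ofReal_ne_top h3
  rw [ENNReal.toReal_mul, ENNReal.toReal_ofReal (by positivity),
    ENNReal.toReal_ofReal (by positivity)] at h4
  rw [measureReal_def]
  have : 0 < ‖θ‖ ^ 2 := by positivity
  nlinarith

theorem measure_inner_ge_le (hν : IsEvenLogConcaveTwo ν) {θ : En n} (hθ : θ ≠ 0) (m : ℕ) :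
    ν.real {x | 4 * ‖θ‖ * m ≤ |⟪x, θ⟫|} ≤ 2 * (1 / 4 : ℝ) ^ m := by
  have := hν.prob
  have hθ' : 0 < ‖θ‖ := norm_pos_iff.2 hθ
  have hm : ∀ c : ℝ, MeasurableSet {x : En n | c ≤ ⟪x, θ⟫} := fun c =>
    measurableSet_le (by fun_prop) (by fun_prop)
  rcases Nat.eq_zero_or_pos m with rfl | hmpos
  · have : ν.real {x : En n | 4 * ‖θ‖ * (0 : ℕ) ≤ |⟪x, θ⟫|} ≤ 1 := measureReal_le_one
    rw [pow_zero]
    linarith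
  have hone : ν.real {x | 4 * ‖θ‖ * m ≤ ⟪x, θ⟫} ≤ (1 / 4 : ℝ) ^ m := by
    rcases Nat.eq_or_lt_of_le (show 1 ≤ m from hmpos) with rfl | h1
    · have h2 : ν.real {x | 4 * ‖θ‖ * (1 : ℕ) ≤ ⟪x, θ⟫} ≤ ν.real {x | 4 * ‖θ‖ ≤ |⟪x, θ⟫|} :=
        measureReal_mono fun x hx => by
          simp only [Set.mem_ofPred_eq, Nat.cast_one, mul_one] at *
          exact hx.trans (le_abs_self _)
      rw [pow_one]
      exact h2.trans ((hν.measure_four_mul_le hθ).trans (by norm_num))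
    · have hm0 : (0 : ℝ) < m := by exact_mod_cast hmpos
      have hm1 : (1 : ℝ) < m := by exact_mod_cast h1
      have ha : 0 < 1 - 1 / (m : ℝ) := by
        rw [sub_pos, div_lt_one hm0]
        exact hm1
      have hb : 0 < 1 / (m : ℝ) := by positivity
      have key := hν.logConcave (1 - 1 / m) (1 / m) ha hb (by ring) {x | 0 ≤ ⟪x, θ⟫}
        {x | 4 * ‖θ‖ * m ≤ ⟪x, θ⟫} {x | 4 * ‖θ‖ ≤ ⟪x, θ⟫} (hm _) (hm _) (hm _) (by
          intro x hx y hy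
          simp only [Set.mem_ofPred_eq] at *
          rw [inner_add_left, inner_smul_left, inner_smul_left]
          simp only [conj_trivial]
          have h2 : 1 / (m : ℝ) * (4 * ‖θ‖ * m) ≤ 1 / m * ⟪y, θ⟫ := by gcongr
          have h3 : 1 / (m : ℝ) * (4 * ‖θ‖ * m) = 4 * ‖θ‖ := by field_simp
          have := mul_nonneg ha.le hx
          linarith)
      have key2 := ENNReal.toReal_mono (measure_ne_top _ _) key
      rw [ENNReal.toReal_mul, ← ENNReal.toReal_rpow, ← ENNReal.toReal_rpow] at key2
      have h8 : (ν {x | 4 * ‖θ‖ ≤ ⟪x, θ⟫}).toReal ≤ 1 / 8 :=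
        (measureReal_mono (s₂ := {x | 4 * ‖θ‖ ≤ |⟪x, θ⟫|})
          fun x (hx : 4 * ‖θ‖ ≤ ⟪x, θ⟫) => hx.trans (le_abs_self _)).trans
          (hν.measure_four_mul_le hθ)
      have key3 := pow_le_pow_left₀ (by positivity) (key2.trans h8) m
      rw [mul_pow, ← rpow_natCast, ← rpow_mul ENNReal.toReal_nonneg, ← rpow_natCast (_ ^ (1 / (m:ℝ))),
        ← rpow_mul ENNReal.toReal_nonneg, one_div_mul_cancel hm0.ne', rpow_one,
        sub_mul, one_div_mul_cancel hm0.ne', one_mul] at key3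
      have hhalf := hν.half_le_measure_inner_nonneg θ
      rw [measureReal_def] at hhalf ⊢
      have h5 : (1 / 2 : ℝ) ^ m ≤ (ν {x | 0 ≤ ⟪x, θ⟫}).toReal ^ ((m : ℝ) - 1) := by
        rw [← rpow_natCast]
        calc (1 / 2 : ℝ) ^ (m : ℝ) ≤ (1 / 2 : ℝ) ^ ((m : ℝ) - 1) :=
              rpow_le_rpow_of_exponent_ge (by norm_num) (by norm_num) (by linarith)
          _ ≤ _ := rpow_le_rpow (by norm_num) hhalf (by linarith)
      have h6 : (1 / 2 : ℝ) ^ m * (ν {x | 4 * ‖θ‖ * m ≤ ⟪x, θ⟫}).toReal ≤ (1 / 8) ^ m :=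
        (mul_le_mul_of_nonneg_right h5 ENNReal.toReal_nonneg).trans key3
      have h7 : (1 / 8 : ℝ) ^ m = (1 / 2) ^ m * (1 / 4) ^ m := by
        rw [← mul_pow]
        norm_num
      rw [h7] at h6
      exact le_of_mul_le_mul_left h6 (by positivity)
  have hsymm : ν.real {x | ⟪x, θ⟫ ≤ -(4 * ‖θ‖ * m)} = ν.real {x | 4 * ‖θ‖ * m ≤ ⟪x, θ⟫} := by
    rw [measureReal_def, measureReal_def, ← hν.measure_neg_preimage (hm _)]
    congr 2
    ext x
    simp [le_neg]
  have hunion : ν.real {x | 4 * ‖θ‖ * m ≤ |⟪x, θ⟫|} ≤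
      ν.real {x | 4 * ‖θ‖ * m ≤ ⟪x, θ⟫} + ν.real {x | ⟪x, θ⟫ ≤ -(4 * ‖θ‖ * m)} := by
    refine le_trans (measureReal_mono ?_) (measureReal_union_le _ _)
    intro x hx
    have hx' : 4 * ‖θ‖ * m ≤ |⟪x, θ⟫| := hx
    rcases le_abs.1 hx' with h | h
    · exact Or.inl h
    · exact Or.inr (le_neg_of_le_neg h)
  linarith

theorem summable_and_tsum_le (k : ℕ) :
    Summable (fun m : ℕ => ((m : ℝ) + 1) ^ (2 * k) * (2 * (1 / 4 : ℝ) ^ m)) ∧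
    ∑' m : ℕ, ((m : ℝ) + 1) ^ (2 * k) * (2 * (1 / 4 : ℝ) ^ m) ≤ 25 * (2 * k) ^ (2 * k) := by
  have he := Real.exp_one_lt_d9
  have hr : exp 1 / 4 < 1 := by linarith
  have hr0 : 0 ≤ exp 1 / 4 := by positivity
  have hg := (hasSum_geometric_of_lt_one hr0 hr).mul_left (2 * exp 1 * (2 * k : ℝ) ^ (2 * k))
  have hle : ∀ m : ℕ, ((m : ℝ) + 1) ^ (2 * k) * (2 * (1 / 4 : ℝ) ^ m) ≤
      2 * exp 1 * (2 * k : ℝ) ^ (2 * k) * (exp 1 / 4) ^ m := by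
    intro m
    have h1 := Real.pow_div_factorial_le_exp ((m : ℝ) + 1) (by positivity) (2 * k)
    rw [div_le_iff₀ (by positivity)] at h1
    have h2 : ((2 * k).factorial : ℝ) ≤ (2 * k : ℝ) ^ (2 * k) := by
      exact_mod_cast Nat.factorial_le_pow (2 * k)
    have h3 : exp ((m : ℝ) + 1) = exp 1 * exp 1 ^ m := by
      rw [← Real.exp_nat_mul, ← Real.exp_add]
      ring_nf
    calc ((m : ℝ) + 1) ^ (2 * k) * (2 * (1 / 4 : ℝ) ^ m)
        ≤ (exp ((m : ℝ) + 1) * (2 * k : ℝ) ^ (2 * k)) * (2 * (1 / 4 : ℝ) ^ m) := by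
          gcongr
          exact h1.trans (by gcongr)
      _ = _ := by
          rw [h3, div_eq_mul_one_div (exp 1) 4, mul_pow]
          ring
  have hs : Summable (fun m : ℕ => ((m : ℝ) + 1) ^ (2 * k) * (2 * (1 / 4 : ℝ) ^ m)) :=
    Summable.of_nonneg_of_le (fun m => by positivity) hle hg.summable
  refine ⟨hs, (hs.tsum_le_tsum hle hg.summable).trans ?_⟩
  rw [hg.tsum_eq]
  have h4 : 2 * exp 1 * (1 - exp 1 / 4)⁻¹ ≤ 25 := by
    rw [← div_eq_mul_inv, div_le_iff₀ (by linarith)]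
    linarith
  calc 2 * exp 1 * (2 * k : ℝ) ^ (2 * k) * (1 - exp 1 / 4)⁻¹
      = (2 * exp 1 * (1 - exp 1 / 4)⁻¹) * (2 * k : ℝ) ^ (2 * k) := by ring
    _ ≤ _ := by gcongr

/-- Reverse Hölder inequality for linear functionals of a log-concave measure. -/
theorem lintegral_inner_pow_le (hν : IsEvenLogConcaveTwo ν) {k : ℕ} (hk : 1 ≤ k) (θ : En n) :
    ∫⁻ x, ENNReal.ofReal (⟪x, θ⟫ ^ (2 * k)) ∂ν ≤ ENNReal.ofReal ((40 * k * ‖θ‖) ^ (2 * k)) := by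
  have := hν.prob
  rcases eq_or_ne θ 0 with rfl | hθ
  · have : 2 * k ≠ 0 := by omega
    simp [this]
  have hθ' : 0 < ‖θ‖ := norm_pos_iff.2 hθ
  set A : ℕ → Set (En n) := fun m => {x | 4 * ‖θ‖ * m ≤ |⟪x, θ⟫|} with hA
  have hAm : ∀ m, MeasurableSet (A m) := fun m => measurableSet_le (by fun_prop) (by fun_prop)
  have hpt : ∀ x, ENNReal.ofReal (⟪x, θ⟫ ^ (2 * k)) ≤
      ∑' m : ℕ, (A m).indicator (fun _ => ENNReal.ofReal ((4 * ‖θ‖ * (m + 1)) ^ (2 * k))) x := by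
    intro x
    refine le_trans ?_ (ENNReal.le_tsum ⌊|⟪x, θ⟫| / (4 * ‖θ‖)⌋₊)
    have h1 : x ∈ A ⌊|⟪x, θ⟫| / (4 * ‖θ‖)⌋₊ := by
      have := Nat.floor_le (a := |⟪x, θ⟫| / (4 * ‖θ‖)) (by positivity)
      rw [le_div_iff₀ (by positivity)] at this
      simp only [hA, Set.mem_ofPred_eq]
      linarith
    rw [Set.indicator_of_mem h1]
    have h2 := (Nat.lt_floor_add_one (|⟪x, θ⟫| / (4 * ‖θ‖))).le
    rw [div_le_iff₀ (by positivity)] at h2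
    rw [← (even_two_mul k).pow_abs]
    refine ENNReal.ofReal_le_ofReal (pow_le_pow_left₀ (abs_nonneg _) ?_ _)
    linarith
  refine (lintegral_mono hpt).trans ?_
  rw [lintegral_tsum fun m => (measurable_const.indicator (hAm m)).aemeasurable]
  obtain ⟨hs, hle⟩ := summable_and_tsum_le k
  calc ∑' m : ℕ, ∫⁻ x, (A m).indicator
        (fun _ => ENNReal.ofReal ((4 * ‖θ‖ * (m + 1)) ^ (2 * k))) x ∂ν
      ≤ ∑' m : ℕ, ENNReal.ofReal ((4 * ‖θ‖) ^ (2 * k) *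
          (((m : ℝ) + 1) ^ (2 * k) * (2 * (1 / 4 : ℝ) ^ m))) := by
        refine ENNReal.tsum_le_tsum fun m => ?_
        rw [lintegral_indicator_const (hAm m), ← mul_assoc, ← mul_pow,
          ENNReal.ofReal_mul (by positivity)]
        gcongr
        rw [← ofReal_measureReal]
        exact ENNReal.ofReal_le_ofReal (hν.measure_inner_ge_le hθ m)
    _ = ENNReal.ofReal ((4 * ‖θ‖) ^ (2 * k) *
          ∑' m : ℕ, (((m : ℝ) + 1) ^ (2 * k) * (2 * (1 / 4 : ℝ) ^ m))) := by
        rw [← ENNReal.ofReal_tsum_of_nonneg (fun m => by positivity) (hs.mul_left _), tsum_mul_left]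
    _ ≤ _ := by
        refine ENNReal.ofReal_le_ofReal ?_
        calc (4 * ‖θ‖) ^ (2 * k) * ∑' m : ℕ, (((m : ℝ) + 1) ^ (2 * k) * (2 * (1 / 4 : ℝ) ^ m))
            ≤ (4 * ‖θ‖) ^ (2 * k) * (25 * (2 * k) ^ (2 * k)) := by gcongr
          _ ≤ (4 * ‖θ‖) ^ (2 * k) * (5 ^ (2 * k) * (2 * k) ^ (2 * k)) := by
              gcongr
              calc (25 : ℝ) = 5 ^ 2 := by norm_num
                _ ≤ 5 ^ (2 * k) := pow_le_pow_right₀ (by norm_num) (by omega)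
          _ = _ := by
              rw [← mul_pow, ← mul_pow]
              ring_nf

theorem eLpNorm_inner_pow (k : ℕ) (hk : 1 ≤ k) (θ : En n) :
    eLpNorm (fun x => ⟪x, θ⟫) ((2 * k : ℕ) : ℝ≥0∞) ν ^ (2 * k) =
      ∫⁻ x, ENNReal.ofReal (⟪x, θ⟫ ^ (2 * k)) ∂ν := by
  have h0 : (2 * k : ℕ) ≠ 0 := by omega
  rw [eLpNorm_eq_lintegral_rpow_enorm_toReal (by exact_mod_cast h0)
    (ENNReal.natCast_ne_top _),
    ← ENNReal.rpow_natCast, ← ENNReal.rpow_mul]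
  simp only [ENNReal.toReal_natCast]
  rw [one_div_mul_cancel (by exact_mod_cast h0), ENNReal.rpow_one]
  congr with x
  rw [ENNReal.rpow_natCast, Real.enorm_eq_ofReal_abs, ← ENNReal.ofReal_pow (abs_nonneg _),
    (even_two_mul k).pow_abs]

theorem eLpNorm_inner_lt_top (hν : IsEvenLogConcaveTwo ν) {k : ℕ} (hk : 1 ≤ k) (θ : En n) :
    eLpNorm (fun x => ⟪x, θ⟫) ((2 * k : ℕ) : ℝ≥0∞) ν < ∞ := by
  have h0 : (2 * k : ℕ) ≠ 0 := by omega
  rw [lt_top_iff_ne_top]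
  intro h
  have := eLpNorm_inner_pow (ν := ν) k hk θ
  rw [h, ENNReal.top_pow h0] at this
  exact absurd (this ▸ hν.lintegral_inner_pow_le hk θ) (by simp)

/-- The `L²ᵏ(ν)` norm of linear functionals, as a seminorm on `ℝⁿ`. -/
noncomputable def momentSeminorm (hν : IsEvenLogConcaveTwo ν) {k : ℕ} (hk : 1 ≤ k) :
    Seminorm ℝ (En n) :=
  Seminorm.of (fun θ => (eLpNorm (fun x => ⟪x, θ⟫) ((2 * k : ℕ) : ℝ≥0∞) ν).toReal)
    (by
      intro θ η
      rw [← ENNReal.toReal_add (hν.eLpNorm_inner_lt_top hk θ).ne (hν.eLpNorm_inner_lt_top hk η).ne]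
      refine ENNReal.toReal_mono (ENNReal.add_ne_top.2
        ⟨(hν.eLpNorm_inner_lt_top hk θ).ne, (hν.eLpNorm_inner_lt_top hk η).ne⟩) ?_
      have h1 : (1 : ℝ≥0∞) ≤ ((2 * k : ℕ) : ℝ≥0∞) := by exact_mod_cast (by omega : 1 ≤ 2 * k)
      simp only [inner_add_right]
      exact eLpNorm_add_le (μ := ν) (f := fun x : En n => ⟪x, θ⟫) (g := fun x : En n => ⟪x, η⟫)
        (by fun_prop) (by fun_prop) h1)
    (by
      intro c θ
      simp only [inner_smul_right]
      have := eLpNorm_const_smul (μ := ν) c (fun x : En n => ⟪x, θ⟫) ((2 * k : ℕ) : ℝ≥0∞)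
      rw [show (fun x : En n => c * ⟪x, θ⟫) = c • fun x : En n => ⟪x, θ⟫ from rfl, this]
      simp)

theorem momentSeminorm_pow (hν : IsEvenLogConcaveTwo ν) {k : ℕ} (hk : 1 ≤ k) (θ : En n) :
    ENNReal.ofReal (hν.momentSeminorm hk θ ^ (2 * k)) =
      ∫⁻ x, ENNReal.ofReal (⟪x, θ⟫ ^ (2 * k)) ∂ν := by
  rw [← eLpNorm_inner_pow k hk θ, momentSeminorm]
  change ENNReal.ofReal ((eLpNorm (fun x => ⟪x, θ⟫) ((2 * k : ℕ) : ℝ≥0∞) ν).toReal ^ (2 * k)) = _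
  rw [ENNReal.ofReal_pow ENNReal.toReal_nonneg,
    ENNReal.ofReal_toReal (hν.eLpNorm_inner_lt_top hk θ).ne]

theorem momentSeminorm_le (hν : IsEvenLogConcaveTwo ν) {k : ℕ} (hk : 1 ≤ k) (θ : En n) :
    hν.momentSeminorm hk θ ≤ 40 * k * ‖θ‖ := by
  have h0 : (2 * k : ℕ) ≠ 0 := by omega
  have := hν.lintegral_inner_pow_le hk θ
  rw [← hν.momentSeminorm_pow hk θ, ENNReal.ofReal_le_ofReal_iff (by positivity)] at this
  exact le_of_pow_le_pow_left₀ h0 (by positivity) this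

end IsEvenLogConcaveTwo

open ProbabilityTheory in
theorem stdGaussian_eq_withDensity (V : Type*) [NormedAddCommGroup V] [InnerProductSpace ℝ V]
    [FiniteDimensional ℝ V] [MeasurableSpace V] [BorelSpace V] :
    stdGaussian V = (volume : Measure V).withDensity fun x =>
      ENNReal.ofReal ((2 * π) ^ (-(Module.finrank ℝ V / 2 : ℝ)) * exp (-(1 / 2) * ‖x‖ ^ 2)) := by
  have hpos : (0 : ℝ) < 2 * π := by positivity
  set c : ℝ := (2 * π) ^ (-(Module.finrank ℝ V / 2 : ℝ)) with hc
  have hc0 : 0 ≤ c := by positivity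
  have hintg : Integrable fun x : V => c * exp (-(1 / 2) * ‖x‖ ^ 2) := by
    have h1 := (GaussianFourier.integrable_cexp_neg_mul_sq_norm_add (V := V) (b := 1 / 2)
      (by norm_num) 0 0).norm
    refine Integrable.const_mul ?_ c
    convert h1 with x
    rw [Complex.norm_exp]
    congr 1
    rw [← Complex.ofReal_pow]
    norm_num [← Complex.ofReal_pow]
  have : IsFiniteMeasure ((volume : Measure V).withDensity fun x =>
      ENNReal.ofReal (c * exp (-(1 / 2) * ‖x‖ ^ 2))) :=
    isFiniteMeasure_withDensity_ofReal hintg.hasFiniteIntegral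
  refine Measure.ext_of_charFun ?_
  ext t
  rw [charFun_stdGaussian, charFun_apply,
    integral_withDensity_eq_integral_toReal_smul (by fun_prop) (by simp)]
  have h2 := GaussianFourier.integral_cexp_neg_mul_sq_norm_add (V := V) (b := 1 / 2)
      (by norm_num) Complex.I t
  calc _ = (c : ℂ) * ((π / (1 / 2 : ℂ)) ^ (Module.finrank ℝ V / 2 : ℂ) *
        Complex.exp (Complex.I ^ 2 * ‖t‖ ^ 2 / (4 * (1 / 2)))) := by
        rw [← mul_assoc]
        have h3 : (c : ℂ) * (π / (1 / 2 : ℂ)) ^ (Module.finrank ℝ V / 2 : ℂ) = 1 := by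
          rw [show (π / (1 / 2 : ℂ)) = ((2 * π : ℝ) : ℂ) by push_cast; ring,
            show (Module.finrank ℝ V / 2 : ℂ) = ((Module.finrank ℝ V / 2 : ℝ) : ℂ) by push_cast; ring,
            ← Complex.ofReal_cpow hpos.le, ← Complex.ofReal_mul, hc, ← rpow_add hpos]
          simp
        rw [h3, one_mul, Complex.I_sq]
        congr 1
        ring
    _ = _ := by
        rw [← h2, ← integral_const_mul]
        congr with x
        rw [ENNReal.toReal_ofReal (by positivity), Complex.real_smul, Complex.ofReal_mul, mul_assoc,
          Complex.ofReal_exp, ← Complex.exp_add, real_inner_comm]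
        congr 3
        · push_cast
          ring
        · ring

open ProbabilityTheory in
theorem map_stdGaussian_eq {V W : Type*} [NormedAddCommGroup V] [InnerProductSpace ℝ V]
    [FiniteDimensional ℝ V] [MeasurableSpace V] [BorelSpace V]
    [NormedAddCommGroup W] [InnerProductSpace ℝ W]
    [FiniteDimensional ℝ W] [MeasurableSpace W] [BorelSpace W] (T : V → W) (S : W → V) (σ : ℝ)
    (hT : Measurable T) (hTS : ∀ x w, ⟪T x, w⟫ = ⟪x, S w⟫) (hS : ∀ w, ‖S w‖ = σ * ‖w‖) :
    (stdGaussian V).map T = (stdGaussian W).map fun w => σ • w := by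
  have h1 : IsFiniteMeasure ((stdGaussian V).map T) := inferInstance
  refine Measure.ext_of_charFun ?_
  ext t
  rw [charFun_map_smul, charFun_stdGaussian, charFun_apply, integral_map hT.aemeasurable
    (by fun_prop)]
  simp_rw [hTS]
  rw [← charFun_apply, charFun_stdGaussian, hS, norm_smul]
  congr 3
  push_cast
  rw [mul_pow, mul_pow]
  norm_cast
  rw [Real.norm_eq_abs, sq_abs]

section Concentration

variable {n : ℕ}

open ProbabilityTheory

/-- Gaussian concentration for the distance to a set. -/
theorem lintegral_exp_infDist_mul_le {A : Set (En n)} (hA : MeasurableSet A) :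
    (∫⁻ x, ENNReal.ofReal (exp (Metric.infDist x A ^ 2 / 4)) ∂(stdGaussian (En n))) *
      stdGaussian (En n) A ≤ 1 := by
  set c : ℝ := (2 * π) ^ (-(Module.finrank ℝ (En n) / 2 : ℝ)) with hc
  have hc0 : 0 ≤ c := by positivity
  set φ : En n → ℝ≥0∞ := fun x => ENNReal.ofReal (c * exp (-(1 / 2) * ‖x‖ ^ 2)) with hφ
  have hφm : Measurable φ := by fun_prop
  have hG : stdGaussian (En n) = volume.withDensity φ := stdGaussian_eq_withDensity _
  have hd : Measurable fun x => ENNReal.ofReal (exp (Metric.infDist x A ^ 2 / 4)) := by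
    have := measurable_infDist (s := A)
    fun_prop
  have h1 := prekopaLeindler_euclideanSpace n (1 / 2) (1 / 2) (by norm_num) (by norm_num)
    (by norm_num) (fun x => φ x * ENNReal.ofReal (exp (Metric.infDist x A ^ 2 / 4)))
    (A.indicator φ) φ (hφm.mul hd) (hφm.indicator hA) hφm (by
      intro x y
      by_cases hy : y ∈ A
      · rw [Set.indicator_of_mem hy, ← ENNReal.mul_rpow_of_nonneg _ _ (by norm_num)]
        simp only [hφ]
        rw [← ENNReal.ofReal_mul (by positivity), ← ENNReal.ofReal_mul (by positivity),
          ENNReal.ofReal_rpow_of_nonneg (by positivity) (by norm_num)]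
        refine ENNReal.ofReal_le_ofReal ?_
        rw [← sqrt_eq_rpow]
        refine Real.sqrt_le_iff.2 ⟨by positivity, ?_⟩
        rw [mul_pow, ← Real.exp_nat_mul]
        have hdist := Metric.infDist_le_dist_of_mem (x := x) hy
        have hd0 : 0 ≤ Metric.infDist x A := Metric.infDist_nonneg
        rw [dist_eq_norm] at hdist
        have hpar := parallelogram_law_with_norm ℝ x y
        have hmid : ‖(1 / 2 : ℝ) • x + (1 / 2 : ℝ) • y‖ = ‖x + y‖ / 2 := by
          rw [← smul_add, norm_smul]
          norm_num
          ring
        rw [hmid]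
        calc c * exp (-(1 / 2) * ‖x‖ ^ 2) * exp (Metric.infDist x A ^ 2 / 4) *
              (c * exp (-(1 / 2) * ‖y‖ ^ 2))
            = c ^ 2 * exp (-(1 / 2) * ‖x‖ ^ 2 + Metric.infDist x A ^ 2 / 4 +
              -(1 / 2) * ‖y‖ ^ 2) := by
              rw [Real.exp_add, Real.exp_add]
              ring
          _ ≤ _ := by
              gcongr
              push_cast
              nlinarith
      · rw [Set.indicator_of_notMem hy, ENNReal.zero_rpow_of_pos (by norm_num), mul_zero]
        exact zero_le)
  have h2 : ∫⁻ x, φ x = 1 := by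
    have := measure_univ (μ := stdGaussian (En n))
    rwa [hG, withDensity_apply _ MeasurableSet.univ, Measure.restrict_univ] at this
  rw [h2, ← ENNReal.mul_rpow_of_nonneg _ _ (by norm_num)] at h1
  have h3 : stdGaussian (En n) A = ∫⁻ x, A.indicator φ x := by
    rw [lintegral_indicator hA, hG, withDensity_apply _ hA]
  rw [h3, hG, lintegral_withDensity_eq_lintegral_mul _ hφm hd]
  by_contra! hcon
  have := ENNReal.one_lt_rpow hcon (z := 1 / 2) (by norm_num)
  exact absurd h1 (not_le.2 this)

theorem lintegral_exp_infDist_le {A : Set (En n)} (hA : MeasurableSet A)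
    (hA2 : 1 / 2 ≤ stdGaussian (En n) A) :
    ∫⁻ x, ENNReal.ofReal (exp (Metric.infDist x A ^ 2 / 4)) ∂(stdGaussian (En n)) ≤ 2 := by
  have h1 := (mul_le_mul_right hA2 _).trans (lintegral_exp_infDist_mul_le hA)
  have h2 := mul_le_mul_left h1 2
  rwa [mul_assoc, ENNReal.div_mul_cancel (by norm_num) (by norm_num), mul_one, one_mul] at h2

theorem stdGaussian_le_of_le_dist {A B : Set (En n)} (hA : MeasurableSet A)
    (hA2 : 1 / 2 ≤ stdGaussian (En n) A) {r : ℝ} (hr : 0 ≤ r)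
    (hAB : ∀ x ∈ B, ∀ y ∈ A, r ≤ dist x y) :
    stdGaussian (En n) B ≤ ENNReal.ofReal (2 * exp (-r ^ 2 / 4)) := by
  have hne : A.Nonempty := by
    by_contra h
    rw [Set.not_nonempty_iff_eq_empty.1 h] at hA2
    simp at hA2
  have h1 := mul_meas_ge_le_lintegral₀ (μ := stdGaussian (En n))
    (f := fun x => ENNReal.ofReal (exp (Metric.infDist x A ^ 2 / 4)))
    (by have := measurable_infDist (s := A); fun_prop) (ENNReal.ofReal (exp (r ^ 2 / 4)))
  have h2 : B ⊆ {x | ENNReal.ofReal (exp (r ^ 2 / 4)) ≤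
      ENNReal.ofReal (exp (Metric.infDist x A ^ 2 / 4))} := by
    intro x hx
    have : r ≤ Metric.infDist x A := (Metric.le_infDist hne).2 fun y hy => hAB x hx y hy
    simp only [Set.mem_ofPred_eq]
    gcongr
  have h3 := (mul_le_mul_right (measure_mono (μ := stdGaussian (En n)) h2) _).trans
    (h1.trans (lintegral_exp_infDist_le hA hA2))
  have h4 := mul_le_mul_right h3 (ENNReal.ofReal (exp (-r ^ 2 / 4)))
  rw [← mul_assoc, ← ENNReal.ofReal_mul (by positivity), ← Real.exp_add,
    show -r ^ 2 / 4 + r ^ 2 / 4 = 0 by ring, Real.exp_zero, ENNReal.ofReal_one, one_mul] at h4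
  rw [mul_comm 2, ENNReal.ofReal_mul (by positivity)]
  simpa using h4

end Concentration

theorem exists_median {Ω : Type*} [MeasurableSpace Ω] (μ : Measure Ω) [IsProbabilityMeasure μ]
    {f : Ω → ℝ} (hf : Measurable f) (hf0 : ∀ x, 0 ≤ f x) :
    ∃ M : ℝ, 0 ≤ M ∧ 1 / 2 ≤ μ {x | M ≤ f x} ∧ 1 / 2 ≤ μ {x | f x ≤ M} := by
  set S : Set ℝ := {t | 1 / 2 ≤ μ {x | t ≤ f x}} with hS
  have hm : ∀ t, MeasurableSet {x | t ≤ f x} := fun t => measurableSet_le measurable_const hf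
  have h0 : (0 : ℝ) ∈ S := by
    have : {x | 0 ≤ f x} = Set.univ := Set.eq_univ_of_forall hf0
    simp [hS, this]
  have hanti : ∀ s t : ℝ, s ≤ t → t ∈ S → s ∈ S := fun s t hst ht =>
    le_trans ht (measure_mono fun x hx => hst.trans hx)
  have hbdd : BddAbove S := by
    have h1 : Tendsto (fun m : ℕ => μ {x | (m : ℝ) ≤ f x}) atTop (𝓝 (μ (⋂ m : ℕ, {x | (m : ℝ) ≤ f x}))) :=
      tendsto_measure_iInter_atTop (fun m => (hm _).nullMeasurableSet)
        (fun a b hab x (hx : (b : ℝ) ≤ f x) =>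
          show (a : ℝ) ≤ f x from le_trans (by exact_mod_cast hab) hx) ⟨0, measure_ne_top _ _⟩
    have h2 : (⋂ m : ℕ, {x | (m : ℝ) ≤ f x}) = ∅ := by
      refine Set.eq_empty_of_forall_notMem fun x hx => ?_
      obtain ⟨m, hm⟩ := exists_nat_gt (f x)
      exact absurd (Set.mem_iInter.1 hx m) (not_le.2 hm)
    rw [h2, measure_empty] at h1
    obtain ⟨m, hm⟩ := (h1.eventually (gt_mem_nhds (show (0 : ℝ≥0∞) < 1 / 2 by norm_num))).exists
    refine ⟨m, fun t ht => ?_⟩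
    by_contra! hlt
    exact absurd (hanti _ _ hlt.le ht) (not_le.2 hm)
  have hlim : Tendsto (fun m : ℕ => 1 / ((m : ℝ) + 1)) atTop (𝓝 0) := tendsto_one_div_add_atTop_nhds_zero_nat
  refine ⟨sSup S, le_csSup hbdd h0, ?_, ?_⟩
  · have h1 : Tendsto (fun m : ℕ => μ {x | sSup S - 1 / ((m : ℝ) + 1) ≤ f x}) atTop
        (𝓝 (μ (⋂ m : ℕ, {x | sSup S - 1 / ((m : ℝ) + 1) ≤ f x}))) :=
      tendsto_measure_iInter_atTop (fun m => (hm _).nullMeasurableSet)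
        (fun a b hab x (hx : _ ≤ f x) => show _ ≤ f x from le_trans (by gcongr) hx) ⟨0, measure_ne_top _ _⟩
    have h2 : (⋂ m : ℕ, {x | sSup S - 1 / ((m : ℝ) + 1) ≤ f x}) ⊆ {x | sSup S ≤ f x} := by
      intro x hx
      refine le_of_tendsto (f := fun m : ℕ => sSup S - 1 / ((m : ℝ) + 1)) (x := atTop) ?_
        (Eventually.of_forall fun m => Set.mem_iInter.1 hx m)
      simpa using hlim.const_sub (sSup S)
    refine le_trans (ge_of_tendsto h1 (Eventually.of_forall fun m => ?_)) (measure_mono h2)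
    obtain ⟨t, ht, hlt⟩ := exists_lt_of_lt_csSup ⟨0, h0⟩
      (show sSup S - 1 / ((m : ℝ) + 1) < sSup S by
        have : 0 < 1 / ((m : ℝ) + 1) := by positivity
        linarith)
    exact hanti _ _ hlt.le ht
  · have h1 : Tendsto (fun m : ℕ => μ {x | f x < sSup S + 1 / ((m : ℝ) + 1)}) atTop
        (𝓝 (μ (⋂ m : ℕ, {x | f x < sSup S + 1 / ((m : ℝ) + 1)}))) :=
      tendsto_measure_iInter_atTop
        (fun m => (measurableSet_lt hf measurable_const).nullMeasurableSet)
        (fun a b hab x (hx : f x < _) => lt_of_lt_of_le hx (by gcongr)) ⟨0, measure_ne_top _ _⟩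
    have h2 : (⋂ m : ℕ, {x | f x < sSup S + 1 / ((m : ℝ) + 1)}) ⊆ {x | f x ≤ sSup S} := by
      intro x hx
      refine ge_of_tendsto (f := fun m : ℕ => sSup S + 1 / ((m : ℝ) + 1)) (x := atTop) ?_
        (Eventually.of_forall fun m => le_of_lt (Set.mem_iInter.1 hx m))
      simpa using hlim.const_add (sSup S)
    refine le_trans (ge_of_tendsto h1 (Eventually.of_forall fun m => ?_)) (measure_mono h2)
    have h3 : sSup S + 1 / ((m : ℝ) + 1) ∉ S := fun h => by
      have := le_csSup hbdd h
      have : 0 < 1 / ((m : ℝ) + 1) := by positivity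
      linarith
    have h4 : μ {x | sSup S + 1 / ((m : ℝ) + 1) ≤ f x} < 1 / 2 := not_le.1 h3
    have h5 := measure_add_measure_compl (μ := μ) (hm (sSup S + 1 / ((m : ℝ) + 1)))
    rw [measure_univ] at h5
    have h6 : {x | sSup S + 1 / ((m : ℝ) + 1) ≤ f x}ᶜ = {x | f x < sSup S + 1 / ((m : ℝ) + 1)} := by
      ext x
      simp
    rw [h6] at h5
    by_contra! h7
    have := ENNReal.add_lt_add h4 h7
    rw [h5, ENNReal.add_halves] at this
    exact lt_irrefl _ this

theorem lintegral_pow_le_lintegral_pow {α : Type*} [MeasurableSpace α] (μ : Measure α)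
    [IsProbabilityMeasure μ] {f : α → ℝ≥0∞} (hf : Measurable f) {k : ℕ} (hk : 1 ≤ k) :
    (∫⁻ x, f x ∂μ) ^ k ≤ ∫⁻ x, f x ^ k ∂μ := by
  have h := eLpNorm'_le_eLpNorm'_of_exponent_le (p := 1) (q := k) one_pos (by exact_mod_cast hk) μ
    hf.aestronglyMeasurable
  simp only [eLpNorm'_eq_lintegral_enorm, enorm_eq_self, ENNReal.rpow_one, ne_eq, one_ne_zero,
    not_false_eq_true, div_self, ENNReal.rpow_natCast] at h
  calc _ ≤ ((∫⁻ x, f x ^ k ∂μ) ^ (1 / (k : ℝ))) ^ k := pow_le_pow_left₀ zero_le h k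
    _ = _ := by
      rw [← ENNReal.rpow_natCast, ← ENNReal.rpow_mul,
        one_div_mul_cancel (by exact_mod_cast (by omega : k ≠ 0)), ENNReal.rpow_one]

open ProbabilityTheory in
theorem lintegral_pow_stdGaussian_real_ge {k : ℕ} (hk : 1 ≤ k) :
    ENNReal.ofReal ((exp (-3) * k) ^ k) ≤
      ∫⁻ x, ENNReal.ofReal (x ^ (2 * k)) ∂(stdGaussian ℝ) := by
  have hk' : (1 : ℝ) ≤ k := by exact_mod_cast hk
  rw [stdGaussian_eq_withDensity, lintegral_withDensity_eq_lintegral_mul _ (by fun_prop)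
    (by fun_prop)]
  have h1 : ∀ x ∈ Set.Icc (√k) (√k + 1), ENNReal.ofReal ((exp (-3) * k) ^ k) ≤
      ((fun x : ℝ => ENNReal.ofReal ((2 * π) ^ (-(Module.finrank ℝ ℝ / 2 : ℝ)) *
        exp (-(1 / 2) * ‖x‖ ^ 2))) * fun x => ENNReal.ofReal (x ^ (2 * k))) x := by
    intro x ⟨hx1, hx2⟩
    have hs : √(k : ℝ) ^ 2 = k := sq_sqrt (by positivity)
    have hs0 : 0 ≤ √(k : ℝ) := sqrt_nonneg _
    rw [Pi.mul_apply, ← ENNReal.ofReal_mul (by positivity)]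
    refine ENNReal.ofReal_le_ofReal ?_
    have h2 : (k : ℝ) ^ k ≤ x ^ (2 * k) := by
      rw [pow_mul]
      refine pow_le_pow_left₀ (by positivity) ?_ k
      nlinarith
    have h3 : exp (-1) ≤ (2 * π) ^ (-(Module.finrank ℝ ℝ / 2 : ℝ)) := by
      rw [Module.finrank_self, rpow_neg (by positivity), exp_neg, Nat.cast_one, ← sqrt_eq_rpow]
      gcongr
      refine sqrt_le_iff.2 ⟨by positivity, ?_⟩
      have := Real.exp_one_gt_d9
      have := Real.pi_lt_d2
      nlinarith
    have h4 : exp (-k - 1) ≤ exp (-(1 / 2) * ‖x‖ ^ 2) := by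
      gcongr
      rw [norm_eq_abs, sq_abs]
      nlinarith [sq_nonneg (√(k : ℝ) - 1)]
    calc (exp (-3) * k) ^ k = exp (k * (-3)) * (k : ℝ) ^ k := by rw [mul_pow, ← exp_nat_mul]
      _ ≤ (exp (-1) * exp (-k - 1)) * (k : ℝ) ^ k := by
          rw [← exp_add]
          gcongr
          linarith
      _ ≤ _ := by gcongr
  calc ENNReal.ofReal ((exp (-3) * k) ^ k)
      = ∫⁻ x in Set.Icc (√k) (√k + 1), ENNReal.ofReal ((exp (-3) * k) ^ k) := by
        simp
    _ ≤ _ := (setLIntegral_mono' measurableSet_Icc h1).trans (setLIntegral_le_lintegral _ _)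

open ProbabilityTheory in
theorem lintegral_inner_pow_stdGaussian_ge {V : Type*} [NormedAddCommGroup V]
    [InnerProductSpace ℝ V] [FiniteDimensional ℝ V] [MeasurableSpace V] [BorelSpace V] {k : ℕ}
    (hk : 1 ≤ k) (x : V) :
    ENNReal.ofReal ((exp (-3) * k) ^ k) * ENNReal.ofReal (‖x‖ ^ 2) ^ k ≤
      ∫⁻ g, ENNReal.ofReal (⟪x, g⟫ ^ (2 * k)) ∂(stdGaussian V) := by
  have h1 := map_stdGaussian_eq (V := V) (W := ℝ) (fun g => ⟪x, g⟫) (fun w => w • x) ‖x‖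
    (by fun_prop) (fun g w => by
      rw [inner_smul_right, real_inner_comm x g]
      simp)
    (fun w => by rw [norm_smul, mul_comm])
  have h2 : ∫⁻ g, ENNReal.ofReal (⟪x, g⟫ ^ (2 * k)) ∂(stdGaussian V) =
      ∫⁻ y : ℝ, ENNReal.ofReal (y ^ (2 * k)) ∂((stdGaussian V).map (fun g => ⟪x, g⟫)) := by
    rw [lintegral_map (by fun_prop) (by fun_prop)]
  rw [h2, h1, lintegral_map (by fun_prop) (by fun_prop)]
  simp only [smul_eq_mul, mul_pow]
  have h3 : ∀ y : ℝ, ENNReal.ofReal (‖x‖ ^ (2 * k) * y ^ (2 * k)) =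
      ENNReal.ofReal (‖x‖ ^ 2) ^ k * ENNReal.ofReal (y ^ (2 * k)) := by
    intro y
    have : 0 ≤ ‖x‖ ^ (2 * k) := by positivity
    rw [ENNReal.ofReal_mul this, pow_mul ‖x‖, ENNReal.ofReal_pow (p := ‖x‖ ^ 2) (by positivity)]
  simp only [h3]
  rw [lintegral_const_mul _ (by fun_prop), mul_comm]
  gcongr
  exact (mul_pow (exp (-3)) (k : ℝ) k) ▸ lintegral_pow_stdGaussian_real_ge hk

theorem IsEvenLogConcaveTwo.lintegral_norm_sq {n : ℕ} {ν : Measure (En n)}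
    (hν : IsEvenLogConcaveTwo ν) :
    ∫⁻ x, ENNReal.ofReal (‖x‖ ^ 2) ∂ν = ENNReal.ofReal (2 * n) := by
  have h1 : ∀ x : En n, ENNReal.ofReal (‖x‖ ^ 2) =
      ∑ i, ENNReal.ofReal (⟪x, EuclideanSpace.single i (1 : ℝ)⟫ ^ 2) := by
    intro x
    rw [← ENNReal.ofReal_sum_of_nonneg (fun i _ => by positivity), EuclideanSpace.norm_sq_eq]
    simp [EuclideanSpace.inner_single_right]
  simp only [h1]
  rw [lintegral_finsetSum _ (fun i _ => by fun_prop)]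
  simp only [hν.moment]
  simp [mul_comm, ENNReal.ofReal_mul]

section Seminorm

variable {n : ℕ} {h : Seminorm ℝ (En n)} {L : ℝ}

theorem Seminorm.sub_le_mul_dist (hL : ∀ x, h x ≤ L * ‖x‖) (x y : En n) :
    h x - h y ≤ L * dist x y := by
  rw [dist_eq_norm]
  exact (le_abs_self _).trans ((abs_sub_map_le_sub h x y).trans (hL _))

theorem Seminorm.continuous_of_le_mul_norm (hL0 : 0 ≤ L) (hL : ∀ x, h x ≤ L * ‖x‖) :
    Continuous h := by
  refine (LipschitzWith.of_dist_le_mul (K := ⟨L, hL0⟩) fun x y => ?_).continuous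
  rw [Real.dist_eq, dist_eq_norm]
  exact (abs_sub_map_le_sub h x y).trans (hL _)

open ProbabilityTheory in
theorem lintegral_seminorm_pow_le (hL0 : 0 < L) (hL : ∀ x, h x ≤ L * ‖x‖) {M : ℝ} (hM : 0 ≤ M)
    (hM2 : 1 / 2 ≤ stdGaussian (En n) {x | h x ≤ M}) (k : ℕ) :
    ∫⁻ x, ENNReal.ofReal (h x ^ (2 * k)) ∂(stdGaussian (En n)) ≤
      ENNReal.ofReal (4 ^ k * (M ^ (2 * k) + 2 * (L ^ (2 * k) * (4 * k) ^ k))) := by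
  have hc := Seminorm.continuous_of_le_mul_norm hL0.le hL
  have hm : MeasurableSet {x | h x ≤ M} := measurableSet_le hc.measurable measurable_const
  have hne : {x | h x ≤ M}.Nonempty := ⟨0, by simpa using hM⟩
  set A := {x | h x ≤ M} with hA
  have hpt : ∀ x, ENNReal.ofReal (h x ^ (2 * k)) ≤ ENNReal.ofReal (4 ^ k * M ^ (2 * k)) +
      ENNReal.ofReal (4 ^ k * (L ^ (2 * k) * (4 * k) ^ k)) *
        ENNReal.ofReal (exp (Metric.infDist x A ^ 2 / 4)) := by
    intro x
    rw [← ENNReal.ofReal_mul (by positivity), ← ENNReal.ofReal_add (by positivity) (by positivity)]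
    refine ENNReal.ofReal_le_ofReal ?_
    have hd0 : 0 ≤ Metric.infDist x A := Metric.infDist_nonneg
    set d := Metric.infDist x A with hd
    have h1 : h x ≤ M + L * d := by
      have : (h x - M) / L ≤ d := (Metric.le_infDist hne).2 fun y hy => by
        rw [div_le_iff₀ hL0]
        have hy' : h y ≤ M := hy
        have := Seminorm.sub_le_mul_dist hL x y
        linarith
      rw [div_le_iff₀ hL0] at this
      linarith
    have h2 : d ^ (2 * k) ≤ (4 * k) ^ k * exp (d ^ 2 / 4) := by
      have h3 := Real.pow_div_factorial_le_exp (d ^ 2 / 4) (by positivity) k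
      rw [div_le_iff₀ (by positivity)] at h3
      have h4 : (k.factorial : ℝ) ≤ (k : ℝ) ^ k := by exact_mod_cast Nat.factorial_le_pow k
      calc d ^ (2 * k) = 4 ^ k * (d ^ 2 / 4) ^ k := by
            rw [← mul_pow, pow_mul]
            ring_nf
        _ ≤ 4 ^ k * (exp (d ^ 2 / 4) * (k : ℝ) ^ k) := by
            gcongr
            exact h3.trans (by gcongr)
        _ = _ := by
            rw [mul_pow]
            ring
    calc h x ^ (2 * k) ≤ (M + L * d) ^ (2 * k) := pow_le_pow_left₀ (apply_nonneg h x) h1 _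
      _ ≤ 2 ^ (2 * k - 1) * (M ^ (2 * k) + (L * d) ^ (2 * k)) :=
          add_pow_le (by positivity) (by positivity) _
      _ ≤ 4 ^ k * (M ^ (2 * k) + (L * d) ^ (2 * k)) := by
          gcongr
          rw [show (4 : ℝ) = 2 ^ 2 by norm_num, ← pow_mul]
          exact pow_le_pow_right₀ (by norm_num) (Nat.sub_le _ _)
      _ ≤ 4 ^ k * (M ^ (2 * k) + L ^ (2 * k) * ((4 * k) ^ k * exp (d ^ 2 / 4))) := by
          rw [mul_pow]
          gcongr
      _ = _ := by ring
  refine (lintegral_mono hpt).trans ?_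
  have hmeas : Measurable fun x => ENNReal.ofReal (exp (Metric.infDist x A ^ 2 / 4)) := by
    have := measurable_infDist (s := A)
    fun_prop
  rw [lintegral_add_left measurable_const, lintegral_const, measure_univ, mul_one,
    lintegral_const_mul _ hmeas]
  refine (add_le_add_right (mul_le_mul_right (lintegral_exp_infDist_le hm hM2) _) _).trans_eq ?_
  rw [← ENNReal.ofReal_ofNat, ← ENNReal.ofReal_mul (by positivity),
    ← ENNReal.ofReal_add (by positivity) (by positivity)]
  ring_nf

end Seminorm

open ProbabilityTheory in
theorem IsEvenLogConcaveTwo.lintegral_momentSeminorm_ge {n : ℕ} {ν : Measure (En n)}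
    (hν : IsEvenLogConcaveTwo ν) {k : ℕ} (hk : 1 ≤ k) :
    ENNReal.ofReal ((exp (-3) * k * (2 * n)) ^ k) ≤
      ∫⁻ g, ENNReal.ofReal (hν.momentSeminorm hk g ^ (2 * k)) ∂(stdGaussian (En n)) := by
  have := hν.prob
  simp only [hν.momentSeminorm_pow hk]
  rw [lintegral_lintegral_swap (by fun_prop)]
  calc ENNReal.ofReal ((exp (-3) * k * (2 * n)) ^ k)
      = ENNReal.ofReal ((exp (-3) * k) ^ k) * (∫⁻ x, ENNReal.ofReal (‖x‖ ^ 2) ∂ν) ^ k := by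
        rw [hν.lintegral_norm_sq, mul_pow, ENNReal.ofReal_mul (by positivity),
          ENNReal.ofReal_pow (p := 2 * (n : ℝ)) (by positivity)]
    _ ≤ ENNReal.ofReal ((exp (-3) * k) ^ k) * ∫⁻ x, ENNReal.ofReal (‖x‖ ^ 2) ^ k ∂ν := by
        gcongr
        exact lintegral_pow_le_lintegral_pow ν (by fun_prop) hk
    _ ≤ _ := by
        rw [← lintegral_const_mul _ (by fun_prop)]
        exact lintegral_mono fun x => lintegral_inner_pow_stdGaussian_ge hk x

open ProbabilityTheory in
theorem IsEvenLogConcaveTwo.exists_scale {n : ℕ} {ν : Measure (En n)}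
    (hν : IsEvenLogConcaveTwo ν) {k : ℕ} (hk : 1 ≤ k) (hkn : (10 : ℝ) ^ 8 * k ^ 2 ≤ n) :
    ∃ M : ℝ, 0 < M ∧ k * n / 100 ≤ M ^ 2 ∧
      stdGaussian (En n) {g | hν.momentSeminorm hk g ≤ M / 2} ≤ ENNReal.ofReal (exp (-38 * k)) ∧
      stdGaussian (En n) {g | 2 * M ≤ hν.momentSeminorm hk g} ≤ ENNReal.ofReal (exp (-38 * k)) := by
  have hk' : (1 : ℝ) ≤ k := by exact_mod_cast hk
  have hn : (0 : ℝ) < n := by nlinarith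
  set h := hν.momentSeminorm hk with hh
  have hL : ∀ x, h x ≤ 40 * k * ‖x‖ := hν.momentSeminorm_le hk
  have hL0 : (0 : ℝ) < 40 * k := by positivity
  have hc := Seminorm.continuous_of_le_mul_norm hL0.le hL
  obtain ⟨M, hM0, hM1, hM2⟩ := exists_median (stdGaussian (En n)) hc.measurable
    fun x => apply_nonneg h x
  have hlow := (hν.lintegral_momentSeminorm_ge hk).trans
    (lintegral_seminorm_pow_le hL0 hL hM0 hM2 k)
  rw [ENNReal.ofReal_le_ofReal_iff (by positivity)] at hlow
  have he3 : 1 / 25 ≤ exp (-3) := by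
    rw [exp_neg, one_div]
    gcongr
    rw [show (3 : ℝ) = (3 : ℕ) * 1 by norm_num, exp_nat_mul]
    have := Real.exp_one_lt_d9
    calc exp 1 ^ 3 ≤ 2.7182818286 ^ 3 := by gcongr
      _ ≤ 25 := by norm_num
  have hMsq : k * n / 100 ≤ M ^ 2 := by
    set a : ℝ := exp (-3) * k * n with ha
    have ha' : k * n / 25 ≤ a := by
      rw [ha]
      have : (0 : ℝ) ≤ k * n := by positivity
      nlinarith
    have hb : (25600 : ℝ) * k ^ 3 * 2 ≤ a := by
      have h1 : (k : ℝ) * (10 ^ 8 * k ^ 2) ≤ k * n := by gcongr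
      nlinarith [pow_pos (show (0 : ℝ) < k by linarith) 3]
    have h1 : (4 : ℝ) ^ k * (2 * ((40 * k) ^ (2 * k) * (4 * k) ^ k)) = 2 * (25600 * k ^ 3) ^ k := by
      rw [pow_mul, show (25600 : ℝ) * k ^ 3 = 4 * ((40 * k) ^ 2 * (4 * k)) by ring,
        mul_pow 4 ((40 * (k : ℝ)) ^ 2 * (4 * k)) k, mul_pow ((40 * (k : ℝ)) ^ 2)]
      ring
    have h2 : (2 : ℝ) ≤ 2 ^ k := by
      calc (2 : ℝ) = 2 ^ 1 := by norm_num
        _ ≤ 2 ^ k := pow_le_pow_right₀ (by norm_num) hk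
    have h3 : 2 * (25600 * (k : ℝ) ^ 3) ^ k ≤ a ^ k := by
      calc 2 * (25600 * (k : ℝ) ^ 3) ^ k ≤ 2 ^ k * (25600 * (k : ℝ) ^ 3) ^ k := by gcongr
        _ = (25600 * (k : ℝ) ^ 3 * 2) ^ k := by rw [← mul_pow, mul_comm]
        _ ≤ _ := by gcongr
    have h4 : (exp (-3) * k * (2 * n)) ^ k = 2 ^ k * a ^ k := by
      rw [← mul_pow, ha]
      congr 1
      ring
    have h5 : a ^ k ≤ (4 * M ^ 2) ^ k := by
      rw [mul_pow 4 (M ^ 2), ← pow_mul M]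
      rw [mul_add, h1, h4] at hlow
      have : 2 * a ^ k ≤ 2 ^ k * a ^ k := by gcongr
      linarith
    have h6 := le_of_pow_le_pow_left₀ (by omega) (by positivity) h5
    linarith
  have hMpos : 0 < M := by
    refine lt_of_le_of_ne hM0 fun hM => ?_
    rw [← hM] at hMsq
    have : 0 < (k : ℝ) * n := by positivity
    norm_num at hMsq
    linarith
  have hratio : 39 * (k : ℝ) ≤ (M / (2 * (40 * k))) ^ 2 / 4 := by
    rw [div_pow, div_div, le_div_iff₀ (by positivity)]
    have : (k : ℝ) * (10 ^ 8 * k ^ 2) ≤ k * n := by gcongr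
    nlinarith [pow_pos (show (0 : ℝ) < k by linarith) 3]
  have htail : ∀ r, M / (2 * (40 * k)) ≤ r →
      ENNReal.ofReal (2 * exp (-r ^ 2 / 4)) ≤ ENNReal.ofReal (exp (-38 * k)) := by
    intro r hr
    refine ENNReal.ofReal_le_ofReal ?_
    have h1 : (M / (2 * (40 * k))) ^ 2 ≤ r ^ 2 := by gcongr
    have h2 : exp (-r ^ 2 / 4) ≤ exp (-1 + -38 * k) := by
      gcongr
      linarith
    rw [exp_add] at h2
    have h3 : 2 * exp (-1) ≤ 1 := by
      rw [exp_neg, ← div_eq_mul_inv, div_le_one (exp_pos _)]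
      have := Real.exp_one_gt_d9
      linarith
    nlinarith [exp_pos (-38 * (k : ℝ))]
  refine ⟨M, hMpos, hMsq, ?_, ?_⟩
  · refine (stdGaussian_le_of_le_dist (measurableSet_le measurable_const hc.measurable) hM1
      (r := M / (2 * (40 * k))) (by positivity) ?_).trans (htail _ le_rfl)
    intro x hx y hy
    have hx' : h x ≤ M / 2 := hx
    have hy' : M ≤ h y := hy
    have := Seminorm.sub_le_mul_dist hL y x
    rw [dist_comm, ← div_div, div_le_iff₀ hL0]
    linarith
  · refine (stdGaussian_le_of_le_dist (measurableSet_le hc.measurable measurable_const) hM2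
      (r := M / (40 * k)) (by positivity) ?_).trans (htail _ (div_le_div_of_nonneg_left hMpos.le hL0 (by linarith)))
    intro x hx y hy
    have hx' : 2 * M ≤ h x := hx
    have hy' : h y ≤ M := hy
    have := Seminorm.sub_le_mul_dist hL x y
    rw [div_le_iff₀ hL0]
    linarith

/-- If a norm is of order `M` at most points of an annulus, then it is of order `M` at every point
of the unit sphere. -/
theorem Seminorm.le_of_volume_bad_lt {k : ℕ} (N : Seminorm ℝ (En k)) {M : ℝ} (hM : 0 < M)
    {B : Set (En k)} (hB : MeasurableSet B)
    (hgood : ∀ u, 1 / 2 ≤ ‖u‖ → ‖u‖ ≤ 3 / 2 → u ∉ B → M / 4 ≤ N u ∧ N u ≤ 3 * M)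
    (hvol : 2 * volume B < volume (Metric.ball (0 : En k) (1 / 24))) {u : En k} (hu : ‖u‖ = 1) :
    M / 8 ≤ N u := by
  have hex : ∀ w : En k, ‖w‖ = 1 → ∃ v : En k, ‖v‖ ≤ 1 / 24 ∧ w + v ∉ B ∧ w - v ∉ B := by
    intro w hw
    have h1 : volume ((fun v => w + v) ⁻¹' B) = volume B := measure_preimage_add volume w B
    have h2 : volume ((fun v => w - v) ⁻¹' B) = volume B :=
      (Measure.measurePreserving_sub_left volume w).measure_preimage hB.nullMeasurableSet
    have h3 : ¬ Metric.ball (0 : En k) (1 / 24) ⊆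
        ((fun v => w + v) ⁻¹' B) ∪ ((fun v => w - v) ⁻¹' B) := fun hsub => by
      have := (measure_mono (μ := volume) hsub).trans (measure_union_le _ _)
      rw [h1, h2, ← two_mul] at this
      exact absurd hvol (not_lt.2 this)
    obtain ⟨v, hv, hvB⟩ := Set.not_subset.1 h3
    rw [mem_ball_zero_iff] at hv
    exact ⟨v, hv.le, fun h => hvB (Or.inl h), fun h => hvB (Or.inr h)⟩
  have hann : ∀ w v : En k, ‖w‖ = 1 → ‖v‖ ≤ 1 / 24 → 1 / 2 ≤ ‖w + v‖ ∧ ‖w + v‖ ≤ 3 / 2 := by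
    intro w v hw hv
    have h1 := norm_add_le w v
    have h2 := norm_sub_le (w + v) v
    rw [add_sub_cancel_right] at h2
    constructor <;> linarith
  have hup : ∀ w : En k, ‖w‖ = 1 → N w ≤ 3 * M := by
    intro w hw
    obtain ⟨v, hv, h1, h2⟩ := hex w hw
    have h3 := hann w v hw hv
    have h4 := hann w (-v) hw (by rwa [norm_neg])
    rw [← sub_eq_add_neg] at h4
    have h5 := (hgood _ h3.1 h3.2 h1).2
    have h6 := (hgood _ h4.1 h4.2 h2).2
    have h7 := map_add_le_add N (w + v) (w - v)
    rw [show w + v + (w - v) = (2 : ℝ) • w by rw [two_smul]; abel, map_smul_eq_mul] at h7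
    norm_num at h7
    linarith
  have hup' : ∀ v : En k, ‖v‖ ≤ 1 / 24 → N v ≤ M / 8 := by
    intro v hv
    rcases eq_or_ne v 0 with rfl | hv0
    · rw [map_zero]
      positivity
    · have h1 := hup (‖v‖⁻¹ • v) (norm_smul_inv_norm hv0)
      have hpos : 0 < ‖v‖ := norm_pos_iff.2 hv0
      rw [map_smul_eq_mul, norm_inv, norm_norm, inv_mul_le_iff₀ hpos] at h1
      nlinarith
  obtain ⟨v, hv, h1, -⟩ := hex u hu
  have h3 := hann u v hu hv
  have h4 := (hgood _ h3.1 h3.2 h1).1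
  have h5 := map_add_le_add N u v
  have h6 := hup' v hv
  linarith

section GaussianMatrix

variable {k n : ℕ}

/-- The product `Γᵀ u` of a row vector with a `k × n` matrix. -/
noncomputable def rowMul (Γ : EuclideanSpace ℝ (Fin k × Fin n)) (u : En k) : En n :=
  WithLp.toLp 2 fun j => ∑ i, Γ (i, j) * u i

/-- The product `Γ x` of a `k × n` matrix with a column vector. -/
noncomputable def colMul (Γ : EuclideanSpace ℝ (Fin k × Fin n)) (x : En n) : En k :=
  WithLp.toLp 2 fun i => ∑ j, Γ (i, j) * x j

/-- The rank one matrix `u xᵀ`. -/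
noncomputable def rankOne (u : En k) (x : En n) : EuclideanSpace ℝ (Fin k × Fin n) :=
  WithLp.toLp 2 fun p => u p.1 * x p.2

theorem inner_colMul (Γ : EuclideanSpace ℝ (Fin k × Fin n)) (u : En k) (x : En n) :
    ⟪colMul Γ x, u⟫ = ⟪Γ, rankOne u x⟫ := by
  simp only [colMul, rankOne, PiLp.inner_apply, RCLike.inner_apply, conj_trivial,
    Fintype.sum_prod_type, Finset.mul_sum]
  exact Finset.sum_congr rfl fun i _ => Finset.sum_congr rfl fun j _ => by ring

theorem inner_rowMul (Γ : EuclideanSpace ℝ (Fin k × Fin n)) (u : En k) (x : En n) :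
    ⟪rowMul Γ u, x⟫ = ⟪Γ, rankOne u x⟫ := by
  simp only [rowMul, rankOne, PiLp.inner_apply, RCLike.inner_apply, conj_trivial,
    Fintype.sum_prod_type, Finset.mul_sum]
  rw [Finset.sum_comm]
  exact Finset.sum_congr rfl fun i _ => Finset.sum_congr rfl fun j _ => by ring

theorem norm_rankOne (u : En k) (x : En n) : ‖rankOne u x‖ = ‖u‖ * ‖x‖ := by
  rw [← sq_eq_sq₀ (norm_nonneg _) (by positivity), mul_pow, EuclideanSpace.norm_sq_eq,
    EuclideanSpace.norm_sq_eq, EuclideanSpace.norm_sq_eq, Finset.sum_mul_sum, Fintype.sum_prod_type]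
  simp [rankOne, mul_pow]

theorem continuous_rowMul :
    Continuous fun p : EuclideanSpace ℝ (Fin k × Fin n) × En k => rowMul p.1 p.2 := by
  unfold rowMul
  fun_prop

theorem continuous_colMul :
    Continuous fun p : EuclideanSpace ℝ (Fin k × Fin n) × En n => colMul p.1 p.2 := by
  unfold colMul
  fun_prop

theorem measurable_rowMul_left (u : En k) :
    Measurable fun Γ : EuclideanSpace ℝ (Fin k × Fin n) => rowMul Γ u :=
  (continuous_rowMul.comp (f := fun Γ => (Γ, u)) (by fun_prop)).measurable

theorem measurable_colMul_left (x : En n) :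
    Measurable fun Γ : EuclideanSpace ℝ (Fin k × Fin n) => colMul Γ x :=
  (continuous_colMul.comp (f := fun Γ => (Γ, x)) (by fun_prop)).measurable

/-- `rowMul Γ` as a linear map. -/
noncomputable def rowMulₗ (Γ : EuclideanSpace ℝ (Fin k × Fin n)) : En k →ₗ[ℝ] En n where
  toFun := rowMul Γ
  map_add' u v := by
    ext j
    simp [rowMul, mul_add, Finset.sum_add_distrib]
  map_smul' c u := by
    ext j
    simp [rowMul, Finset.mul_sum, mul_left_comm]

/-- `colMul Γ` as a linear map. -/
noncomputable def colMulₗ (Γ : EuclideanSpace ℝ (Fin k × Fin n)) : En n →ₗ[ℝ] En k where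
  toFun := colMul Γ
  map_add' u v := by
    ext j
    simp [colMul, mul_add, Finset.sum_add_distrib]
  map_smul' c u := by
    ext j
    simp [colMul, Finset.mul_sum, mul_left_comm]

open ProbabilityTheory

theorem map_rowMul_stdGaussian (u : En k) :
    (stdGaussian (EuclideanSpace ℝ (Fin k × Fin n))).map (fun Γ => rowMul Γ u) =
      (stdGaussian (En n)).map fun g => ‖u‖ • g :=
  map_stdGaussian_eq _ (rankOne u) ‖u‖ (measurable_rowMul_left u)
    (fun Γ x => inner_rowMul Γ u x) (norm_rankOne u)

theorem map_colMul_stdGaussian (x : En n) :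
    (stdGaussian (EuclideanSpace ℝ (Fin k × Fin n))).map (fun Γ => colMul Γ x) =
      (stdGaussian (En k)).map fun g => ‖x‖ • g :=
  map_stdGaussian_eq _ (fun u => rankOne u x) ‖x‖ (measurable_colMul_left x)
    (fun Γ u => inner_colMul Γ u x) (fun u => by rw [norm_rankOne, mul_comm])

theorem lintegral_exp_norm_sq_stdGaussian (k : ℕ) :
    ∫⁻ g, ENNReal.ofReal (exp (‖g‖ ^ 2 / 4)) ∂(stdGaussian (En k)) ≤ ENNReal.ofReal (2 ^ k) := by
  rw [stdGaussian_eq_withDensity, lintegral_withDensity_eq_lintegral_mul _ (by fun_prop)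
    (by fun_prop)]
  set c : ℝ := (2 * π) ^ (-(Module.finrank ℝ (En k) / 2 : ℝ)) with hc
  have hc0 : 0 ≤ c := by positivity
  have h1 : ∀ g : En k, ((fun x : En k => ENNReal.ofReal (c * exp (-(1 / 2) * ‖x‖ ^ 2))) *
      (fun x => ENNReal.ofReal (exp (‖x‖ ^ 2 / 4))) : En k → ℝ≥0∞) g =
      ENNReal.ofReal (c * exp (-(1 / 4) * ‖g‖ ^ 2)) := by
    intro g
    rw [Pi.mul_apply, ← ENNReal.ofReal_mul (by positivity), mul_assoc, ← exp_add]
    ring_nf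
  have hI := GaussianFourier.integral_rexp_neg_mul_sq_norm (V := En k) (b := 1 / 4) (by norm_num)
  have hpos : 0 < (π / (1 / 4)) ^ (Module.finrank ℝ (En k) / 2 : ℝ) := by positivity
  have hintg : Integrable fun x : En k => exp (-(1 / 4) * ‖x‖ ^ 2) := by
    by_contra hni
    rw [integral_undef hni] at hI
    exact hpos.ne hI
  rw [lintegral_congr h1, ← ofReal_integral_eq_lintegral_ofReal (hintg.const_mul c)
    (Eventually.of_forall fun x => by positivity), integral_const_mul, hI]
  refine ENNReal.ofReal_le_ofReal ?_
  rw [hc, rpow_neg (by positivity), ← div_eq_inv_mul, ← div_rpow (by positivity) (by positivity),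
    show π / (1 / 4) / (2 * π) = 2 by field_simp; norm_num, finrank_euclideanSpace_fin,
    ← rpow_natCast]
  refine rpow_le_rpow_of_exponent_le (by norm_num) ?_
  have : (0 : ℝ) ≤ k := by positivity
  linarith

theorem stdGaussian_lt_norm_colMul_le {x : En n} {ρ R : ℝ} (hρ : 0 < ρ) (hR : 0 ≤ R)
    (hx : ‖x‖ ≤ ρ) :
    stdGaussian (EuclideanSpace ℝ (Fin k × Fin n)) {Γ | R < ‖colMul Γ x‖} ≤
      ENNReal.ofReal (2 ^ k * exp (-(R / ρ) ^ 2 / 4)) := by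
  have hm : MeasurableSet {y : En k | R < ‖y‖} := measurableSet_lt (by fun_prop) (by fun_prop)
  have h1 : {Γ : EuclideanSpace ℝ (Fin k × Fin n) | R < ‖colMul Γ x‖} =
      (fun Γ => colMul Γ x) ⁻¹' {y | R < ‖y‖} := rfl
  rw [h1, ← Measure.map_apply (measurable_colMul_left x) hm,
    map_colMul_stdGaussian, Measure.map_apply (by fun_prop) hm]
  have h2 : (fun g : En k => ‖x‖ • g) ⁻¹' {y | R < ‖y‖} ⊆
      {g | ENNReal.ofReal (exp ((R / ρ) ^ 2 / 4)) ≤ ENNReal.ofReal (exp (‖g‖ ^ 2 / 4))} := by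
    intro g hg
    have hg' : R < ‖(‖x‖ • g)‖ := hg
    rw [norm_smul, norm_norm] at hg'
    simp only [Set.mem_ofPred_eq]
    have : R / ρ ≤ ‖g‖ := by
      rw [div_le_iff₀ hρ]
      nlinarith [norm_nonneg g]
    gcongr
  have h3 := mul_meas_ge_le_lintegral₀ (μ := stdGaussian (En k))
    (f := fun g => ENNReal.ofReal (exp (‖g‖ ^ 2 / 4))) (by fun_prop)
    (ENNReal.ofReal (exp ((R / ρ) ^ 2 / 4)))
  have h4 := (mul_le_mul_right (measure_mono (μ := stdGaussian (En k)) h2) _).trans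
    (h3.trans (lintegral_exp_norm_sq_stdGaussian k))
  have h5 := mul_le_mul_right h4 (ENNReal.ofReal (exp (-(R / ρ) ^ 2 / 4)))
  rw [← mul_assoc, ← ENNReal.ofReal_mul (by positivity), ← Real.exp_add,
    show -(R / ρ) ^ 2 / 4 + (R / ρ) ^ 2 / 4 = 0 by ring, Real.exp_zero, ENNReal.ofReal_one, one_mul,
    ← ENNReal.ofReal_mul (by positivity), mul_comm] at h5
  exact h5

theorem exists_good_matrices {h : Seminorm ℝ (En n)} (hc : Continuous h) {M : ℝ} (hM : 0 < M)
    (hk : 1 ≤ k) (hlow : stdGaussian (En n) {g | h g ≤ M / 2} ≤ ENNReal.ofReal (exp (-38 * k)))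
    (hup : stdGaussian (En n) {g | 2 * M ≤ h g} ≤ ENNReal.ofReal (exp (-38 * k))) :
    ∃ S : Set (EuclideanSpace ℝ (Fin k × Fin n)), MeasurableSet S ∧
      1 / 2 ≤ stdGaussian (EuclideanSpace ℝ (Fin k × Fin n)) S ∧
      ∀ Γ ∈ S, ∀ u, ‖u‖ = 1 → M / 8 ≤ h (rowMul Γ u) := by
  have hk' : (1 : ℝ) ≤ k := by exact_mod_cast hk
  set μ := stdGaussian (EuclideanSpace ℝ (Fin k × Fin n)) with hμ
  set bad : Set (EuclideanSpace ℝ (Fin k × Fin n) × En k) :=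
    {p | (1 / 2 ≤ ‖p.2‖ ∧ ‖p.2‖ ≤ 3 / 2) ∧ (h (rowMul p.1 p.2) ≤ M / 4 ∨ 3 * M ≤ h (rowMul p.1 p.2))}
    with hbad
  have hcr := (hc.comp (continuous_rowMul (k := k) (n := n))).measurable
  have hnm : Measurable fun p : EuclideanSpace ℝ (Fin k × Fin n) × En k => ‖p.2‖ := by fun_prop
  have hbm : MeasurableSet bad :=
    ((measurableSet_le measurable_const hnm).inter (measurableSet_le hnm measurable_const)).inter
      ((measurableSet_le hcr measurable_const).union (measurableSet_le measurable_const hcr))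
  set V : EuclideanSpace ℝ (Fin k × Fin n) → ℝ≥0∞ := fun Γ => volume (Prod.mk Γ ⁻¹' bad) with hV
  have hVm : Measurable V := measurable_measure_prodMk_left hbm
  set δ : ℝ := exp (-38 * k) with hδ
  have hsec : ∀ u : En k, μ ((fun Γ => (Γ, u)) ⁻¹' bad) ≤
      (Metric.closedBall (0 : En k) (3 / 2)).indicator (fun _ => ENNReal.ofReal (2 * δ)) u := by
    intro u
    by_cases hu : 1 / 2 ≤ ‖u‖ ∧ ‖u‖ ≤ 3 / 2
    · rw [Set.indicator_of_mem (by simpa using hu.2)]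
      have hu0 : 0 < ‖u‖ := by linarith [hu.1]
      have hm : MeasurableSet {y : En n | h y ≤ M / 4 ∨ 3 * M ≤ h y} :=
        (measurableSet_le hc.measurable (by fun_prop)).union
          (measurableSet_le (by fun_prop) hc.measurable)
      have h1 : ((fun Γ => (Γ, u)) ⁻¹' bad) ⊆
          (fun Γ => rowMul Γ u) ⁻¹' {y : En n | h y ≤ M / 4 ∨ 3 * M ≤ h y} := fun Γ hΓ => hΓ.2
      refine (measure_mono h1).trans ?_
      rw [← Measure.map_apply (measurable_rowMul_left u) hm,
        map_rowMul_stdGaussian, Measure.map_apply (by fun_prop) hm]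
      have h2 : (fun g : En n => ‖u‖ • g) ⁻¹' {y : En n | h y ≤ M / 4 ∨ 3 * M ≤ h y} ⊆
          {g | h g ≤ M / 2} ∪ {g | 2 * M ≤ h g} := by
        intro g hg
        have hg' : h (‖u‖ • g) ≤ M / 4 ∨ 3 * M ≤ h (‖u‖ • g) := hg
        rw [map_smul_eq_mul, norm_norm] at hg'
        have hg0 : 0 ≤ h g := apply_nonneg h g
        rcases hg' with hg' | hg'
        · refine Or.inl (show h g ≤ M / 2 from ?_)
          nlinarith [hu.1]
        · refine Or.inr (show 2 * M ≤ h g from ?_)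
          nlinarith [hu.2]
      refine (measure_mono h2).trans ((measure_union_le _ _).trans ((add_le_add hlow hup).trans_eq ?_))
      rw [← ENNReal.ofReal_add (by positivity) (by positivity), two_mul]
    · have : (fun Γ => (Γ, u)) ⁻¹' bad = ∅ := Set.eq_empty_of_forall_notMem fun Γ hΓ => hu hΓ.1
      rw [this, measure_empty]
      exact zero_le
  have hintg : ∫⁻ Γ, V Γ ∂μ ≤ ENNReal.ofReal (2 * δ) * volume (Metric.closedBall (0 : En k) (3 / 2)) := by
    rw [← Measure.prod_apply hbm, Measure.prod_apply_symm hbm]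
    refine (lintegral_mono hsec).trans_eq ?_
    rw [lintegral_indicator_const Metric.isClosed_closedBall.measurableSet]
  set ω := volume (Metric.ball (0 : En k) 1) with hω
  have hω0 : ω ≠ 0 := (Metric.measure_ball_pos volume _ one_pos).ne'
  have hωt : ω ≠ ∞ := measure_ball_lt_top.ne
  have hball : volume (Metric.ball (0 : En k) (1 / 24)) = ENNReal.ofReal ((1 / 24) ^ k) * ω := by
    rw [Measure.addHaar_ball_of_pos _ _ (by norm_num), finrank_euclideanSpace_fin]
  have hcball : volume (Metric.closedBall (0 : En k) (3 / 2)) = ENNReal.ofReal ((3 / 2) ^ k) * ω := by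
    rw [Measure.addHaar_closedBall _ _ (by norm_num), finrank_euclideanSpace_fin]
  have hnum : 2 * (2 * δ) * (3 / 2) ^ k ≤ 1 / 2 * (1 / 24 : ℝ) ^ k := by
    have he := Real.exp_one_gt_d9
    have h1 : exp (-38 * k) * exp 1 ^ (38 * k) = 1 := by
      rw [← exp_nat_mul, ← exp_add]
      push_cast
      rw [show -38 * (k : ℝ) + 38 * k * 1 = 0 by ring, exp_zero]
    have h2 : (8 : ℝ) * 36 ^ k ≤ exp 1 ^ (38 * k) := by
      calc (8 : ℝ) * 36 ^ k ≤ 8 ^ k * 36 ^ k := by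
            gcongr
            exact le_self_pow₀ (by norm_num) (by omega)
        _ = 288 ^ k := by rw [← mul_pow]; norm_num
        _ ≤ (2 ^ 38) ^ k := by gcongr; norm_num
        _ ≤ (exp 1 ^ 38) ^ k := by gcongr; linarith
        _ = _ := by rw [pow_mul]
    have h3 : (3 / 2 : ℝ) ^ k = 36 ^ k * (1 / 24) ^ k := by rw [← mul_pow]; norm_num
    rw [h3]
    have h4 : δ * (8 * 36 ^ k) ≤ 1 := (mul_le_mul_of_nonneg_left h2 (exp_pos _).le).trans_eq h1
    have h5 : (0 : ℝ) < (1 / 24) ^ k := by positivity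
    nlinarith
  set S : Set (EuclideanSpace ℝ (Fin k × Fin n)) :=
    {Γ | 2 * V Γ < ENNReal.ofReal ((1 / 24) ^ k) * ω} with hS
  have hSm : MeasurableSet S := measurableSet_lt (by fun_prop) (by fun_prop)
  refine ⟨S, hSm, ?_, ?_⟩
  · have hcompl : μ Sᶜ ≤ 1 / 2 := by
      have h1 := mul_meas_ge_le_lintegral₀ (μ := μ) (f := fun Γ => 2 * V Γ) (by fun_prop)
        (ENNReal.ofReal ((1 / 24) ^ k) * ω)
      have h2 : {Γ | ENNReal.ofReal ((1 / 24) ^ k) * ω ≤ 2 * V Γ} = Sᶜ := by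
        ext Γ
        simp [hS]
      rw [h2, lintegral_const_mul _ hVm] at h1
      have h3 : ENNReal.ofReal ((1 / 24) ^ k) * ω * μ Sᶜ ≤
          ENNReal.ofReal ((1 / 24) ^ k) * ω * (1 / 2) := by
        refine h1.trans ((mul_le_mul_right hintg 2).trans ?_)
        rw [show (1 / 2 : ℝ≥0∞) = ENNReal.ofReal (1 / 2) by
            rw [ENNReal.ofReal_div_of_pos (by norm_num)]; simp,
          hcball, ← ENNReal.ofReal_ofNat, ← mul_assoc, ← mul_assoc,
          ← ENNReal.ofReal_mul (by norm_num), ← ENNReal.ofReal_mul (by positivity),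
          mul_right_comm (ENNReal.ofReal ((1 / 24) ^ k)), ← ENNReal.ofReal_mul (by positivity)]
        exact mul_le_mul_left (ENNReal.ofReal_le_ofReal (hnum.trans_eq (mul_comm _ _))) _
      exact (ENNReal.mul_le_mul_iff_right (mul_ne_zero (by simp) hω0)
        (ENNReal.mul_ne_top ENNReal.ofReal_ne_top hωt)).1 h3
    have h1 := measure_add_measure_compl (μ := μ) hSm
    rw [measure_univ] at h1
    by_contra! hlt
    have := ENNReal.add_lt_add_of_lt_of_le (by finiteness) hlt hcompl
    rw [h1, ENNReal.add_halves] at this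
    exact lt_irrefl _ this
  · intro Γ hΓ u hu
    refine Seminorm.le_of_volume_bad_lt (h.comp (rowMulₗ Γ)) hM (B := Prod.mk Γ ⁻¹' bad)
      (measurable_prodMk_left hbm) ?_ (by rw [hball]; exact hΓ) hu
    intro v hv1 hv2 hv3
    have hv4 : ¬ (h (rowMul Γ v) ≤ M / 4 ∨ 3 * M ≤ h (rowMul Γ v)) := fun h => hv3 ⟨⟨hv1, hv2⟩, h⟩
    rw [not_or, not_le, not_le] at hv4
    exact ⟨hv4.1.le, hv4.2.le⟩

end GaussianMatrix

section LevelSet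

variable {k : ℕ} {ν : Measure (En k)} {r : ℝ}

theorem measurable_measure_closedBall [SFinite ν] :
    Measurable fun x : En k => ν (Metric.closedBall x r) := by
  have : MeasurableSet {p : En k × En k | dist p.2 p.1 ≤ r} :=
    (isClosed_le (by fun_prop) continuous_const).measurableSet
  exact measurable_measure_prodMk_left this

theorem lintegral_mul_measure_closedBall [SFinite ν] {f : En k → ℝ≥0∞} (hf : Measurable f) :
    ∫⁻ x, f x * ν (Metric.closedBall x r) =
      ∫⁻ y, (∫⁻ z in Metric.closedBall 0 r, f (y + z)) ∂ν := by
  have hm : MeasurableSet {p : En k × En k | dist p.2 p.1 ≤ r} :=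
    (isClosed_le (by fun_prop) continuous_const).measurableSet
  have h1 : ∀ x, f x * ν (Metric.closedBall x r) =
      ∫⁻ y, f x * {p : En k × En k | dist p.2 p.1 ≤ r}.indicator 1 (x, y) ∂ν := by
    intro x
    have hg : Measurable fun y => {p : En k × En k | dist p.2 p.1 ≤ r}.indicator
        (1 : En k × En k → ℝ≥0∞) (x, y) := (measurable_one.indicator hm).comp measurable_prodMk_left
    rw [lintegral_const_mul _ hg,
      ← lintegral_indicator_one Metric.isClosed_closedBall.measurableSet]
    rfl
  simp_rw [h1]
  rw [lintegral_lintegral_swap (((hf.comp measurable_fst).mul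
    (measurable_one.indicator hm)).aemeasurable)]
  refine lintegral_congr fun y => ?_
  rw [← lintegral_add_left_eq_self _ y, ← lintegral_indicator Metric.isClosed_closedBall.measurableSet]
  refine lintegral_congr fun z => ?_
  by_cases hz : ‖z‖ ≤ r
  · rw [Set.indicator_of_mem (by simpa using hz), Set.indicator_of_mem (by simpa using hz)]
    simp
  · rw [Set.indicator_of_notMem (by simpa using hz), Set.indicator_of_notMem (by simpa using hz)]
    simp

theorem MeasLogConcave.measure_closedBall_combo (hν : MeasLogConcave ν) {a b : ℝ} (ha : 0 < a)
    (hb : 0 < b) (hab : a + b = 1) (x y : En k) :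
    ν (Metric.closedBall x r) ^ a * ν (Metric.closedBall y r) ^ b ≤
      ν (Metric.closedBall (a • x + b • y) r) := by
  refine hν a b ha hb hab _ _ _ Metric.isClosed_closedBall.measurableSet
    Metric.isClosed_closedBall.measurableSet Metric.isClosed_closedBall.measurableSet ?_
  intro v hv w hw
  rw [mem_closedBall_iff_norm] at hv hw ⊢
  rw [show a • v + b • w - (a • x + b • y) = a • (v - x) + b • (w - y) by module]
  refine (norm_add_le _ _).trans ?_
  rw [norm_smul, norm_smul, norm_of_nonneg ha.le, norm_of_nonneg hb.le]
  calc a * ‖v - x‖ + b * ‖w - y‖ ≤ a * r + b * r := by gcongr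
    _ = r := by rw [← add_mul, hab, one_mul]

theorem measure_closedBall_neg (heven : ν.map (fun x => -x) = ν) (x : En k) :
    ν (Metric.closedBall (-x) r) = ν (Metric.closedBall x r) := by
  conv_rhs => rw [← heven, Measure.map_apply measurable_neg Metric.isClosed_closedBall.measurableSet]
  congr 1
  ext y
  rw [Set.mem_preimage, mem_closedBall_iff_norm, mem_closedBall_iff_norm, ← norm_neg]
  congr! 2
  abel

theorem MeasLogConcave.convex_level (hν : MeasLogConcave ν) {t : ℝ≥0∞} (ht0 : t ≠ 0) (ht : t ≠ ∞) :
    Convex ℝ {x | t ≤ ν (Metric.closedBall x r)} := by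
  rw [convex_iff_forall_pos]
  intro x (hx : t ≤ _) y (hy : t ≤ _) a b ha hb hab
  refine le_trans ?_ (hν.measure_closedBall_combo ha hb hab x y)
  calc t = t ^ a * t ^ b := by rw [← ENNReal.rpow_add _ _ ht0 ht, hab, ENNReal.rpow_one]
    _ ≤ _ := by gcongr

/-- Decay of the measure of balls along rays. -/
theorem MeasLogConcave.measure_closedBall_le_of_inv_smul [IsFiniteMeasure ν]
    (hν : MeasLogConcave ν) (h0 : ν (Metric.closedBall 0 r) ≠ 0) {s : ℝ≥0∞} (x : En k) (i : ℕ)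
    (hx : ν (Metric.closedBall (((i : ℝ) + 1)⁻¹ • x) r) ≤ s * ν (Metric.closedBall 0 r)) :
    ν (Metric.closedBall x r) ≤ s ^ i * ν (Metric.closedBall (((i : ℝ) + 1)⁻¹ • x) r) := by
  rcases Nat.eq_zero_or_pos i with rfl | hi
  · simp
  have hi' : (0 : ℝ) < i := by exact_mod_cast hi
  set P := ν (Metric.closedBall 0 r) with hP
  set Q := ν (Metric.closedBall (((i : ℝ) + 1)⁻¹ • x) r) with hQ
  have h1 := hν.measure_closedBall_combo (r := r) (a := i / (i + 1)) (b := ((i : ℝ) + 1)⁻¹)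
    (by positivity) (by positivity) (by field_simp) 0 x
  rw [smul_zero, zero_add] at h1
  have h2 := ENNReal.pow_le_pow_left (n := i + 1) h1
  rw [mul_pow, ← ENNReal.rpow_natCast, ← ENNReal.rpow_natCast, ← ENNReal.rpow_mul,
    ← ENNReal.rpow_mul] at h2
  push_cast at h2
  rw [div_mul_cancel₀ _ (by positivity), inv_mul_cancel₀ (by positivity), ENNReal.rpow_one,
    ENNReal.rpow_natCast, ← hP, ← hQ] at h2
  have h3 : P ^ i * ν (Metric.closedBall x r) ≤ P ^ i * (s ^ i * Q) :=
    calc _ ≤ Q ^ (i + 1) := h2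
      _ = Q ^ i * Q := pow_succ _ _
      _ ≤ (s * P) ^ i * Q := by gcongr
      _ = _ := by rw [mul_pow]; ring
  exact (ENNReal.mul_le_mul_iff_right (pow_ne_zero _ h0)
    (ENNReal.pow_ne_top (measure_ne_top _ _))).1 h3

theorem lintegral_comp_inv_smul {f : En k → ℝ≥0∞} (hf : Measurable f) {a : ℝ} (ha : 0 < a) :
    ∫⁻ x, f (a⁻¹ • x) = ENNReal.ofReal (a ^ k) * ∫⁻ x, f x := by
  have h := Measure.map_addHaar_smul (volume : Measure (En k)) (inv_ne_zero ha.ne')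
  rw [← lintegral_map (g := fun x : En k => a⁻¹ • x) hf (by fun_prop), h, lintegral_smul_measure,
    finrank_euclideanSpace_fin, abs_of_pos (by positivity), inv_pow, inv_inv, smul_eq_mul]

theorem lintegral_inner_pow_add_ge (y u : En k) (m : ℕ) :
    volume (Metric.closedBall (0 : En k) r) * ENNReal.ofReal (⟪y, u⟫ ^ (2 * m)) ≤
      ∫⁻ z in Metric.closedBall (0 : En k) r, ENNReal.ofReal (⟪y + z, u⟫ ^ (2 * m)) := by
  have hB : MeasurableSet (Metric.closedBall (0 : En k) r) := Metric.isClosed_closedBall.measurableSet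
  have h1 : ∫⁻ z in Metric.closedBall (0 : En k) r, ENNReal.ofReal (⟪y - z, u⟫ ^ (2 * m)) =
      ∫⁻ z in Metric.closedBall (0 : En k) r, ENNReal.ofReal (⟪y + z, u⟫ ^ (2 * m)) := by
    rw [← lintegral_indicator hB, ← lintegral_indicator hB, ← lintegral_neg_eq_self]
    refine lintegral_congr fun z => ?_
    by_cases hz : ‖z‖ ≤ r
    · rw [Set.indicator_of_mem (by simpa using hz), Set.indicator_of_mem (by simpa using hz),
        sub_neg_eq_add]
    · rw [Set.indicator_of_notMem (by simpa using hz), Set.indicator_of_notMem (by simpa using hz)]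
  have h2 : 2 * (volume (Metric.closedBall (0 : En k) r) * ENNReal.ofReal (⟪y, u⟫ ^ (2 * m))) ≤
      2 * ∫⁻ z in Metric.closedBall (0 : En k) r, ENNReal.ofReal (⟪y + z, u⟫ ^ (2 * m)) := by
    conv_rhs => rw [two_mul]
    conv_rhs => enter [2]; rw [← h1]
    rw [← lintegral_add_left (by fun_prop), mul_left_comm, mul_comm, ← setLIntegral_const]
    refine lintegral_mono fun z => ?_
    rw [show (2 : ℝ≥0∞) * ENNReal.ofReal (⟪y, u⟫ ^ (2 * m)) = ENNReal.ofReal (2 * ⟪y, u⟫ ^ (2 * m)) by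
      rw [ENNReal.ofReal_mul (by norm_num), ENNReal.ofReal_ofNat], ← ENNReal.ofReal_add
      (Even.pow_nonneg (even_two_mul m) _) (Even.pow_nonneg (even_two_mul m) _)]
    refine ENNReal.ofReal_le_ofReal ?_
    have h3 := (even_two_mul m).convexOn_pow (𝕜 := ℝ) |>.2 (Set.mem_univ ⟪y + z, u⟫)
      (Set.mem_univ ⟪y - z, u⟫) (show (0 : ℝ) ≤ 1 / 2 by norm_num) (show (0 : ℝ) ≤ 1 / 2 by norm_num)
      (by norm_num)
    simp only [smul_eq_mul] at h3
    rw [show 1 / 2 * ⟪y + z, u⟫ + 1 / 2 * ⟪y - z, u⟫ = ⟪y, u⟫ by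
      rw [inner_add_left, inner_sub_left]; ring] at h3
    linarith
  exact (ENNReal.mul_le_mul_iff_right (by simp) (by simp)).1 h2

theorem lintegral_inner_pow_mul_measure_closedBall_ge [IsProbabilityMeasure ν] {τ : ℝ} {u : En k}
    (hmom : ENNReal.ofReal (τ ^ (2 * k)) ≤ ∫⁻ y, ENNReal.ofReal (⟪y, u⟫ ^ (2 * k)) ∂ν) :
    volume (Metric.closedBall (0 : En k) r) * ENNReal.ofReal (τ ^ (2 * k)) ≤
      ∫⁻ x, ENNReal.ofReal (⟪x, u⟫ ^ (2 * k)) * ν (Metric.closedBall x r) := by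
  rw [lintegral_mul_measure_closedBall (by fun_prop)]
  calc _ ≤ volume (Metric.closedBall (0 : En k) r) *
        ∫⁻ y, ENNReal.ofReal (⟪y, u⟫ ^ (2 * k)) ∂ν := by gcongr
    _ = ∫⁻ y, volume (Metric.closedBall (0 : En k) r) * ENNReal.ofReal (⟪y, u⟫ ^ (2 * k)) ∂ν := by
      rw [lintegral_const_mul _ (by fun_prop)]
    _ ≤ _ := lintegral_mono fun y => lintegral_inner_pow_add_ge y u k

theorem lintegral_measure_closedBall [IsProbabilityMeasure ν] :
    ∫⁻ x, ν (Metric.closedBall x r) = volume (Metric.closedBall (0 : En k) r) := by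
  have h := lintegral_mul_measure_closedBall (ν := ν) (r := r) (f := fun _ => 1) measurable_const
  simpa using h

theorem MeasLogConcave.lintegral_inner_pow_mul_measure_closedBall_le [IsProbabilityMeasure ν]
    (hν : MeasLogConcave ν) (hk : 1 ≤ k) (h0 : ν (Metric.closedBall 0 r) ≠ 0) {u : En k} {σ : ℝ}
    (hσ : 0 < σ) (hu : ∀ x, σ < |⟪x, u⟫| →
      ν (Metric.closedBall x r) ≤ ENNReal.ofReal ((1 / 16) ^ k) * ν (Metric.closedBall 0 r)) :
    ∫⁻ x, ENNReal.ofReal (⟪x, u⟫ ^ (2 * k)) * ν (Metric.closedBall x r) ≤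
      ENNReal.ofReal (σ ^ (2 * k) * 17 ^ k) * volume (Metric.closedBall (0 : En k) r) := by
  set c : ℕ → ℝ := fun i => σ ^ (2 * k) * ((i : ℝ) + 2) ^ (2 * k) * ((1 / 16) ^ k) ^ i with hc
  have hpt : ∀ x, ENNReal.ofReal (⟪x, u⟫ ^ (2 * k)) * ν (Metric.closedBall x r) ≤
      ENNReal.ofReal (σ ^ (2 * k)) * ν (Metric.closedBall x r) +
        ∑' i : ℕ, ENNReal.ofReal (c i) * ν (Metric.closedBall (((i : ℝ) + 1)⁻¹ • x) r) := by
    intro x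
    have habs : ⟪x, u⟫ ^ (2 * k) = |⟪x, u⟫| ^ (2 * k) := ((even_two_mul k).pow_abs _).symm
    rw [habs]
    rcases le_or_gt |⟪x, u⟫| σ with hx | hx
    · refine le_trans ?_ le_self_add
      gcongr
    · set i := ⌈|⟪x, u⟫| / σ⌉₊ - 2 with hi
      have hs : 1 < |⟪x, u⟫| / σ := (one_lt_div hσ).2 hx
      have hceil : 2 ≤ ⌈|⟪x, u⟫| / σ⌉₊ := Nat.lt_ceil.2 (by exact_mod_cast hs)
      have h2 : ((i : ℝ) + 2) = ⌈|⟪x, u⟫| / σ⌉₊ := by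
        rw [hi, Nat.cast_sub hceil]
        push_cast
        ring
      have h3 : |⟪x, u⟫| ≤ σ * ((i : ℝ) + 2) := by
        rw [h2, mul_comm, ← div_le_iff₀ hσ]
        exact Nat.le_ceil _
      have h4 : σ * ((i : ℝ) + 1) < |⟪x, u⟫| := by
        have := Nat.ceil_lt_add_one (a := |⟪x, u⟫| / σ) (by positivity)
        rw [← h2] at this
        rw [mul_comm, ← lt_div_iff₀ hσ]
        linarith
      have hi1 : (0 : ℝ) < (i : ℝ) + 1 := by positivity
      have h5 := hν.measure_closedBall_le_of_inv_smul h0 x i (hu _ (by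
        rw [inner_smul_left, conj_trivial, abs_mul, abs_of_pos (inv_pos.2 hi1), ← div_eq_inv_mul,
          lt_div_iff₀ hi1]
        exact h4))
      refine le_trans ?_ le_add_self
      refine le_trans ?_ (ENNReal.le_tsum i)
      calc _ ≤ ENNReal.ofReal ((σ * ((i : ℝ) + 2)) ^ (2 * k)) * (ENNReal.ofReal ((1 / 16) ^ k) ^ i *
            ν (Metric.closedBall (((i : ℝ) + 1)⁻¹ • x) r)) := by gcongr
        _ = _ := by
          rw [← mul_assoc, ← ENNReal.ofReal_pow (by positivity), ← ENNReal.ofReal_mul (by positivity),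
            mul_pow]
  have hnum : ∀ i : ℕ, c i * ((i : ℝ) + 1) ^ k ≤ σ ^ (2 * k) * 8 ^ k * (1 / 2) ^ i := by
    intro i
    have h1 : (i : ℝ) + 2 ≤ 2 * 2 ^ i := by
      have : i + 1 ≤ 2 ^ i := Nat.lt_two_pow_self
      have h' : (i : ℝ) + 1 ≤ 2 ^ i := by exact_mod_cast this
      have : (1 : ℝ) ≤ 2 ^ i := one_le_pow₀ (by norm_num)
      linarith
    have h1' : (i : ℝ) + 1 ≤ 2 * 2 ^ i := by linarith
    have h2 : c i * ((i : ℝ) + 1) ^ k =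
        σ ^ (2 * k) * ((((i : ℝ) + 2) ^ 2 * ((i : ℝ) + 1)) * (1 / 16) ^ i) ^ k := by
      simp only [hc]
      rw [mul_pow, mul_pow, ← pow_mul, ← pow_mul, ← pow_mul, mul_comm i k]
      ring
    have h3 : (((i : ℝ) + 2) ^ 2 * ((i : ℝ) + 1)) * (1 / 16) ^ i ≤ 8 * (1 / 2) ^ i := by
      calc _ ≤ ((2 * 2 ^ i) ^ 2 * (2 * 2 ^ i)) * (1 / 16 : ℝ) ^ i := by gcongr
        _ = 8 * ((2 : ℝ) ^ i * 2 ^ i * 2 ^ i * (1 / 16 : ℝ) ^ i) := by ring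
        _ = 8 * (1 / 2) ^ i := by rw [← mul_pow, ← mul_pow, ← mul_pow]; norm_num
    have h4 : ((1 / 2 : ℝ) ^ i) ^ k ≤ (1 / 2) ^ i :=
      pow_le_of_le_one (by positivity) (pow_le_one₀ (by norm_num) (by norm_num)) (by omega)
    rw [h2, mul_assoc (σ ^ (2 * k)) (8 ^ k)]
    refine mul_le_mul_of_nonneg_left ?_ (by positivity)
    calc _ ≤ (8 * (1 / 2 : ℝ) ^ i) ^ k := by gcongr
      _ = 8 ^ k * ((1 / 2 : ℝ) ^ i) ^ k := by rw [mul_pow]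
      _ ≤ _ := mul_le_mul_of_nonneg_left h4 (by positivity)
  have hφ := measurable_measure_closedBall (ν := ν) (r := r)
  have hφ' : ∀ i : ℕ, Measurable fun x : En k => ν (Metric.closedBall (((i : ℝ) + 1)⁻¹ • x) r) :=
    fun i => hφ.comp (measurable_const_smul _)
  set V := volume (Metric.closedBall (0 : En k) r) with hV
  have hterm : ∀ i : ℕ, ∫⁻ x, ENNReal.ofReal (c i) * ν (Metric.closedBall (((i : ℝ) + 1)⁻¹ • x) r) ≤
      ENNReal.ofReal (σ ^ (2 * k) * 8 ^ k * (1 / 2) ^ i) * V := by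
    intro i
    rw [lintegral_const_mul _ (hφ' i), lintegral_comp_inv_smul hφ (by positivity),
      lintegral_measure_closedBall, ← mul_assoc, ← ENNReal.ofReal_mul (by positivity)]
    exact mul_le_mul_left (ENNReal.ofReal_le_ofReal (hnum i)) V
  refine (lintegral_mono hpt).trans ?_
  rw [lintegral_add_left (hφ.const_mul _), lintegral_tsum fun i => ((hφ' i).const_mul _).aemeasurable,
    lintegral_const_mul _ hφ, lintegral_measure_closedBall]
  have hsum : ∑' i : ℕ, ENNReal.ofReal (σ ^ (2 * k) * 8 ^ k * (1 / 2) ^ i) =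
      ENNReal.ofReal (σ ^ (2 * k) * 8 ^ k * 2) := by
    rw [← ENNReal.ofReal_tsum_of_nonneg (fun i => by positivity)
      (summable_geometric_two.mul_left _), tsum_mul_left, tsum_geometric_two]
  calc _ ≤ ENNReal.ofReal (σ ^ (2 * k)) * V +
        ∑' i : ℕ, ENNReal.ofReal (σ ^ (2 * k) * 8 ^ k * (1 / 2) ^ i) * V := by
        gcongr with i
        exact hterm i
    _ = ENNReal.ofReal (σ ^ (2 * k) + σ ^ (2 * k) * 8 ^ k * 2) * V := by
      rw [ENNReal.tsum_mul_right, hsum, ← add_mul, ← ENNReal.ofReal_add (by positivity)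
        (by positivity)]
    _ ≤ _ := by
      gcongr
      have h8 : (1 : ℝ) + 8 ^ k * 2 ≤ 17 ^ k := by
        obtain ⟨m, rfl⟩ : ∃ m, k = m + 1 := ⟨k - 1, by omega⟩
        have h1 : (1 : ℝ) ≤ 17 ^ m := one_le_pow₀ (by norm_num)
        have h2 : (8 : ℝ) ^ m ≤ 17 ^ m := by gcongr; norm_num
        rw [pow_succ, pow_succ]
        linarith
      calc σ ^ (2 * k) + σ ^ (2 * k) * 8 ^ k * 2 = σ ^ (2 * k) * (1 + 8 ^ k * 2) := by ring
        _ ≤ _ := by gcongr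

/-- If all the one-dimensional marginals of an even log-concave probability measure on `ℝᵏ` have
large moments of order `2k`, then small balls have small measure. -/
theorem MeasLogConcave.measure_closedBall_le [IsProbabilityMeasure ν] (hν : MeasLogConcave ν)
    (heven : ν.map (fun x => -x) = ν) (hk : 1 ≤ k) {τ : ℝ} (hr : 0 < r) (hτ : 0 < τ)
    (hmom : ∀ u, ‖u‖ = 1 →
      ENNReal.ofReal (τ ^ (2 * k)) ≤ ∫⁻ y, ENNReal.ofReal (⟪y, u⟫ ^ (2 * k)) ∂ν) :
    ν (Metric.closedBall 0 r) ≤ ENNReal.ofReal ((80 * r / τ) ^ k) := by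
  by_cases h0 : ν (Metric.closedBall 0 r) = 0
  · rw [h0]
    exact zero_le
  set P := ν (Metric.closedBall 0 r) with hP
  have hPt : P ≠ ∞ := measure_ne_top _ _
  set t := ENNReal.ofReal ((1 / 16) ^ k) * P with ht
  have ht0 : t ≠ 0 := mul_ne_zero (by simp) h0
  have htt : t ≠ ∞ := ENNReal.mul_ne_top ENNReal.ofReal_ne_top hPt
  set K : Set (En k) := {x | t ≤ ν (Metric.closedBall x r)} with hK
  have hKc : Convex ℝ K := hν.convex_level ht0 htt
  set V := volume (Metric.closedBall (0 : En k) r) with hV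
  have hV0 : V ≠ 0 := (Metric.measure_closedBall_pos volume _ hr).ne'
  have hVt : V ≠ ∞ := measure_closedBall_lt_top.ne
  have hsub : Metric.ball (0 : En k) (τ / 5) ⊆ closure K := by
    intro z hz
    rw [mem_ball_zero_iff] at hz
    by_contra hzK
    obtain ⟨f, s, hf, hfz⟩ := geometric_hahn_banach_closed_point hKc.closure isClosed_closure hzK
    have h0K : (0 : En k) ∈ K := by
      show t ≤ P
      calc t ≤ 1 * P := by
            rw [ht]
            gcongr
            exact ENNReal.ofReal_le_one.2 (pow_le_one₀ (by norm_num) (by norm_num))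
        _ = P := one_mul _
    have hs0 : 0 < s := by simpa using hf 0 (subset_closure h0K)
    have hf0 : f ≠ 0 := by
      rintro rfl
      simp only [zero_apply] at hfz
      linarith
    have hfn : 0 < ‖f‖ := norm_pos_iff.2 hf0
    set w := (InnerProductSpace.toDual ℝ (En k)).symm f with hw
    have hwn : ‖w‖ = ‖f‖ := LinearIsometryEquiv.norm_map _ _
    have hwf : ∀ x, ⟪x, w⟫ = f x := fun x => by
      rw [real_inner_comm, hw, InnerProductSpace.toDual_symm_apply]
    set u := ‖w‖⁻¹ • w with hu
    have hu1 : ‖u‖ = 1 := norm_smul_inv_norm (norm_pos_iff.1 (hwn ▸ hfn))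
    have hux : ∀ x, ⟪x, u⟫ = f x / ‖f‖ := fun x => by
      rw [hu, inner_smul_right, hwf, hwn, div_eq_inv_mul]
    have hout : ∀ x, τ / 5 < |⟪x, u⟫| → ν (Metric.closedBall x r) ≤ t := by
      intro x hx
      by_contra! hlt
      have hxK : x ∈ K := hlt.le
      have hnxK : -x ∈ K := by
        show t ≤ _
        rw [measure_closedBall_neg heven]
        exact hlt.le
      have h1 := hf x (subset_closure hxK)
      have h2 := hf (-x) (subset_closure hnxK)
      rw [map_neg] at h2
      have h3 : |f x| < s := abs_lt.2 ⟨by linarith, h1⟩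
      have h4 : f z ≤ ‖f‖ * ‖z‖ := (le_abs_self _).trans (f.le_opNorm z)
      rw [hux, abs_div, abs_of_pos hfn, lt_div_iff₀ hfn] at hx
      nlinarith
    have hup := hν.lintegral_inner_pow_mul_measure_closedBall_le hk h0 (by positivity) hout
    have hlow := (lintegral_inner_pow_mul_measure_closedBall_ge (r := r) (hmom u hu1)).trans hup
    rw [mul_comm, ENNReal.mul_le_mul_iff_left hV0 hVt, ENNReal.ofReal_le_ofReal_iff (by positivity),
      div_pow, pow_mul 5] at hlow
    have h17 : (17 : ℝ) ^ k < (5 ^ 2) ^ k := by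
      gcongr
      norm_num
    rw [div_mul_eq_mul_div, le_div_iff₀ (by positivity)] at hlow
    have : 0 < τ ^ (2 * k) := by positivity
    nlinarith
  have hvol : volume (Metric.ball (0 : En k) (τ / 5)) ≤ volume K :=
    (measure_mono hsub).trans_eq (measure_closure_of_null_frontier (hKc.addHaar_frontier volume))
  have hmarkov : t * volume K ≤ V := by
    rw [hV, ← lintegral_measure_closedBall (ν := ν)]
    exact mul_meas_ge_le_lintegral₀ measurable_measure_closedBall.aemeasurable t
  set ω := volume (Metric.ball (0 : En k) 1) with hω
  have hω0 : ω ≠ 0 := (Metric.measure_ball_pos volume _ one_pos).ne'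
  have hωt : ω ≠ ∞ := measure_ball_lt_top.ne
  have h1 : t * volume (Metric.ball (0 : En k) (τ / 5)) ≤ V := by
    refine le_trans ?_ hmarkov
    gcongr
  rw [hV, Measure.addHaar_ball_of_pos _ _ (by positivity), Measure.addHaar_closedBall _ _ hr.le,
    finrank_euclideanSpace_fin, ← mul_assoc, ← hω, ENNReal.mul_le_mul_iff_left hω0 hωt, ht] at h1
  have h2 := mul_le_mul_right h1 (ENNReal.ofReal ((80 / τ) ^ k))
  rw [← ENNReal.ofReal_mul (by positivity), ← mul_pow, mul_right_comm, ← mul_assoc,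
    ← ENNReal.ofReal_mul (by positivity), ← ENNReal.ofReal_mul (by positivity), ← mul_pow, ← mul_pow,
    show 80 / τ * (1 / 16 * (τ / 5)) = 1 by field_simp; norm_num, one_pow, ENNReal.ofReal_one,
    one_mul, div_mul_eq_mul_div] at h2
  exact h2

end LevelSet

open ProbabilityTheory

namespace IsEvenLogConcaveTwo

variable {n k : ℕ} {ν : Measure (En n)}

theorem measure_norm_colMul_le (hν : IsEvenLogConcaveTwo ν) (hk : 1 ≤ k)
    (Γ : EuclideanSpace ℝ (Fin k × Fin n)) {R τ : ℝ} (hR : 0 < R) (hτ : 0 < τ)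
    (hΓ : ∀ u, ‖u‖ = 1 →
      ENNReal.ofReal (τ ^ (2 * k)) ≤ ∫⁻ x, ENNReal.ofReal (⟪x, rowMul Γ u⟫ ^ (2 * k)) ∂ν) :
    ν {x | ‖colMul Γ x‖ ≤ R} ≤ ENNReal.ofReal ((80 * R / τ) ^ k) := by
  have := hν.prob
  have hmeas : Measurable (colMul Γ) :=
    (continuous_colMul.comp (f := fun x => (Γ, x)) (by fun_prop)).measurable
  have : IsProbabilityMeasure (ν.map (colMul Γ)) :=
    Measure.isProbabilityMeasure_map hmeas.aemeasurable
  have hlc : MeasLogConcave (ν.map (colMul Γ)) := hν.logConcave.map (colMulₗ Γ) hmeas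
  have heven : (ν.map (colMul Γ)).map (fun y => -y) = ν.map (colMul Γ) := by
    rw [Measure.map_map measurable_neg hmeas]
    conv_rhs => rw [← hν.even, Measure.map_map hmeas measurable_neg]
    congr 1
    ext1 x
    exact ((colMulₗ Γ).map_neg x).symm
  have h := hlc.measure_closedBall_le heven hk hR hτ fun u hu => by
    rw [lintegral_map (by fun_prop) hmeas]
    refine (hΓ u hu).trans_eq (lintegral_congr fun x => ?_)
    rw [inner_colMul, ← inner_rowMul, real_inner_comm]
  rw [Measure.map_apply hmeas Metric.isClosed_closedBall.measurableSet] at h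
  convert h using 2
  ext x
  simp

theorem measure_closedBall_le_of_good (hν : IsEvenLogConcaveTwo ν) {ρ R : ℝ} (hρ : 0 < ρ)
    (hR : 0 < R) {S : Set (EuclideanSpace ℝ (Fin k × Fin n))} (hS : MeasurableSet S)
    (hS2 : 1 / 2 ≤ stdGaussian (EuclideanSpace ℝ (Fin k × Fin n)) S) {β : ℝ≥0∞}
    (hβ : ∀ Γ ∈ S, ν {x | ‖colMul Γ x‖ ≤ R} ≤ β) :
    ν (Metric.closedBall 0 ρ) ≤
      2 * (β + ENNReal.ofReal (2 ^ k * exp (-(R / ρ) ^ 2 / 4))) := by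
  have := hν.prob
  set μ := stdGaussian (EuclideanSpace ℝ (Fin k × Fin n)) with hμ
  set γ := ENNReal.ofReal (2 ^ k * exp (-(R / ρ) ^ 2 / 4)) with hγ
  set B := Metric.closedBall (0 : En n) ρ with hB
  have hBm : MeasurableSet B := Metric.isClosed_closedBall.measurableSet
  have hcm := (continuous_colMul (k := k) (n := n)).norm.measurable
  set D : Set (EuclideanSpace ℝ (Fin k × Fin n) × En n) :=
    {p | p.1 ∈ S ∧ ‖colMul p.1 p.2‖ ≤ R} with hD
  set G : Set (EuclideanSpace ℝ (Fin k × Fin n) × En n) :=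
    {p | p.2 ∈ B ∧ R < ‖colMul p.1 p.2‖} with hG
  have hDm : MeasurableSet D := (measurable_fst hS).inter (measurableSet_le hcm measurable_const)
  have hGm : MeasurableSet G := (measurable_snd hBm).inter (measurableSet_lt measurable_const hcm)
  have h1 : (μ.prod ν) D ≤ β := by
    rw [Measure.prod_apply hDm]
    calc _ ≤ ∫⁻ _, β ∂μ := by
          refine lintegral_mono fun Γ => ?_
          by_cases hΓ : Γ ∈ S
          · exact (measure_mono fun x hx => hx.2).trans (hβ Γ hΓ)
          · have : Prod.mk Γ ⁻¹' D = ∅ := Set.eq_empty_of_forall_notMem fun x hx => hΓ hx.1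
            rw [this, measure_empty]
            exact zero_le
      _ = β := by simp
  have h2 : (μ.prod ν) G ≤ γ := by
    rw [Measure.prod_apply_symm hGm]
    calc _ ≤ ∫⁻ _, γ ∂ν := by
          refine lintegral_mono fun x => ?_
          by_cases hx : x ∈ B
          · exact (measure_mono fun Γ hΓ => hΓ.2).trans
              (stdGaussian_lt_norm_colMul_le hρ hR.le (mem_closedBall_zero_iff.1 hx))
          · have : (fun Γ => (Γ, x)) ⁻¹' G = ∅ := Set.eq_empty_of_forall_notMem fun Γ hΓ => hx hΓ.1
            rw [this, measure_empty]
            exact zero_le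
      _ = γ := by simp
  have h3 : S ×ˢ B ⊆ D ∪ G := by
    rintro ⟨Γ, x⟩ ⟨hΓ, hx⟩
    rcases le_or_gt ‖colMul Γ x‖ R with h | h
    · exact Or.inl ⟨hΓ, h⟩
    · exact Or.inr ⟨hx, h⟩
  have h4 : μ S * ν B ≤ β + γ := by
    rw [← Measure.prod_prod]
    exact (measure_mono h3).trans ((measure_union_le _ _).trans (add_le_add h1 h2))
  calc ν B = 2 * (1 / 2 * ν B) := by
        rw [← mul_assoc, one_div, ENNReal.mul_inv_cancel (by simp) (by simp), one_mul]
    _ ≤ 2 * (μ S * ν B) := by gcongr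
    _ ≤ _ := by gcongr

theorem measure_closedBall_le (hν : IsEvenLogConcaveTwo ν) (hk : 1 ≤ k)
    (hkn : (10 : ℝ) ^ 8 * k ^ 2 ≤ n) {δ : ℝ} (hδ : 0 < δ) (hδ1 : δ ≤ 1 / 60000) :
    ν (Metric.closedBall 0 (2 * δ ^ 4 * √n)) ≤ ENNReal.ofReal (δ ^ k) := by
  have hk0 : (1 : ℝ) ≤ k := by exact_mod_cast hk
  have hn0 : (0 : ℝ) < n := lt_of_lt_of_le (by positivity) hkn
  obtain ⟨M, hM, hMn, hlow, hup⟩ := hν.exists_scale hk hkn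
  have hc : Continuous (hν.momentSeminorm hk) :=
    Seminorm.continuous_of_le_mul_norm (by positivity) (hν.momentSeminorm_le hk)
  obtain ⟨S, hS, hS2, hgood⟩ := exists_good_matrices hc hM hk hlow hup
  set ρ := 2 * δ ^ 4 * √n with hρ
  have hρ0 : 0 < ρ := by positivity
  set R := ρ * (√k / δ ^ 2) with hR
  have hR0 : 0 < R := by positivity
  have hsqrt : √n * √k ≤ 10 * M := by
    rw [← Real.sqrt_mul hn0.le]
    refine Real.sqrt_le_iff.2 ⟨by positivity, ?_⟩
    nlinarith
  have hratio : 80 * R / (M / 8) ≤ 12800 * δ ^ 2 := by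
    rw [div_le_iff₀ (by positivity), hR, hρ,
      show 80 * (2 * δ ^ 4 * √n * (√k / δ ^ 2)) = 160 * δ ^ 2 * (√n * √k) by field_simp; norm_num]
    have : 0 < δ ^ 2 := by positivity
    nlinarith
  have hβ : ∀ Γ ∈ S, ν {x | ‖colMul Γ x‖ ≤ R} ≤ ENNReal.ofReal ((12800 * δ ^ 2) ^ k) := by
    intro Γ hΓ
    refine (hν.measure_norm_colMul_le hk Γ hR0 (τ := M / 8) (by positivity) fun u hu => ?_).trans ?_
    · rw [← hν.momentSeminorm_pow hk]
      have := hgood Γ hΓ u hu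
      gcongr
    · gcongr
  refine (hν.measure_closedBall_le_of_good hρ0 hR0 hS hS2 hβ).trans ?_
  have hexp : 2 ^ k * exp (-(R / ρ) ^ 2 / 4) ≤ (12800 * δ ^ 2) ^ k := by
    have h1 : -(R / ρ) ^ 2 / 4 = k * (-(1 / (4 * δ ^ 4))) := by
      rw [hR, mul_div_cancel_left₀ _ hρ0.ne', div_pow, Real.sq_sqrt (by positivity)]
      field_simp
    have h2 : exp (-(1 / (4 * δ ^ 4))) ≤ 4 * δ ^ 4 := by
      have := Real.add_one_le_exp (1 / (4 * δ ^ 4))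
      rw [Real.exp_neg, inv_le_comm₀ (Real.exp_pos _) (by positivity), ← one_div]
      linarith
    rw [h1, Real.exp_nat_mul, ← mul_pow]
    have h3 : 2 * exp (-(1 / (4 * δ ^ 4))) ≤ 12800 * δ ^ 2 := by
      have : δ ^ 2 ≤ 1 := pow_le_one₀ hδ.le (by linarith)
      nlinarith
    gcongr
  have hfin : 2 * ((12800 * δ ^ 2) ^ k + (12800 * δ ^ 2) ^ k) ≤ δ ^ k := by
    calc 2 * ((12800 * δ ^ 2) ^ k + (12800 * δ ^ 2) ^ k) = 4 * (12800 * δ ^ 2) ^ k := by ring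
      _ ≤ 4 ^ k * (12800 * δ ^ 2) ^ k := by
        gcongr
        exact le_self_pow₀ (by norm_num) (by omega)
      _ = (4 * (12800 * δ ^ 2)) ^ k := (mul_pow 4 (12800 * δ ^ 2) k).symm
      _ ≤ δ ^ k := by
        gcongr
        nlinarith
  refine le_trans ?_ (ENNReal.ofReal_le_ofReal hfin)
  rw [ENNReal.ofReal_mul zero_le_two, ENNReal.ofReal_add (by positivity) (by positivity),
    ENNReal.ofReal_ofNat]
  exact mul_le_mul_right (add_le_add_right (ENNReal.ofReal_le_ofReal hexp) _) _

theorem measure_closedBall_le_mul (hν : IsEvenLogConcaveTwo ν) (hn : n ≠ 0) {ρ : ℝ} (hρ : 0 < ρ) :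
    ν (Metric.closedBall 0 ρ) ≤ ENNReal.ofReal (80 * ρ) := by
  set j : Fin n := ⟨0, Nat.pos_of_ne_zero hn⟩
  set Γ : EuclideanSpace ℝ (Fin 1 × Fin n) := WithLp.toLp 2 fun p => if p.2 = j then 1 else 0 with hΓ
  have hrow : ∀ u : En 1, rowMul Γ u = EuclideanSpace.single j (u 0) := by
    intro u
    ext i
    simp [rowMul, hΓ]
  have h := hν.measure_norm_colMul_le le_rfl Γ hρ one_pos fun u hu => by
    have hu0 : ‖rowMul Γ u‖ = 1 := by
      rw [hrow, PiLp.norm_single, ← hu, EuclideanSpace.norm_eq]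
      simp [Real.sqrt_sq_eq_abs]
    rw [mul_one, hν.moment, hu0]
    exact ENNReal.ofReal_le_ofReal (by norm_num)
  rw [pow_one, div_one] at h
  refine (measure_mono fun x hx => ?_).trans h
  show ‖colMul Γ x‖ ≤ ρ
  have hcol : ‖colMul Γ x‖ = ‖x j‖ := by
    rw [EuclideanSpace.norm_eq]
    simp [colMul, hΓ, Real.sqrt_sq_eq_abs]
  rw [hcol]
  exact (PiLp.norm_apply_le x j).trans (mem_closedBall_zero_iff.1 hx)

end IsEvenLogConcaveTwo

theorem exists_pmeas_le {n : ℕ} {p : En n → ℝ} (hp : IsLogConcave p) (hd : IsDensity p)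
    (hi : IsIsotropic p) (δ : ℝ) : ∃ ν : Measure (En n), IsEvenLogConcaveTwo ν ∧
      ∀ s : ℝ, 0 ≤ s → ν (Metric.closedBall 0 (2 * δ ^ 4 * √n)) ≤ ENNReal.ofReal (s ^ 2) →
        pmeas p {x | ‖x‖ ^ 2 ≤ δ ^ 8 * n} ≤ s := by
  obtain ⟨ν, hν, hle⟩ := exists_symmetrization hp hd hi
  refine ⟨ν, hν, fun s hs h => ?_⟩
  have := isProbabilityMeasure_densityMeasure hp hd
  have hset : {x : En n | ‖x‖ ^ 2 ≤ δ ^ 8 * n} = Metric.closedBall 0 (δ ^ 4 * √n) := by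
    ext x
    rw [Set.mem_ofPred_eq, mem_closedBall_zero_iff, ← pow_le_pow_iff_left₀ (norm_nonneg x)
      (by positivity) two_ne_zero, mul_pow, Real.sq_sqrt (by positivity), ← pow_mul]
  rw [hset, pmeas_eq hp hd Metric.isClosed_closedBall.measurableSet]
  refine ENNReal.toReal_le_of_le_ofReal hs ?_
  have h1 := (hle (δ ^ 4 * √n)).trans_eq (by rw [← mul_assoc]) |>.trans h
  rw [ENNReal.ofReal_pow hs] at h1
  exact (ENNReal.pow_le_pow_left_iff two_ne_zero).1 h1

theorem pmeas_norm_sq_le_rpow {n : ℕ} {p : En n → ℝ} (hp : IsLogConcave p) (hd : IsDensity p)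
    (hi : IsIsotropic p) {δ : ℝ} (hδ : 0 < δ) (hδ1 : δ ≤ 1 / 60000) :
    pmeas p {x | ‖x‖ ^ 2 ≤ δ ^ 8 * n} ≤ δ ^ (√n / 40000) := by
  rcases eq_or_ne n 0 with rfl | hn
  · have := isProbabilityMeasure_densityMeasure hp hd
    rw [pmeas_eq hp hd (measurableSet_le (by fun_prop) (by fun_prop))]
    rw [Nat.cast_zero, Real.sqrt_zero, zero_div, rpow_zero]
    exact measureReal_le_one
  obtain ⟨ν, hν, hle⟩ := exists_pmeas_le hp hd hi δ
  have hδ2 : δ ≤ 1 := by linarith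
  have hn0 : (0 : ℝ) < n := by exact_mod_cast Nat.pos_of_ne_zero hn
  refine hle _ (by positivity) ?_
  rw [← rpow_mul_natCast hδ.le]
  rcases lt_or_ge (√n) (10 ^ 4) with hsmall | hbig
  · refine (hν.measure_closedBall_le_mul hn (by positivity)).trans (ENNReal.ofReal_le_ofReal ?_)
    calc 80 * (2 * δ ^ 4 * √n) ≤ 80 * (2 * δ ^ 4 * 10 ^ 4) := by gcongr
      _ = 1600000 * δ ^ 3 * δ := by ring
      _ ≤ 1600000 * (1 / 60000) ^ 3 * δ := by gcongr
      _ ≤ 1 * δ := by gcongr; norm_num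
      _ = δ ^ (1 : ℝ) := by rw [one_mul, rpow_one]
      _ ≤ δ ^ (√n / 40000 * (2 : ℕ)) := by
        refine rpow_le_rpow_of_exponent_ge hδ hδ2 ?_
        push_cast
        linarith
  · set k := ⌊√n / 10 ^ 4⌋₊ with hk
    have hk1 : 1 ≤ k := Nat.le_floor (by rw [Nat.cast_one, le_div_iff₀ (by positivity)]; linarith)
    have hkle : (k : ℝ) ≤ √n / 10 ^ 4 := Nat.floor_le (by positivity)
    have hkgt : √n / 10 ^ 4 < k + 1 := Nat.lt_floor_add_one _
    have hkn : (10 : ℝ) ^ 8 * k ^ 2 ≤ n := by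
      calc (10 : ℝ) ^ 8 * k ^ 2 ≤ 10 ^ 8 * (√n / 10 ^ 4) ^ 2 := by gcongr
        _ = √n ^ 2 := by ring
        _ = n := Real.sq_sqrt hn0.le
    refine (hν.measure_closedBall_le hk1 hkn hδ hδ1).trans (ENNReal.ofReal_le_ofReal ?_)
    rw [← rpow_natCast]
    refine rpow_le_rpow_of_exponent_ge hδ hδ2 ?_
    have hk0 : (1 : ℝ) ≤ k := by exact_mod_cast hk1
    push_cast
    linarith

/-- There is a universal constant `c > 0` such that for every isotropic
logconcave probability density `p` on `ℝⁿ` and every `0 < ε ≤ c`,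
`P(‖x‖² ≤ ε·n) ≤ ε^{c·√n}`. -/
theorem small_ball_probability_unconditional :
    ∃ c : ℝ, 0 < c ∧
      ∀ (n : ℕ) (p : En n → ℝ),
        IsLogConcave p → IsDensity p → IsIsotropic p →
        ∀ ε : ℝ, 0 < ε → ε ≤ c →
          pmeas p {x | ‖x‖ ^ 2 ≤ ε * n} ≤ ε ^ (c * Real.sqrt n) := by
  refine ⟨(1 / 60000) ^ 8, by positivity, fun n p hp hd hi ε hε hεc => ?_⟩
  set δ := ε ^ (1 / 8 : ℝ) with hδ
  have hδ0 : 0 < δ := rpow_pos_of_pos hε _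
  have hδ8 : δ ^ 8 = ε := by
    rw [hδ, ← rpow_mul_natCast hε.le]
    norm_num
  have hδ1 : δ ≤ 1 / 60000 := by
    rwa [← pow_le_pow_iff_left₀ hδ0.le (by norm_num) (by norm_num : 8 ≠ 0), hδ8]
  have h := pmeas_norm_sq_le_rpow hp hd hi hδ0 hδ1
  rw [hδ8, hδ, ← rpow_mul hε.le] at h
  refine h.trans (rpow_le_rpow_of_exponent_ge hε (hεc.trans (by norm_num)) ?_)
  have := Real.sqrt_nonneg n
  linarith
end

section
/- There is a universal constant c > 0 such that for all real numbers a < y < b and all 0 < g ≤ 1/2 satisfying ∫_y^b e^{−x²/2} dx = g · ∫_a^b e^{−x²/2} dx, one has e^{−y²/2} ≥ c · g · √(log(1/g)) · ∫_a^b e^{−x²/2} dx. -/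
open Real

lemma intervalIntegrable_exp_neg_sq_half (a b : ℝ) :
    IntervalIntegrable (fun x : ℝ => Real.exp (-x ^ 2 / 2)) MeasureTheory.volume a b :=
  Continuous.intervalIntegrable (by fun_prop) a b

/-- The mass that `e^{−x²/2}` gives to an interval is at most `√(2π) ≤ 3`. -/
lemma integral_exp_neg_sq_half_le_three {a b : ℝ} (hab : a ≤ b) :
    ∫ x in a..b, Real.exp (-x ^ 2 / 2) ≤ 3 := by
  have hfun : (fun x : ℝ => Real.exp (-x ^ 2 / 2)) = fun x => Real.exp (-(1 / 2) * x ^ 2) := by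
    funext x
    ring_nf
  rw [hfun, intervalIntegral.integral_of_le hab]
  calc ∫ x in Set.Ioc a b, Real.exp (-(1 / 2) * x ^ 2)
      ≤ ∫ x, Real.exp (-(1 / 2) * x ^ 2) :=
        MeasureTheory.setIntegral_le_integral (integrable_exp_neg_mul_sq (by norm_num))
          (Filter.Eventually.of_forall fun x => (Real.exp_pos _).le)
    _ = √(π / (1 / 2)) := integral_gaussian _
    _ ≤ 3 := Real.sqrt_le_iff.2 ⟨by norm_num, by linarith [Real.pi_lt_four]⟩

lemma integral_exp_neg_sq_half_tail_le {y b : ℝ} (hy : 0 ≤ y) (hyb : y ≤ b) :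
    ∫ x in y..b, Real.exp (-x ^ 2 / 2) ≤ 3 * Real.exp (-y ^ 2 / 2) := by
  calc ∫ x in y..b, Real.exp (-x ^ 2 / 2)
      ≤ ∫ x in y..b, Real.exp (-y ^ 2 / 2) * Real.exp (-(x - y) ^ 2 / 2) := by
        refine intervalIntegral.integral_mono_on hyb (intervalIntegrable_exp_neg_sq_half y b)
          (Continuous.intervalIntegrable (by fun_prop) y b) fun x hx => ?_
        rw [← Real.exp_add, Real.exp_le_exp]
        nlinarith [mul_nonneg hy (sub_nonneg.2 hx.1)]
    _ = Real.exp (-y ^ 2 / 2) * ∫ x in (y - y)..(b - y), Real.exp (-x ^ 2 / 2) := by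
        rw [intervalIntegral.integral_const_mul,
          intervalIntegral.integral_comp_sub_right (fun x => Real.exp (-x ^ 2 / 2))]
    _ ≤ Real.exp (-y ^ 2 / 2) * 3 := by
        gcongr
        exact integral_exp_neg_sq_half_le_three (by linarith)
    _ = 3 * Real.exp (-y ^ 2 / 2) := mul_comm _ _

/-- The Mills-ratio bound for the Gaussian tail. -/
lemma mul_integral_exp_neg_sq_half_tail_le {y b : ℝ} (hyb : y ≤ b) :
    y * ∫ x in y..b, Real.exp (-x ^ 2 / 2) ≤ Real.exp (-y ^ 2 / 2) := by
  have hint : ∫ x in y..b, x * Real.exp (-x ^ 2 / 2)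
      = -Real.exp (-b ^ 2 / 2) - -Real.exp (-y ^ 2 / 2) := by
    refine intervalIntegral.integral_eq_sub_of_hasDerivAt
      (f := fun x => -Real.exp (-x ^ 2 / 2)) (fun x _ => ?_)
      (Continuous.intervalIntegrable (by fun_prop) y b)
    have h : HasDerivAt (fun x : ℝ => -x ^ 2 / 2) (-x) x :=
      ((hasDerivAt_pow 2 x).fun_neg.div_const 2).congr_deriv (by norm_num; ring)
    exact h.exp.fun_neg.congr_deriv (by ring)
  calc y * ∫ x in y..b, Real.exp (-x ^ 2 / 2)
      = ∫ x in y..b, y * Real.exp (-x ^ 2 / 2) :=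
        (intervalIntegral.integral_const_mul _ _).symm
    _ ≤ ∫ x in y..b, x * Real.exp (-x ^ 2 / 2) :=
        intervalIntegral.integral_mono_on hyb (Continuous.intervalIntegrable (by fun_prop) y b)
          (Continuous.intervalIntegrable (by fun_prop) y b)
          fun x hx => mul_le_mul_of_nonneg_right hx.1 (Real.exp_pos _).le
    _ ≤ Real.exp (-y ^ 2 / 2) := by
        rw [hint]
        linarith [Real.exp_pos (-b ^ 2 / 2)]

lemma sq_mul_log_one_div_le {t : ℝ} (ht : 0 < t) : t ^ 2 * Real.log (1 / t) ≤ t := by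
  have h := mul_le_mul_of_nonneg_left (Real.log_le_sub_one_of_pos (one_div_pos.2 ht))
    (sq_nonneg t)
  have h' : t ^ 2 * (1 / t - 1) = t - t ^ 2 := by field_simp
  nlinarith [sq_nonneg t]

lemma sq_integral_tail_mul_log_le_of_nonneg {a y b g : ℝ} (hay : a < y) (hyb : y < b)
    (hg : 0 < g) (hy : 0 ≤ y)
    (h : ∫ x in y..b, Real.exp (-x ^ 2 / 2) = g * ∫ x in a..b, Real.exp (-x ^ 2 / 2)) :
    (g * ∫ x in a..b, Real.exp (-x ^ 2 / 2)) ^ 2 * Real.log (1 / g)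
      ≤ (5 * Real.exp (-y ^ 2 / 2)) ^ 2 := by
  have hM : 0 < ∫ x in a..b, Real.exp (-x ^ 2 / 2) :=
    intervalIntegral.intervalIntegral_pos_of_pos (intervalIntegrable_exp_neg_sq_half a b)
      (fun x => Real.exp_pos _) (hay.trans hyb)
  have hM3 := integral_exp_neg_sq_half_le_three (hay.trans hyb).le
  have hT3 := integral_exp_neg_sq_half_tail_le hy hyb.le
  have hyT := mul_integral_exp_neg_sq_half_tail_le hyb.le
  rw [h] at hT3 hyT
  have hF := Real.exp_pos (-y ^ 2 / 2)
  have hlogF := Real.log_exp (-y ^ 2 / 2)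
  set M := ∫ x in a..b, Real.exp (-x ^ 2 / 2)
  set F := Real.exp (-y ^ 2 / 2)
  obtain ⟨s, hs⟩ : ∃ s, s = g * M / F := ⟨_, rfl⟩
  have hs0 : 0 < s := by rw [hs]; positivity
  have hsF : g * M = s * F := by rw [hs]; field_simp
  rw [hsF] at hT3 hyT ⊢
  have hs3 : s ≤ 3 := le_of_mul_le_mul_right hT3 hF
  have hys : y * s ≤ 1 := le_of_mul_le_mul_right (by linarith) hF
  have hlog : Real.log (1 / g) = Real.log M + Real.log (1 / s) + y ^ 2 / 2 := by
    have hg' := congrArg Real.log hsF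
    rw [Real.log_mul hg.ne' hM.ne', Real.log_mul hs0.ne' hF.ne', hlogF] at hg'
    simp only [one_div, Real.log_inv]
    linarith
  have hlogM : Real.log M ≤ 2 := by linarith [Real.log_le_sub_one_of_pos hM]
  have h1 : s ^ 2 * Real.log M ≤ 9 * 2 := by
    have := mul_le_mul_of_nonneg_left hlogM (sq_nonneg s)
    nlinarith
  have h2 : (y * s) ^ 2 ≤ 1 := pow_le_one₀ (by positivity) hys
  have h3 := sq_mul_log_one_div_le hs0
  have h4 : s ^ 2 * Real.log (1 / g) ≤ 25 := by
    rw [hlog]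
    nlinarith
  nlinarith [mul_le_mul_of_nonneg_right h4 (sq_nonneg F)]

lemma sq_integral_tail_mul_log_le_of_neg {a y b g : ℝ} (hay : a < y) (hyb : y < b)
    (hg : 0 < g) (hg2 : g ≤ 1 / 2) (hy : y < 0)
    (h : ∫ x in y..b, Real.exp (-x ^ 2 / 2) = g * ∫ x in a..b, Real.exp (-x ^ 2 / 2)) :
    (g * ∫ x in a..b, Real.exp (-x ^ 2 / 2)) ^ 2 * Real.log (1 / g)
      ≤ (5 * Real.exp (-y ^ 2 / 2)) ^ 2 := by
  have hM : 0 < ∫ x in a..b, Real.exp (-x ^ 2 / 2) :=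
    intervalIntegral.intervalIntegral_pos_of_pos (intervalIntegrable_exp_neg_sq_half a b)
      (fun x => Real.exp_pos _) (hay.trans hyb)
  have hsplit := intervalIntegral.integral_add_adjacent_intervals
    (intervalIntegrable_exp_neg_sq_half a y) (intervalIntegrable_exp_neg_sq_half y b)
  have hleft : ∫ x in a..y, Real.exp (-x ^ 2 / 2) ≤ 3 * Real.exp (-y ^ 2 / 2) := by
    have hrefl := intervalIntegral.integral_comp_neg (a := a) (b := y)
      (fun x : ℝ => Real.exp (-x ^ 2 / 2))
    have htail := integral_exp_neg_sq_half_tail_le (neg_nonneg.2 hy.le) (neg_le_neg hay.le)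
    simp only [neg_sq] at hrefl htail
    rwa [hrefl]
  rw [h] at hsplit
  set M := ∫ x in a..b, Real.exp (-x ^ 2 / 2)
  set F := Real.exp (-y ^ 2 / 2)
  have hMF : M ≤ 6 * F := by nlinarith
  have hlog := sq_mul_log_one_div_le hg
  calc (g * M) ^ 2 * Real.log (1 / g) = M ^ 2 * (g ^ 2 * Real.log (1 / g)) := by ring
    _ ≤ M ^ 2 * (1 / 2) := by gcongr; linarith
    _ ≤ (6 * F) ^ 2 * (1 / 2) := by gcongr
    _ ≤ (5 * F) ^ 2 := by nlinarith [sq_nonneg F]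

/-- One-dimensional Gaussian isoperimetric estimate: if `a < y < b`,
`0 < g ≤ 1/2` and `∫_y^b e^{−x²/2} dx = g·∫_a^b e^{−x²/2} dx`, then
`e^{−y²/2} ≥ c·g·√(log(1/g))·∫_a^b e^{−x²/2} dx`. -/
theorem one_dim_gaussian_isoperimetry :
    ∃ c : ℝ, 0 < c ∧
      ∀ a y b g : ℝ, a < y → y < b → 0 < g → g ≤ 1 / 2 →
        (∫ x in y..b, Real.exp (-x ^ 2 / 2)) = g * ∫ x in a..b, Real.exp (-x ^ 2 / 2) →
        c * g * Real.sqrt (Real.log (1 / g)) * (∫ x in a..b, Real.exp (-x ^ 2 / 2))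
          ≤ Real.exp (-y ^ 2 / 2) := by
  refine ⟨1 / 5, by norm_num, fun a y b g hay hyb hg hg2 h => ?_⟩
  have hlog : 0 ≤ Real.log (1 / g) := by
    refine Real.log_nonneg ?_
    rw [le_div_iff₀ hg]
    linarith
  have hsq : (g * ∫ x in a..b, Real.exp (-x ^ 2 / 2)) ^ 2 * Real.log (1 / g)
      ≤ (5 * Real.exp (-y ^ 2 / 2)) ^ 2 := by
    rcases le_or_gt 0 y with hy | hy
    · exact sq_integral_tail_mul_log_le_of_nonneg hay hyb hg hy h
    · exact sq_integral_tail_mul_log_le_of_neg hay hyb hg hg2 hy h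
  rw [← Real.sq_sqrt hlog, ← mul_pow] at hsq
  have hle := le_of_abs_le (abs_le_of_sq_le_sq hsq (by positivity))
  linarith
end

section
/- For any n×n positive definite matrix A, any n×n symmetric matrix Δ, and any α, β ≥ 0, tr(A^α Δ A^β Δ) ≤ tr(A^{α+β} Δ²). -/
noncomputable section

/-- Real power `A^γ` of a positive definite matrix, via the spectral functional calculus. -/
def Matrix.PosDef.rpow {n : ℕ} {A : Matrix (Fin n) (Fin n) ℝ} (hA : A.PosDef) (γ : ℝ) :
    Matrix (Fin n) (Fin n) ℝ :=
  hA.1.cfc fun x => x ^ γ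

open Matrix

theorem Matrix.trace_diagonal_mul_mul_diagonal_mul {ι : Type*} [Fintype ι] [DecidableEq ι]
    (f g : ι → ℝ) {D : Matrix ι ι ℝ} (hD : D.IsSymm) :
    trace (diagonal f * D * diagonal g * D) = ∑ i, ∑ j, f i * g j * D i j ^ 2 := by
  simp only [trace, diag_apply, mul_apply (M := diagonal f * D * diagonal g), mul_diagonal,
    diagonal_mul]
  refine Finset.sum_congr rfl fun i _ => Finset.sum_congr rfl fun j _ => ?_
  rw [hD.apply i j]
  ring

theorem Matrix.trace_diagonal_mul_mul_self {ι : Type*} [Fintype ι] [DecidableEq ι]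
    (f : ι → ℝ) {D : Matrix ι ι ℝ} (hD : D.IsSymm) :
    trace (diagonal f * (D * D)) = ∑ i, ∑ j, f i * D i j ^ 2 := by
  simpa [Matrix.mul_assoc] using trace_diagonal_mul_mul_diagonal_mul f (fun _ => 1) hD

/-- If `f` and `g` are similarly ordered, moving the weight `g` across a symmetric matrix
increases the trace. -/
theorem Matrix.trace_diagonal_mul_mul_diagonal_mul_le {ι : Type*} [Fintype ι] [DecidableEq ι]
    {f g : ι → ℝ} (hfg : Monovary f g) {D : Matrix ι ι ℝ} (hD : D.IsSymm) :
    trace (diagonal f * D * diagonal g * D) ≤ trace (diagonal (f * g) * (D * D)) := by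
  rw [trace_diagonal_mul_mul_diagonal_mul f g hD, trace_diagonal_mul_mul_self (f * g) hD]
  have swap (F : ι → ι → ℝ) :
      ∑ i, ∑ j, F i j * D i j ^ 2 = ∑ i, ∑ j, F j i * D i j ^ 2 := by
    rw [Finset.sum_comm]
    simp only [hD.apply]
  have key : 0 ≤ ∑ i, ∑ j, (f i - f j) * (g i - g j) * D i j ^ 2 :=
    Finset.sum_nonneg fun i _ => Finset.sum_nonneg fun j _ =>
      mul_nonneg (monovary_iff_forall_mul_nonneg.1 hfg j i) (sq_nonneg _)
  have expand : ∑ i, ∑ j, (f i - f j) * (g i - g j) * D i j ^ 2 =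
      (∑ i, ∑ j, (f * g) i * D i j ^ 2 + ∑ i, ∑ j, (f * g) j * D i j ^ 2) -
      (∑ i, ∑ j, f i * g j * D i j ^ 2 + ∑ i, ∑ j, f j * g i * D i j ^ 2) := by
    simp only [← Finset.sum_add_distrib, ← Finset.sum_sub_distrib, Pi.mul_apply]
    refine Finset.sum_congr rfl fun i _ => Finset.sum_congr rfl fun j _ => ?_
    ring
  have h₁ := swap fun i _ => (f * g) i
  have h₂ := swap fun i j => f i * g j
  linarith

/-- For a positive definite `A`, a symmetric `Δ` and `α, β ≥ 0`,
`tr(A^α Δ A^β Δ) ≤ tr(A^{α+β} Δ²)`. -/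
theorem trace_power_shift {n : ℕ} (A Δ : Matrix (Fin n) (Fin n) ℝ) (hA : A.PosDef)
    (hΔ : Δ.IsSymm) (α β : ℝ) (hα : 0 ≤ α) (hβ : 0 ≤ β) :
    Matrix.trace (hA.rpow α * Δ * hA.rpow β * Δ)
      ≤ Matrix.trace (hA.rpow (α + β) * (Δ * Δ)) := by
  let U : Matrix (Fin n) (Fin n) ℝ := hA.1.eigenvectorUnitary
  let D := star U * Δ * U
  let p (γ : ℝ) (i : Fin n) : ℝ := hA.1.eigenvalues i ^ γ
  have hU : U * star U = 1 := Unitary.coe_mul_star_self _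
  have hrpow (γ : ℝ) : hA.rpow γ = U * diagonal (p γ) * star U := by
    simp only [Matrix.PosDef.rpow, Matrix.IsHermitian.cfc, Unitary.conjStarAlgAut_apply]
    rfl
  have hD : D.IsSymm := by
    simp only [D, IsSymm, star_eq_conjTranspose, conjTranspose_eq_transpose_of_trivial,
      transpose_mul, transpose_transpose, hΔ.eq, Matrix.mul_assoc]
  have hp : p (α + β) = p α * p β :=
    funext fun i => Real.rpow_add (hA.eigenvalues_pos i) α β
  have hmono : Monovary (p α) (p β) := by
    refine monovary_iff_forall_mul_nonneg.2 fun i j => ?_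
    have hi := (hA.eigenvalues_pos i).le
    have hj := (hA.eigenvalues_pos j).le
    rcases le_total (hA.1.eigenvalues i) (hA.1.eigenvalues j) with h | h
    · exact mul_nonneg (sub_nonneg.2 (Real.rpow_le_rpow hi h hα))
        (sub_nonneg.2 (Real.rpow_le_rpow hi h hβ))
    · exact mul_nonneg_of_nonpos_of_nonpos (sub_nonpos.2 (Real.rpow_le_rpow hj h hα))
        (sub_nonpos.2 (Real.rpow_le_rpow hj h hβ))
  have hleft : trace (hA.rpow α * Δ * hA.rpow β * Δ) =
      trace (diagonal (p α) * D * diagonal (p β) * D) := by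
    rw [hrpow, hrpow, Matrix.mul_assoc, Matrix.mul_assoc, Matrix.mul_assoc, Matrix.mul_assoc,
      trace_mul_comm]
    simp only [D, Matrix.mul_assoc]
  have hright : trace (hA.rpow (α + β) * (Δ * Δ)) =
      trace (diagonal (p α * p β) * (D * D)) := by
    have hDD : D * D = star U * (Δ * Δ) * U := by
      calc D * D = star U * Δ * (U * star U) * Δ * U := by simp only [D, Matrix.mul_assoc]
        _ = star U * (Δ * Δ) * U := by rw [hU]; simp only [Matrix.mul_one, Matrix.mul_assoc]
    rw [hrpow, hp, hDD, Matrix.mul_assoc, Matrix.mul_assoc, trace_mul_comm]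
    simp only [Matrix.mul_assoc]
  rw [hleft, hright]
  exact trace_diagonal_mul_mul_diagonal_mul_le hmono hD

end
end

section
/- Fix integers n, q ≥ 1 and Φ > 0, and for an n×n symmetric matrix X let u(X) be the unique real number u with X ≺ uI and tr((uI − X)^{−q}) = Φ. Then u is twice differentiable, its first Fréchet derivative in a symmetric direction H is Du(X)[H] = tr((uI−X)^{−(q+1)} H) / tr((uI−X)^{−(q+1)}), and its second derivative is D²u(X)[H₁,H₂] = [ Σ_{k=1}^{q+1} tr((uI−X)^{−k} H₁ (uI−X)^{−(q+2−k)} H₂) ] / tr((uI−X)^{−(q+1)}) − (q+1)·tr((uI−X)^{−(q+1)}H₁)·tr((uI−X)^{−(q+2)}H₂) / tr((uI−X)^{−(q+1)})² − (q+1)·tr((uI−X)^{−(q+1)}H₂)·tr((uI−X)^{−(q+2)}H₁) / tr((uI−X)^{−(q+1)})² + (q+1)·tr((uI−X)^{−(q+1)}H₁)·tr((uI−X)^{−(q+1)}H₂)·tr((uI−X)^{−(q+2)}) / tr((uI−X)^{−(q+1)})³, where u = u(X). -/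
open Matrix

noncomputable section

variable {n : ℕ}

/-- `(u X • 1 - X)⁻¹ ^ k`, the `k`-th power of the resolvent-type matrix. -/
def Res {n : ℕ} (u : Matrix (Fin n) (Fin n) ℝ → ℝ) (X : Matrix (Fin n) (Fin n) ℝ)
    (k : ℕ) : Matrix (Fin n) (Fin n) ℝ :=
  ((u X • (1 : Matrix (Fin n) (Fin n) ℝ) - X)⁻¹) ^ k

/-- The claimed first derivative `Du(X)[H]`. -/
def D1 {n : ℕ} (u : Matrix (Fin n) (Fin n) ℝ → ℝ) (q : ℕ) (X H : Matrix (Fin n) (Fin n) ℝ) :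
    ℝ :=
  Matrix.trace (Res u X (q + 1) * H) / Matrix.trace (Res u X (q + 1))

/-- The claimed second derivative `D²u(X)[H₁, H₂]`. -/
def D2 {n : ℕ} (u : Matrix (Fin n) (Fin n) ℝ → ℝ) (q : ℕ)
    (X H₁ H₂ : Matrix (Fin n) (Fin n) ℝ) : ℝ :=
  (∑ k ∈ Finset.Icc 1 (q + 1),
      Matrix.trace (Res u X k * H₁ * Res u X (q + 2 - k) * H₂)) /
      Matrix.trace (Res u X (q + 1))
    - (q + 1) * Matrix.trace (Res u X (q + 1) * H₁) * Matrix.trace (Res u X (q + 2) * H₂) /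
        Matrix.trace (Res u X (q + 1)) ^ 2
    - (q + 1) * Matrix.trace (Res u X (q + 1) * H₂) * Matrix.trace (Res u X (q + 2) * H₁) /
        Matrix.trace (Res u X (q + 1)) ^ 2
    + (q + 1) * Matrix.trace (Res u X (q + 1) * H₁) * Matrix.trace (Res u X (q + 1) * H₂) *
        Matrix.trace (Res u X (q + 2)) / Matrix.trace (Res u X (q + 1)) ^ 3

section Resolvent

variable {ι : Type*} [DecidableEq ι]

open Filter Topology
open scoped Matrix.Norms.L2Operator MatrixOrder

lemma Matrix.PosDef.shift_mono {X : Matrix ι ι ℝ} {t r : ℝ}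
    (ht : (t • (1 : Matrix ι ι ℝ) - X).PosDef) (hr : t ≤ r) :
    (r • (1 : Matrix ι ι ℝ) - X).PosDef := by
  have h := ht.add_posSemidef ((PosSemidef.one (n := ι) (R := ℝ)).smul (sub_nonneg.2 hr))
  convert h using 1
  rw [sub_smul]
  abel

variable [Fintype ι]

/-- A Hermitian matrix close to a positive definite one is positive definite. -/
lemma Matrix.PosDef.eventually_posDef_of_isHermitian {A : Matrix ι ι ℝ} (hA : A.PosDef) :
    ∀ᶠ B in 𝓝 A, B.IsHermitian → B.PosDef := by
  rcases isEmpty_or_nonempty ι with h | h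
  · refine Eventually.of_forall fun B _ => ?_
    rwa [Subsingleton.elim B A]
  obtain ⟨c, hc, hcA⟩ := (CFC.exists_pos_algebraMap_le_iff (a := A) hA.isHermitian).2
    fun x hx => hA.isStrictlyPositive.spectrum_pos hx
  filter_upwards [Metric.ball_mem_nhds A hc] with B hB hBh
  have hBA : IsSelfAdjoint (A - B) := hA.isHermitian.sub hBh
  have h1 : A - B ≤ algebraMap ℝ _ ‖A - B‖ := by
    have := FiniteDimensional.complete ℝ (Matrix ι ι ℝ)
    exact (le_algebraMap_iff_spectrum_le hBA).2 fun x hx =>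
      (le_abs_self x).trans (spectrum.norm_le_norm_of_mem hx)
  have h2 : 0 < c - ‖A - B‖ := by
    rw [Metric.mem_ball, dist_comm, dist_eq_norm] at hB
    linarith
  have h3 : ((c - ‖A - B‖) • (1 : Matrix ι ι ℝ)).PosDef := PosDef.one.smul h2
  have h4 : (B - (c - ‖A - B‖) • (1 : Matrix ι ι ℝ)).PosSemidef := by
    rw [← Matrix.le_iff]
    rw [Algebra.algebraMap_eq_smul_one] at h1 hcA
    calc (c - ‖A - B‖) • (1 : Matrix ι ι ℝ) = c • 1 - ‖A - B‖ • 1 := sub_smul _ _ _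
      _ ≤ A - (A - B) := sub_le_sub hcA h1
      _ = B := sub_sub_cancel _ _
  simpa using h3.add_posSemidef h4

lemma Matrix.PosDef.pow {A : Matrix ι ι ℝ} (hA : A.PosDef) (k : ℕ) : (A ^ k).PosDef :=
  (hA.posSemidef.pow k).posDef_iff_isUnit.2 (hA.isUnit.pow k)

/-- The derivative of `s ↦ tr((a(s) I - X - sH)⁻ᵏ B)`. -/
lemma hasDerivAt_trace_resolvent_pow_mul {a : ℝ → ℝ} {a' s : ℝ} (X H B : Matrix ι ι ℝ) (k : ℕ)
    (ha : HasDerivAt a a' s) (hu : IsUnit (a s • (1 : Matrix ι ι ℝ) - (X + s • H))) :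
    HasDerivAt (fun t => trace ((a t • (1 : Matrix ι ι ℝ) - (X + t • H))⁻¹ ^ k * B))
      (∑ i ∈ Finset.range k, trace ((a s • (1 : Matrix ι ι ℝ) - (X + s • H))⁻¹ ^ (k - i) * H *
          (a s • (1 : Matrix ι ι ℝ) - (X + s • H))⁻¹ ^ (i + 1) * B)
        - k * a' * trace ((a s • (1 : Matrix ι ι ℝ) - (X + s • H))⁻¹ ^ (k + 1) * B)) s := by
  have hM : HasDerivAt (fun t => a t • (1 : Matrix ι ι ℝ) - (X + t • H)) (a' • 1 - H) s := by
    have := (ha.smul_const (1 : Matrix ι ι ℝ)).sub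
      (((hasDerivAt_id s).smul_const H).const_add X)
    simpa using! this
  obtain ⟨U, hU⟩ := hu
  have hinv : HasDerivAt (fun t => (a t • (1 : Matrix ι ι ℝ) - (X + t • H))⁻¹)
      (-((a s • (1 : Matrix ι ι ℝ) - (X + s • H))⁻¹ * (a' • 1 - H) *
        (a s • (1 : Matrix ι ι ℝ) - (X + s • H))⁻¹)) s := by
    have h := hasFDerivAt_ringInverse (𝕜 := ℝ) U
    rw [hU] at h
    have h' := h.comp_hasDerivAt s hM
    simp only [nonsing_inv_eq_ringInverse]
    rw [← hU, Ring.inverse_unit]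
    simpa using! h'
  set R := (a s • (1 : Matrix ι ι ℝ) - (X + s • H))⁻¹ with hR
  let L : Matrix ι ι ℝ →L[ℝ] ℝ :=
    LinearMap.toContinuousLinearMap ((traceLinearMap ι ℝ ℝ).comp (LinearMap.mulRight ℝ B))
  have h := L.hasFDerivAt.comp_hasDerivAt s (hinv.fun_pow' k)
  refine h.congr_deriv ?_
  rw [← hR]
  change trace ((∑ i ∈ Finset.range k, R ^ (k.pred - i) * -(R * (a' • 1 - H) * R) * R ^ i) * B) = _
  have hconst : (k : ℝ) * a' * trace (R ^ (k + 1) * B)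
      = ∑ i ∈ Finset.range k, a' * trace (R ^ (k + 1) * B) := by
    simp [mul_assoc]
  rw [hconst, ← Finset.sum_sub_distrib, Finset.sum_mul, trace_sum]
  refine Finset.sum_congr rfl fun i hi => ?_
  have hi := Finset.mem_range.1 hi
  have e1 : R ^ (k - i) = R ^ (k.pred - i) * R := by
    rw [← pow_succ]; congr 1; simp only [Nat.pred_eq_sub_one]; omega
  have e2 : R ^ (k + 1) = R ^ (k.pred - i) * R * R ^ (i + 1) := by
    rw [← e1, ← pow_add]; congr 1; omega
  rw [e2, e1, pow_succ' R i, ← smul_eq_mul a', ← trace_smul, ← trace_sub]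
  congr 1
  noncomm_ring

lemma hasDerivAt_trace_resolvent_pow {a : ℝ → ℝ} {a' s : ℝ} (X H : Matrix ι ι ℝ) (k : ℕ)
    (ha : HasDerivAt a a' s) (hu : IsUnit (a s • (1 : Matrix ι ι ℝ) - (X + s • H))) :
    HasDerivAt (fun t => trace ((a t • (1 : Matrix ι ι ℝ) - (X + t • H))⁻¹ ^ k))
      (k * trace ((a s • (1 : Matrix ι ι ℝ) - (X + s • H))⁻¹ ^ (k + 1) * H)
        - k * a' * trace ((a s • (1 : Matrix ι ι ℝ) - (X + s • H))⁻¹ ^ (k + 1))) s := by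
  have h := hasDerivAt_trace_resolvent_pow_mul X H 1 k ha hu
  simp only [mul_one] at h
  refine h.congr_deriv ?_
  congr 1
  rw [← nsmul_eq_mul, ← Finset.card_range k, ← Finset.sum_const, Finset.card_range]
  refine Finset.sum_congr rfl fun i hi => ?_
  have hi := Finset.mem_range.1 hi
  rw [mul_assoc, trace_mul_comm, mul_assoc, trace_mul_comm, ← pow_add]
  congr 3
  omega

lemma hasDerivAt_trace_shift_inv_pow (X : Matrix ι ι ℝ) (k : ℕ) {t : ℝ}
    (hu : IsUnit (t • (1 : Matrix ι ι ℝ) - X)) :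
    HasDerivAt (fun r : ℝ => trace ((r • (1 : Matrix ι ι ℝ) - X)⁻¹ ^ k))
      (-(k * trace ((t • (1 : Matrix ι ι ℝ) - X)⁻¹ ^ (k + 1)))) t := by
  simpa using hasDerivAt_trace_resolvent_pow X 0 k (hasDerivAt_id t) (by simpa using hu)

/-- The trace of a positive power of the resolvent is strictly decreasing to the right of the
spectrum. -/
lemma trace_shift_inv_pow_lt [Nonempty ι] {X : Matrix ι ι ℝ} {k : ℕ} (hk : 1 ≤ k) {t r : ℝ}
    (ht : (t • (1 : Matrix ι ι ℝ) - X).PosDef) (hr : t < r) :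
    trace ((r • (1 : Matrix ι ι ℝ) - X)⁻¹ ^ k) < trace ((t • (1 : Matrix ι ι ℝ) - X)⁻¹ ^ k) := by
  have hpos : ∀ x ∈ Set.Ici t, (x • (1 : Matrix ι ι ℝ) - X).PosDef := fun x hx => ht.shift_mono hx
  refine strictAntiOn_of_deriv_neg (convex_Ici t) (f := fun r : ℝ =>
    trace ((r • (1 : Matrix ι ι ℝ) - X)⁻¹ ^ k)) ?_ ?_ Set.self_mem_Ici hr.le hr
  · exact fun x hx =>
      (hasDerivAt_trace_shift_inv_pow X k (hpos x hx).isUnit).continuousAt.continuousWithinAt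
  · intro x hx
    have hx' := hpos x (interior_subset hx)
    rw [(hasDerivAt_trace_shift_inv_pow X k hx'.isUnit).deriv]
    have := (hx'.inv.pow (k + 1)).trace_pos
    have : (0 : ℝ) < k := by exact_mod_cast hk
    rw [neg_lt_zero]
    positivity

lemma eq_of_trace_shift_inv_pow_eq [Nonempty ι] {X : Matrix ι ι ℝ} {k : ℕ} (hk : 1 ≤ k) {t r : ℝ}
    (ht : (t • (1 : Matrix ι ι ℝ) - X).PosDef) (hr : (r • (1 : Matrix ι ι ℝ) - X).PosDef)
    (h : trace ((t • (1 : Matrix ι ι ℝ) - X)⁻¹ ^ k) = trace ((r • (1 : Matrix ι ι ℝ) - X)⁻¹ ^ k)) :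
    t = r := by
  rcases lt_trichotomy t r with hlt | rfl | hlt
  · exact absurd h (trace_shift_inv_pow_lt hk ht hlt).ne'
  · rfl
  · exact absurd h (trace_shift_inv_pow_lt hk hr hlt).ne

/-- A solution of `tr((a(s) I - X - sH)⁻ᵏ) = Φ` to the right of the spectrum is differentiable. -/
lemma differentiableAt_of_trace_resolvent_pow_eq [Nonempty ι] {X H : Matrix ι ι ℝ} {k : ℕ}
    (hk : 1 ≤ k) {Φ : ℝ} {a : ℝ → ℝ} (hX : X.IsHermitian) (hH : H.IsHermitian)
    (hpos : ∀ s, (a s • (1 : Matrix ι ι ℝ) - (X + s • H)).PosDef)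
    (htr : ∀ s, trace ((a s • (1 : Matrix ι ι ℝ) - (X + s • H))⁻¹ ^ k) = Φ) :
    DifferentiableAt ℝ a 0 := by
  let M : ℝ × ℝ → Matrix ι ι ℝ := fun p => p.2 • (1 : Matrix ι ι ℝ) - (X + p.1 • H)
  have hMc : ContDiff ℝ 1 M := by fun_prop
  have hM0 : (M (0, a 0)).PosDef := hpos 0
  obtain ⟨U, hU⟩ := hM0.isUnit
  have hF : ContDiffAt ℝ 1 (fun p => trace ((M p)⁻¹ ^ k)) (0, a 0) := by
    have h1 : ContDiffAt ℝ 1 Ring.inverse (M (0, a 0)) := hU ▸ contDiffAt_ringInverse ℝ U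
    have h2 := (h1.comp (0, a 0) hMc.contDiffAt).pow k
    have h3 := (LinearMap.toContinuousLinearMap (traceLinearMap ι ℝ ℝ)).contDiff.contDiffAt.comp
      (0, a 0) h2
    simp only [nonsing_inv_eq_ringInverse]
    exact h3
  have hpartial : (fderiv ℝ (fun p => trace ((M p)⁻¹ ^ k)) (0, a 0)) (0, 1) ≠ 0 := by
    have h1 := ((hF.differentiableAt one_ne_zero).hasFDerivAt).comp_hasDerivAt (a 0)
      ((hasDerivAt_const (a 0) (0 : ℝ)).prodMk (hasDerivAt_id (a 0)))
    have h2 : HasDerivAt (fun t : ℝ => trace ((M (0, t))⁻¹ ^ k)) _ (a 0) :=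
      hasDerivAt_trace_shift_inv_pow (X + (0 : ℝ) • H) k (hpos 0).isUnit
    rw [h1.unique h2]
    have := ((hpos 0).inv.pow (k + 1)).trace_pos
    have : (0 : ℝ) < k := by exact_mod_cast hk
    rw [neg_ne_zero]
    positivity
  have hinv : (fderiv ℝ (fun p => trace ((M p)⁻¹ ^ k)) (0, a 0) ∘L
      .inr ℝ ℝ ℝ).IsInvertible := by
    refine ⟨ContinuousLinearEquiv.unitsEquivAut ℝ (Units.mk0 _ hpartial), ?_⟩
    ext
    simp
  have hd := (hF.hasStrictFDerivAt_implicitFunction one_ne_zero hinv).hasFDerivAt.differentiableAt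
  have himp := hF.eventually_apply_implicitFunction one_ne_zero hinv
  have hself := hF.implicitFunction_apply_self one_ne_zero hinv
  set ψ := hF.implicitFunction one_ne_zero hinv
  have hMψ : Tendsto (fun s => M (s, ψ s)) (𝓝 0) (𝓝 (M (0, a 0))) := by
    refine (hMc.continuous.tendsto _).comp ?_
    have := (continuousAt_id (x := (0 : ℝ))).prodMk hd.continuousAt
    rwa [ContinuousAt, hself] at this
  refine hd.congr_of_eventuallyEq ?_
  filter_upwards [himp, hMψ.eventually hM0.eventually_posDef_of_isHermitian] with s hs hs'
  refine eq_of_trace_shift_inv_pow_eq hk (hpos s) (hs' ?_) ?_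
  · exact (isHermitian_one.smul (IsSelfAdjoint.all _)).sub
      (hX.add (hH.smul (IsSelfAdjoint.all _)))
  · rw [htr s]
    exact (htr 0).symm.trans hs.symm

end Resolvent

/-- Derivatives of the Stieltjes-barrier potential: if `u` satisfies
`X ≺ u(X)·I` and `tr((u(X)·I − X)^{−q}) = Φ` on symmetric matrices, then along symmetric
directions the first (Gateaux/Fréchet) derivative of `u` is
`Du(X)[H] = tr((uI−X)^{−(q+1)}H)/tr((uI−X)^{−(q+1)})` and the second derivative
`D²u(X)[H₁,H₂] = d/ds Du(X+sH₂)[H₁]|₀` is given by the stated formula. -/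
theorem barrier_derivatives (q : ℕ) (hq : 1 ≤ q) (Φ : ℝ) (hΦ : 0 < Φ)
    (u : Matrix (Fin n) (Fin n) ℝ → ℝ)
    (hu : ∀ X : Matrix (Fin n) (Fin n) ℝ, X.IsSymm →
      (u X • (1 : Matrix (Fin n) (Fin n) ℝ) - X).PosDef ∧
      Matrix.trace (Res u X q) = Φ) :
    ∀ X H₁ H₂ : Matrix (Fin n) (Fin n) ℝ, X.IsSymm → H₁.IsSymm → H₂.IsSymm →
      HasDerivAt (fun s : ℝ => u (X + s • H₁)) (D1 u q X H₁) 0 ∧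
      HasDerivAt (fun s : ℝ => D1 u q (X + s • H₂) H₁) (D2 u q X H₁ H₂) 0 := by
  have hn : Nonempty (Fin n) := by
    by_contra h
    rw [not_nonempty_iff] at h
    have := (hu 0 isSymm_zero).2
    simp [trace] at this
    exact hΦ.ne this
  have hq0 : (q : ℝ) ≠ 0 := by exact_mod_cast (by omega : q ≠ 0)
  have hline : ∀ X H : Matrix (Fin n) (Fin n) ℝ, X.IsSymm → H.IsSymm → ∀ s : ℝ,
      (X + s • H).IsSymm := fun X H hX hH s => hX.add (hH.smul s)
  have first : ∀ X H : Matrix (Fin n) (Fin n) ℝ, X.IsSymm → H.IsSymm →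
      HasDerivAt (fun s : ℝ => u (X + s • H)) (D1 u q X H) 0 := by
    intro X H hX hH
    have hd := (differentiableAt_of_trace_resolvent_pow_eq hq (a := fun s => u (X + s • H))
      (by simpa [IsHermitian] using! hX) (by simpa [IsHermitian] using! hH)
      (fun s => (hu _ (hline X H hX hH s)).1)
      (fun s => (hu _ (hline X H hX hH s)).2)).hasDerivAt
    have h1 := hasDerivAt_trace_resolvent_pow X H q hd (hu _ (hline X H hX hH 0)).1.isUnit
    have h2 := h1.unique ((hasDerivAt_const (0 : ℝ) Φ).congr_of_eventuallyEq
      (Filter.Eventually.of_forall fun s => (hu _ (hline X H hX hH s)).2))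
    have hpos := ((hu X hX).1.inv.pow (q + 1)).trace_pos
    refine hd.congr_deriv ?_
    simp only [zero_smul, add_zero] at h2
    rw [D1, Res, eq_div_iff hpos.ne']
    refine mul_left_cancel₀ hq0 ?_
    linarith
  intro X H₁ H₂ hX hH₁ hH₂
  refine ⟨first X H₁ hX hH₁, ?_⟩
  have hd := first X H₂ hX hH₂
  have hunit := (hu _ (hline X H₂ hX hH₂ 0)).1.isUnit
  have hN := hasDerivAt_trace_resolvent_pow_mul X H₂ H₁ (q + 1) hd hunit
  have hD := hasDerivAt_trace_resolvent_pow X H₂ (q + 1) hd hunit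
  have hpos := ((hu X hX).1.inv.pow (q + 1)).trace_pos
  have hdiv := hN.fun_div hD (by simpa using hpos.ne')
  refine hdiv.congr_deriv ?_
  simp only [zero_smul, add_zero]
  have hsum : ∑ k ∈ Finset.Icc 1 (q + 1),
      trace (Res u X k * H₁ * Res u X (q + 2 - k) * H₂) =
      ∑ i ∈ Finset.range (q + 1), trace ((u X • (1 : Matrix (Fin n) (Fin n) ℝ) - X)⁻¹ ^ (q + 1 - i)
        * H₂ * (u X • (1 : Matrix (Fin n) (Fin n) ℝ) - X)⁻¹ ^ (i + 1) * H₁) := by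
    rw [← Finset.Ico_add_one_right_eq_Icc, Finset.sum_Ico_eq_sum_range]
    refine Finset.sum_congr rfl fun k _ => ?_
    rw [Res, Res, mul_assoc, trace_mul_comm, ← mul_assoc, add_comm 1 k,
      show q + 2 - (k + 1) = q + 1 - k by omega]
  rw [D2, hsum, D1]
  simp only [Res] at hpos ⊢
  push_cast
  field_simp
  ring

end
end
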